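/- Every holomorphic vector bundle on the surface Z_k = Tot(O_{P^1}(-k)) is algebraic. -/

import Mathlib

/-!  Common setup: the local surfaces `Z_k = Tot 𝒪_{ℙ¹}(-k)`.

`Z_k` is covered by the two canonical coordinate charts `U = ℂ²_{z,u}` and
`V = ℂ²_{ξ,v}`, glued over `ℂ* × ℂ` by `(ξ, v) = (z⁻¹, z^k u)`.  Since every
holomorphic vector bundle on a chart `ℂ²` is trivial (Oka–Grauert), a
holomorphic rank `r` vector bundle on `Z_k` is presented by its transition
matrix in canonical coordinates, and all the numerical invariants (splitting
type, width `h⁰(Q)`, height `h⁰(R¹π_*E)`, local charge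
`c₂^{loc} = χ(ℓ,E) = width + height`) are computed, as in the paper, by Čech
cohomology in canonical coordinates. -/

noncomputable section

open Matrix

/-- The overlap `U ∩ V` of the two canonical charts, in `U`-coordinates:
the locus `z ≠ 0`. -/
def overlap : Set (ℂ × ℂ) := {p | p.1 ≠ 0}

/-- The change of canonical coordinates of `Z_k`: `(z, u) ↦ (ξ, v) = (z⁻¹, z^k u)`. -/
def coordChange (k : ℕ) (p : ℂ × ℂ) : ℂ × ℂ := (p.1⁻¹, p.1 ^ k * p.2)

/-- A holomorphic rank `r` vector bundle on `Z_k`, presented by its transition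
matrix in the canonical coordinates (`U`-frame vs. `V`-frame). -/
structure BundleData (r k : ℕ) where
  T : ℂ × ℂ → Matrix (Fin r) (Fin r) ℂ
  holo : ∀ i j, DifferentiableOn ℂ (fun p => T p i j) overlap
  invertible : ∀ p ∈ overlap, IsUnit (T p)

/-- A holomorphic family of invertible `r × r` matrices on `s ⊆ ℂ²`. -/
def HoloGL (r : ℕ) (s : Set (ℂ × ℂ)) (A : ℂ × ℂ → Matrix (Fin r) (Fin r) ℂ) : Prop :=
  (∀ i j, DifferentiableOn ℂ (fun p => A p i j) s) ∧ ∀ p ∈ s, IsUnit (A p)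

/-- Isomorphism of holomorphic bundles on `Z_k`, in terms of transition
matrices: `T' = A ⬝ T ⬝ B⁻¹` with `A` holomorphic invertible on the chart `U`
and `B` holomorphic invertible on the chart `V`. -/
def BIso {r k : ℕ} (E E' : BundleData r k) : Prop :=
  ∃ A B : ℂ × ℂ → Matrix (Fin r) (Fin r) ℂ,
    HoloGL r Set.univ A ∧ HoloGL r Set.univ B ∧
    ∀ p ∈ overlap, E'.T p = A p * E.T p * (B (coordChange k p))⁻¹

/-- `c₁(E) = 0`:  the determinant line bundle of `E` is holomorphically
trivial, i.e. `det T` is a coboundary of nonvanishing holomorphic functions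
on the two charts. -/
def FirstChernZero {r k : ℕ} (E : BundleData r k) : Prop :=
  ∃ a b : ℂ × ℂ → ℂ, Differentiable ℂ a ∧ Differentiable ℂ b ∧
    (∀ p, a p ≠ 0) ∧ (∀ p, b p ≠ 0) ∧
    ∀ p ∈ overlap, (E.T p).det = a p * b (coordChange k p)

/-- `E` has splitting type `j`:  the restriction `E|_ℓ` to the zero section
`ℓ ≅ ℙ¹` (cut out by `u = 0`) splits as `𝒪_{ℙ¹}(j) ⊕ 𝒪_{ℙ¹}(-j)`, i.e. the
restricted transition matrix `T(z,0)` is equivalent, over the standard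
two-chart cover of `ℙ¹`, to `diag(z^j, z^{-j})`. -/
def SplittingType {k : ℕ} (E : BundleData 2 k) (j : ℕ) : Prop :=
  ∃ A B : ℂ → Matrix (Fin 2) (Fin 2) ℂ,
    (∀ i l, Differentiable ℂ fun z => A z i l) ∧
    (∀ i l, Differentiable ℂ fun z => B z i l) ∧
    (∀ z, IsUnit (A z)) ∧ (∀ z, IsUnit (B z)) ∧
    ∀ z : ℂ, z ≠ 0 → E.T (z, 0) = A z * !![z ^ j, 0; 0, (z ^ j)⁻¹] * (B z⁻¹)⁻¹

/-- Holomorphic `ℂ^r`-valued maps on a subset `s ⊆ ℂ²`. -/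
def HoloVec (r : ℕ) (s : Set (ℂ × ℂ)) (f : ℂ × ℂ → Fin r → ℂ) : Prop :=
  ∀ i, DifferentiableOn ℂ (fun p => f p i) s

/-- Čech 1-cochains for `E` on the cover `{U, V}`: sections of `E` over
`U ∩ V`, written in the `U`-frame. -/
def cochains (r : ℕ) : Set ((ℂ × ℂ) → (Fin r → ℂ)) := {f | HoloVec r overlap f}

/-- Čech coboundaries: sums `a + T ⬝ (b ∘ coordChange)` of a holomorphic
section over `U` and one over `V`. -/
def coboundaries {r k : ℕ} (E : BundleData r k) : Set ((ℂ × ℂ) → (Fin r → ℂ)) :=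
  {f | ∃ a b, HoloVec r Set.univ a ∧ HoloVec r Set.univ b ∧
      ∀ p ∈ overlap, f p = a p + (E.T p).mulVec (b (coordChange k p))}

/-- The *height* `h⁰(R¹π_* E)` of `E`, where `π : Z_k → X_k` contracts `ℓ`:
by the theorem on formal functions it is computed as the dimension of the
Čech cohomology `H¹(Z_k, E)` in canonical coordinates (the sets of cochains
and coboundaries are `ℂ`-subspaces, so taking spans changes nothing). -/
def height {r k : ℕ} (E : BundleData r k) : ℕ :=
  Module.finrank ℂ
    (↥(Submodule.span ℂ (cochains r)) ⧸
      (Submodule.comap (Submodule.span ℂ (cochains r)).subtype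
        (Submodule.span ℂ (coboundaries E))))

/-- Sections of `E` over `Z_k ∖ ℓ`, in the `U`-frame: holomorphic on
`U ∖ ℓ = {u ≠ 0}` and matching a holomorphic section on `V ∖ ℓ = {v ≠ 0}`
via the transition matrix.  These are the sections of the reflexive hull
`(π_* E)^{∨∨} ` over `X_k`. -/
def outerSections {r k : ℕ} (E : BundleData r k) : Set ((ℂ × ℂ) → (Fin r → ℂ)) :=
  {f | HoloVec r {p | p.2 ≠ 0} f ∧ ∃ b, HoloVec r {p | p.2 ≠ 0} b ∧
      ∀ p : ℂ × ℂ, p.1 ≠ 0 → p.2 ≠ 0 → f p = (E.T p).mulVec (b (coordChange k p))}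

/-- Global sections of `E` over `Z_k`, i.e. sections of `π_* E`, in the
`U`-frame. -/
def globalSections {r k : ℕ} (E : BundleData r k) : Set ((ℂ × ℂ) → (Fin r → ℂ)) :=
  {f | HoloVec r Set.univ f ∧ ∃ b, HoloVec r Set.univ b ∧
      ∀ p ∈ overlap, f p = (E.T p).mulVec (b (coordChange k p))}

/-- The *width* `h⁰(Q)` of `E`, where `Q` is the skyscraper sheaf in
`0 → π_*E → (π_*E)^{∨∨} → Q → 0`:  the dimension of
`Γ(Z_k ∖ ℓ, E) / Γ(Z_k, E)`. -/
def width {r k : ℕ} (E : BundleData r k) : ℕ :=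
  Module.finrank ℂ
    (↥(Submodule.span ℂ (outerSections E)) ⧸
      (Submodule.comap (Submodule.span ℂ (outerSections E)).subtype
        (Submodule.span ℂ (globalSections E))))

/-- The local charge (local second Chern class `c₂^{loc}`, equal to the local
holomorphic Euler characteristic `χ(ℓ, E) = h⁰(Q) + h⁰(R¹π_*E)`) of `E`
around the zero section `ℓ ⊆ Z_k`. -/
def localCharge {r k : ℕ} (E : BundleData r k) : ℕ := width E + height E

/-- The transition matrix `[[z^j, p],[0, z^{-j}]]` of the extension
`0 → 𝒪(-j) → E → 𝒪(j) → 0` with extension class `p ∈ Ext¹(𝒪(j), 𝒪(-j))`. -/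
def extMatrix (j : ℕ) (p : ℂ × ℂ → ℂ) (q : ℂ × ℂ) : Matrix (Fin 2) (Fin 2) ℂ :=
  !![q.1 ^ j, p q; 0, (q.1 ^ j)⁻¹]

/-- The rank 2 bundle on `Z_k` with `c₁ = 0`, splitting type `j` and extension
class `p`, given in canonical coordinates by the transition matrix
`[[z^j, p],[0, z^{-j}]]`. -/
def extBundle (k j : ℕ) (p : ℂ × ℂ → ℂ) (hp : DifferentiableOn ℂ p overlap) :
    BundleData 2 k where
  T := extMatrix j p
  holo := by
    intro i l
    fin_cases i <;> fin_cases l <;>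
      simp only [extMatrix, Matrix.cons_val', Matrix.cons_val_zero, Matrix.cons_val_one,
        Matrix.head_cons, Matrix.empty_val', Matrix.cons_val_fin_one, Matrix.head_fin_const,
        Matrix.of_apply, Fin.isValue]
    · exact (differentiable_fst.pow j).differentiableOn
    · exact hp
    · exact differentiableOn_const 0
    · exact DifferentiableOn.inv ((differentiable_fst.pow j).differentiableOn)
        (fun q hq => pow_ne_zero j hq)
  invertible := by
    intro q hq
    rw [Matrix.isUnit_iff_isUnit_det]
    have hdet : (extMatrix j p q).det = 1 := by
      have hq1 : q.1 ≠ 0 := hq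
      simp [extMatrix, Matrix.det_fin_two_of, mul_inv_cancel₀ (pow_ne_zero j hq1)]
    rw [hdet]; exact isUnit_one


/-- `f` is a regular (algebraic) function on the overlap
`U ∩ V = ℂ* × ℂ ⊆ Z_k`: it is given by a polynomial in `z`, `z⁻¹` and `u`. -/
def RegularOnOverlap (f : ℂ × ℂ → ℂ) : Prop :=
  ∃ P : MvPolynomial (Fin 3) ℂ,
    ∀ p ∈ overlap, f p = MvPolynomial.eval ![p.1, p.1⁻¹, p.2] P

section SeveralVariables

variable {E : Type*} [NormedAddCommGroup E] [NormedSpace ℂ E]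
variable {X : Type*} [NormedAddCommGroup X] [NormedSpace ℂ X]

/-- Cauchy's estimate for the Fréchet derivative of a bounded holomorphic function. -/
theorem norm_fderiv_le_of_bounded_on_ball {f : X → E} {x : X} {r M : ℝ} (hr : 0 < r)
    (hf : DifferentiableOn ℂ f (Metric.ball x r)) (hM : ∀ y ∈ Metric.ball x r, ‖f y‖ ≤ M) :
    ‖fderiv ℂ f x‖ ≤ 2 * M / r := by
  have hM0 : 0 ≤ M := (norm_nonneg _).trans (hM x (Metric.mem_ball_self hr))
  refine ContinuousLinearMap.opNorm_le_bound _ (by positivity) fun v => ?_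
  rcases eq_or_ne v 0 with rfl | hv
  · simp
  have hv' : 0 < ‖v‖ := norm_pos_iff.2 hv
  set ρ : ℝ := r / (2 * ‖v‖) with hρ
  have hρ0 : 0 < ρ := by positivity
  have hmem : ∀ t : ℂ, ‖t‖ ≤ ρ → x + t • v ∈ Metric.ball x r := by
    intro t ht
    rw [mem_ball_iff_norm, add_sub_cancel_left, norm_smul]
    calc ‖t‖ * ‖v‖ ≤ ρ * ‖v‖ := by gcongr
      _ = r / 2 := by rw [hρ]; field_simp
      _ < r := by linarith
  have hdiff : ∀ t : ℂ, ‖t‖ ≤ ρ → DifferentiableAt ℂ (fun t : ℂ => f (x + t • v)) t := by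
    intro t ht
    have h1 : DifferentiableAt ℂ f (x + t • v) :=
      (hf _ (hmem t ht)).differentiableAt (Metric.isOpen_ball.mem_nhds (hmem t ht))
    exact h1.comp t (by fun_prop)
  have hd : deriv (fun t : ℂ => f (x + t • v)) 0 = fderiv ℂ f x v := by
    have h1 : HasFDerivAt f (fderiv ℂ f x) (x + (0 : ℂ) • v) := by
      simpa using ((hf x (Metric.mem_ball_self hr)).differentiableAt
        (Metric.ball_mem_nhds x hr)).hasFDerivAt
    have h2 : HasDerivAt (fun t : ℂ => x + t • v) v 0 := by
      simpa using ((hasDerivAt_id (0 : ℂ)).smul_const v).const_add x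
    exact (h1.comp_hasDerivAt 0 h2).deriv
  rw [← hd]
  have := Complex.norm_deriv_le_of_forall_mem_sphere_norm_le (c := 0) (R := ρ) (C := M)
    (f := fun t : ℂ => f (x + t • v)) hρ0
    (DifferentiableOn.diffContOnCl fun t ht => (hdiff t (by
      have := Metric.closure_ball_subset_closedBall ht
      simpa using this)).differentiableWithinAt)
    (fun t ht => hM _ (hmem t (by simpa using (mem_sphere_iff_norm.1 ht).le)))
  calc _ ≤ M / ρ := this
    _ = 2 * M / r * ‖v‖ := by rw [hρ]; field_simp

/-- The Weierstrass M-test for holomorphic functions of several variables. -/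
theorem differentiableOn_tsum_of_norm_le [CompleteSpace E] {ι : Type*}
    {f : ι → X → E} {b : ι → ℝ} {s : Set X}
    (hs : IsOpen s) (hf : ∀ i, DifferentiableOn ℂ (f i) s) (hb : Summable b)
    (hfb : ∀ i, ∀ x ∈ s, ‖f i x‖ ≤ b i) :
    DifferentiableOn ℂ (fun x => ∑' i, f i x) s := by
  intro x hx
  obtain ⟨r, hr, hrs⟩ := Metric.isOpen_iff.1 hs x hx
  have hball : Metric.ball x (r / 2) ⊆ s := (Metric.ball_subset_ball (by linarith)).trans hrs
  have key := hasFDerivAt_tsum_of_isPreconnected (𝕜 := ℂ) (f := f)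
    (f' := fun i y => fderiv ℂ (f i) y)
    (u := fun i => 2 * b i / (r / 2)) (s := Metric.ball x (r / 2)) (x₀ := x) (x := x)
    ((hb.mul_left 2).div_const _) Metric.isOpen_ball
    (by
      let _ : NormedSpace ℝ X := NormedSpace.restrictScalars ℝ ℂ X
      exact (convex_ball x (r / 2)).isPreconnected)
    (fun i y hy => ((hf i y (hball hy)).differentiableAt (hs.mem_nhds (hball hy))).hasFDerivAt)
    (fun i y hy => by
      have hsub : Metric.ball y (r / 2) ⊆ s := by
        refine (Metric.ball_subset_ball' ?_).trans hrs
        have := Metric.mem_ball.1 hy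
        linarith
      exact norm_fderiv_le_of_bounded_on_ball (by linarith) ((hf i).mono hsub)
        fun z hz => hfb i z (hsub hz))
    (Metric.mem_ball_self (by linarith))
    (Summable.of_norm_bounded hb fun i => hfb i x hx)
    (Metric.mem_ball_self (by linarith))
  exact key.differentiableAt.differentiableWithinAt

end SeveralVariables

section Expansions

open Metric Set Filter Topology MeasureTheory

variable {E : Type*} [NormedAddCommGroup E] [NormedSpace ℂ E]

/-- The geometric expansion, at infinity, of a Cauchy integral. -/
theorem hasSum_circleIntegral_inv_sub_outside {f : ℂ → E} {r : ℝ} {z : ℂ} (hr : 0 < r)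
    (hf : CircleIntegrable f 0 r) (hz : r < ‖z‖) :
    HasSum (fun n : ℕ => ∮ w in C(0, r), (w / z) ^ n • z⁻¹ • f w)
      (∮ w in C(0, r), (z - w)⁻¹ • f w) := by
  have hz0 : 0 < ‖z‖ := hr.trans hz
  have hz' : z ≠ 0 := norm_pos_iff.1 hz0
  have hq : r / ‖z‖ ∈ Ico (0 : ℝ) 1 := ⟨by positivity, (div_lt_one hz0).2 hz⟩
  refine intervalIntegral.hasSum_integral_of_dominated_convergence
      (fun n θ => ‖f (circleMap 0 r θ)‖ * (r * ‖z‖⁻¹) * (r / ‖z‖) ^ n)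
      (fun n => ?_) (fun n => ?_) ?_ ?_ ?_
  · simp only [deriv_circleMap]
    apply_rules [AEStronglyMeasurable.smul, hf.def'.1] <;> apply Measurable.aestronglyMeasurable
    · fun_prop
    · fun_prop
    · fun_prop
  · refine Eventually.of_forall fun θ _ => le_of_eq ?_
    simp [norm_smul, abs_of_pos hr]
    ring
  · exact Eventually.of_forall fun _ _ => (summable_geometric_of_lt_one hq.1 hq.2).mul_left _
  · simp only [tsum_mul_left, tsum_geometric_of_lt_one hq.1 hq.2, mul_assoc]
    exact hf.norm.mul_continuousOn continuousOn_const
  · refine Eventually.of_forall fun θ _ => HasSum.const_smul _ ?_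
    simp only [smul_smul]
    refine HasSum.smul_const ?_ _
    have : ‖circleMap 0 r θ / z‖ < 1 := by simpa [abs_of_pos hr] using hq.2
    convert! (hasSum_geometric_of_norm_lt_one this).mul_right z⁻¹ using 1
    rw [← mul_inv, sub_mul, one_mul, div_mul_cancel₀ _ hz']

/-- Laurent expansion on an annulus, with Cauchy estimates. -/
theorem exists_laurent [CompleteSpace E] {R R₁ M : ℝ} (hR₁ : 1 < R₁) (hR : R₁ < R) {f : ℂ → E}
    (hf : DifferentiableOn ℂ f {z | R⁻¹ < ‖z‖ ∧ ‖z‖ < R})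
    (hM : ∀ z, R⁻¹ < ‖z‖ → ‖z‖ < R → ‖f z‖ ≤ M) :
    ∃ c : ℤ → E, (∀ m, ‖c m‖ ≤ M * (R₁ ^ m.natAbs)⁻¹) ∧
      ∀ z, R₁⁻¹ < ‖z‖ → ‖z‖ < R₁ → HasSum (fun m => z ^ m • c m) (f z) := by
  have h0 : 0 < R₁ := by linarith
  have h0' : 0 < R₁⁻¹ := inv_pos.2 h0
  have hinv : R⁻¹ < R₁⁻¹ := inv_strictAnti₀ h0 hR
  have hlt1 : R₁⁻¹ < 1 := inv_lt_one_of_one_lt₀ hR₁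
  have hlt : R₁⁻¹ < R₁ := hlt1.trans hR₁
  set s : Set ℂ := {z | R⁻¹ < ‖z‖ ∧ ‖z‖ < R} with hs
  have hso : IsOpen s := by
    simp only [hs, ofPred_and]
    exact (isOpen_lt continuous_const continuous_norm).inter
      (isOpen_lt continuous_norm continuous_const)
  have hsph : ∀ ρ, R₁⁻¹ ≤ ρ → ρ ≤ R₁ → sphere (0 : ℂ) ρ ⊆ s := by
    intro ρ h1 h2 w hw
    have : ‖w‖ = ρ := by simpa using hw
    exact ⟨by linarith, by linarith⟩
  have hcont : ∀ ρ, R₁⁻¹ ≤ ρ → ρ ≤ R₁ → ContinuousOn f (sphere 0 ρ) := fun ρ h1 h2 =>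
    hf.continuousOn.mono (hsph ρ h1 h2)
  have hcirc : ∀ ρ, R₁⁻¹ ≤ ρ → ρ ≤ R₁ → CircleIntegrable f 0 ρ := fun ρ h1 h2 =>
    (hcont ρ h1 h2).circleIntegrable (h0'.le.trans h1)
  have hMs : ∀ ρ, R₁⁻¹ ≤ ρ → ρ ≤ R₁ → ∀ w ∈ sphere (0 : ℂ) ρ, ‖f w‖ ≤ M :=
    fun ρ h1 h2 w hw => hM w (hsph ρ h1 h2 hw).1 (hsph ρ h1 h2 hw).2
  let lc : ℝ → ℤ → E := fun ρ m =>
    (2 * Real.pi * Complex.I : ℂ)⁻¹ • ∮ w in C(0, ρ), w ^ (-m - 1) • f w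
  have hlc : ∀ ρ, R₁⁻¹ ≤ ρ → ρ ≤ R₁ → ∀ m, ‖lc ρ m‖ ≤ M * ρ ^ (-m) := by
    intro ρ h1 h2 m
    have hρ : 0 < ρ := h0'.trans_le h1
    refine (circleIntegral.norm_two_pi_i_inv_smul_integral_le_of_norm_le_const
      (C := ρ ^ (-m - 1) * M) hρ.le ?_).trans (le_of_eq ?_)
    · intro w hw
      have hw' : ‖w‖ = ρ := by simpa using hw
      rw [norm_smul, norm_zpow, hw']
      exact mul_le_mul_of_nonneg_left (hMs ρ h1 h2 w hw) (by positivity)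
    · rw [zpow_sub_one₀ hρ.ne']
      field_simp
  refine ⟨fun m => if 0 ≤ m then lc R₁ m else lc R₁⁻¹ m, ?_, ?_⟩
  · intro m
    rcases le_or_gt 0 m with hm | hm
    · simp only [if_pos hm]
      refine (hlc R₁ hlt.le le_rfl m).trans (le_of_eq ?_)
      obtain ⟨n, rfl⟩ := Int.eq_ofNat_of_zero_le hm
      simp
    · simp only [if_neg (not_le.2 hm)]
      refine (hlc R₁⁻¹ le_rfl hlt.le m).trans (le_of_eq ?_)
      obtain ⟨n, hn⟩ := Int.eq_ofNat_of_zero_le (neg_nonneg.2 hm.le)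
      have : m.natAbs = n := by omega
      rw [hn, this]
      simp
  intro z hz1 hz2
  have hz0 : 0 < ‖z‖ := h0'.trans hz1
  have hz : z ≠ 0 := norm_pos_iff.1 hz0
  have hpi : (2 * Real.pi * Complex.I : ℂ) ≠ 0 := Complex.two_pi_I_ne_zero
  have hzs : z ∈ s := ⟨hinv.trans hz1, hz2.trans hR⟩
  have hg : DifferentiableOn ℂ (dslope f z) s :=
    (Complex.differentiableOn_dslope (hso.mem_nhds hzs)).2 hf
  have hsub : closedBall (0 : ℂ) R₁ \ ball 0 R₁⁻¹ ⊆ s := by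
    intro w hw
    simp only [Set.mem_sdiff, mem_closedBall, dist_zero_right, mem_ball, not_lt] at hw
    exact ⟨hinv.trans_le hw.2, hw.1.trans_lt hR⟩
  have hannulus := Complex.circleIntegral_eq_of_differentiable_on_annulus_off_countable
    h0' hlt.le countable_empty (hg.continuousOn.mono hsub) (by
      intro w hw
      have hw' : w ∈ s := hsub ⟨ball_subset_closedBall hw.1.1,
        fun h => hw.1.2 (ball_subset_closedBall h)⟩
      exact (hg w hw').differentiableAt (hso.mem_nhds hw'))
  have hsplit : ∀ ρ, R₁⁻¹ ≤ ρ → ρ ≤ R₁ → ρ ≠ ‖z‖ →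
      (∮ w in C(0, ρ), dslope f z w) =
        (∮ w in C(0, ρ), (w - z)⁻¹ • f w) - (∮ w in C(0, ρ), (w - z)⁻¹) • f z := by
    intro ρ h1 h2 h3
    have hρ : 0 ≤ ρ := h0'.le.trans h1
    have hne : ∀ w ∈ sphere (0 : ℂ) ρ, w - z ≠ 0 := by
      intro w hw h
      rw [sub_eq_zero.1 h] at hw
      exact h3 (by simpa using hw.symm)
    have hci : ContinuousOn (fun w : ℂ => (w - z)⁻¹) (sphere 0 ρ) :=
      ContinuousOn.inv₀ (by fun_prop) hne
    have hi1 : CircleIntegrable (fun w => (w - z)⁻¹ • f w) 0 ρ :=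
      (hci.smul (hcont ρ h1 h2)).circleIntegrable hρ
    have hi2 : CircleIntegrable (fun w => (w - z)⁻¹ • f z) 0 ρ :=
      (hci.smul continuousOn_const).circleIntegrable hρ
    rw [← circleIntegral.integral_smul_const, ← circleIntegral.integral_sub hi1 hi2]
    refine circleIntegral.integral_congr hρ fun w hw => ?_
    have : w ≠ z := fun h => hne w hw (by simp [h])
    simp only [dslope_of_ne _ this, slope_def_module, smul_sub]
  rw [hsplit R₁ hlt.le le_rfl hz2.ne', hsplit R₁⁻¹ le_rfl hlt.le hz1.ne,
    circleIntegral.integral_sub_inv_of_mem_ball (by simpa using hz2)] at hannulus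
  have hzero : (∮ w in C(0, R₁⁻¹), (w - z)⁻¹) = 0 := by
    have hd : ∀ w ∈ closedBall (0 : ℂ) R₁⁻¹, DifferentiableAt ℂ (fun w : ℂ => (w - z)⁻¹) w := by
      intro w hw
      have : w - z ≠ 0 := by
        intro h
        rw [sub_eq_zero.1 h] at hw
        simp at hw
        linarith
      exact DifferentiableAt.inv (by fun_prop) this
    exact Complex.circleIntegral_eq_zero_of_differentiable_on_off_countable h0'.le
      countable_empty (fun w hw => (hd w hw).continuousAt.continuousWithinAt)
      fun w hw => hd w (ball_subset_closedBall hw.1)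
  rw [hzero, zero_smul, sub_zero] at hannulus
  have hA := (hasSum_two_pi_I_cauchyPowerSeries_integral (hcirc R₁ hlt.le le_rfl) hz2).const_smul
    (2 * Real.pi * Complex.I : ℂ)⁻¹
  have hB := (hasSum_circleIntegral_inv_sub_outside h0' (hcirc R₁⁻¹ le_rfl hlt.le) hz1).const_smul
    (2 * Real.pi * Complex.I : ℂ)⁻¹
  have hfz : f z = ((2 * Real.pi * Complex.I : ℂ)⁻¹ • ∮ w in C(0, R₁), (w - (0 + z))⁻¹ • f w) +
      (2 * Real.pi * Complex.I : ℂ)⁻¹ • ∮ w in C(0, R₁⁻¹), (z - w)⁻¹ • f w := by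
    have h1 : (∮ w in C(0, R₁⁻¹), (z - w)⁻¹ • f w) = -∮ w in C(0, R₁⁻¹), (w - z)⁻¹ • f w := by
      rw [← neg_one_smul ℂ, ← circleIntegral.integral_smul]
      congr 1
      ext w
      rw [smul_smul, ← neg_sub w z, inv_neg, neg_one_mul]
    rw [h1, zero_add, ← smul_add, ← sub_eq_add_neg, ← hannulus, sub_sub_cancel, smul_smul,
      inv_mul_cancel₀ hpi, one_smul]
  rw [hfz]
  refine HasSum.of_nat_of_neg_add_one ?_ ?_
  · convert hA using 2 with n
    have hn : (0 : ℤ) ≤ n := by omega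
    simp only [if_pos hn, lc]
    rw [smul_comm, ← circleIntegral.integral_smul]
    congr 1
    refine circleIntegral.integral_congr h0.le fun w hw => ?_
    have hw0 : w ≠ 0 := by
      rintro rfl
      simp at hw
      linarith
    simp only [smul_smul, sub_zero]
    congr 1
    rw [zpow_sub_one₀ hw0, _root_.zpow_neg, zpow_natCast, zpow_natCast, div_pow]
    ring
  · convert hB using 2 with n
    have hn : ¬ (0 : ℤ) ≤ -(n + 1) := by omega
    simp only [if_neg hn, lc]
    rw [smul_comm, ← circleIntegral.integral_smul]
    congr 1
    refine circleIntegral.integral_congr h0'.le fun w hw => ?_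
    simp only [smul_smul]
    congr 1
    have : -(-((n : ℤ) + 1)) - 1 = n := by ring
    rw [this, _root_.zpow_neg, zpow_natCast, div_pow, zpow_add_one₀ hz, zpow_natCast, mul_inv]
    ring

end Expansions

section ExpansionsTwo

open Metric Set Filter Topology MeasureTheory
open scoped Interval

variable {E : Type*} [NormedAddCommGroup E] [NormedSpace ℂ E]

/-- Circle integrals in one variable depend holomorphically on the other variable. -/
theorem differentiableOn_circleIntegral_param [CompleteSpace E] {D : Set ℂ}
    (hD : IsOpen D) {ρ M : ℝ} (hρ : 0 < ρ)
    {s : Set ℂ} (hs : IsOpen s) (hρs : sphere 0 ρ ⊆ s) {f : ℂ × ℂ → E}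
    (hf : DifferentiableOn ℂ f (D ×ˢ s))
    (hM : ∀ p ∈ D ×ˢ s, ‖f p‖ ≤ M) {φ : ℂ → ℂ} (hφ : ContinuousOn φ (sphere 0 ρ)) :
    DifferentiableOn ℂ (fun z => ∮ w in C(0, ρ), φ w • f (z, w)) D := by
  intro x₀ hx₀
  obtain ⟨δ, hδ, hball⟩ := Metric.isOpen_iff.1 hD x₀ hx₀
  have hw : ∀ θ, circleMap 0 ρ θ ∈ sphere (0 : ℂ) ρ := fun θ => circleMap_mem_sphere 0 hρ.le θ
  obtain ⟨Φ, hΦ⟩ := (isCompact_sphere (0 : ℂ) ρ).exists_bound_of_continuousOn hφ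
  have hΦ0 : 0 ≤ Φ := (norm_nonneg _).trans (hΦ _ (hw 0))
  have hso : IsOpen (D ×ˢ s) := hD.prod hs
  have hmem : ∀ x ∈ D, ∀ θ, (x, circleMap 0 ρ θ) ∈ D ×ˢ s := fun x hx θ => ⟨hx, hρs (hw θ)⟩
  let G : ℂ → ℝ → E := fun x θ =>
    deriv (circleMap 0 ρ) θ • φ (circleMap 0 ρ θ) • f (x, circleMap 0 ρ θ)
  have hGc : ∀ x ∈ D, Continuous (G x) := by
    intro x hx
    have h1 : Continuous fun θ => φ (circleMap 0 ρ θ) :=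
      hφ.comp_continuous (continuous_circleMap 0 ρ) hw
    have h2 : Continuous fun θ => f (x, circleMap 0 ρ θ) :=
      hf.continuousOn.comp_continuous (by fun_prop) (hmem x hx)
    simp only [G, deriv_circleMap]
    exact ((continuous_circleMap 0 ρ).mul continuous_const).smul (h1.smul h2)
  have hGd : ∀ x ∈ D, ∀ θ, HasDerivAt (fun x => G x θ) (deriv (fun x => G x θ) x) x := by
    intro x hx θ
    have h1 : DifferentiableAt ℂ f (x, circleMap 0 ρ θ) :=
      (hf _ (hmem x hx θ)).differentiableAt (hso.mem_nhds (hmem x hx θ))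
    have h2 : DifferentiableAt ℂ (fun x => f (x, circleMap 0 ρ θ)) x :=
      h1.comp x (by fun_prop)
    exact ((h2.const_smul _).const_smul _).hasDerivAt
  have hGb : ∀ x ∈ D, ∀ θ, ‖G x θ‖ ≤ ρ * (Φ * M) := by
    intro x hx θ
    simp only [G, norm_smul, deriv_circleMap, norm_mul, Complex.norm_I, mul_one]
    have : ‖circleMap 0 ρ θ‖ = ρ := by simpa using hw θ
    rw [this]
    gcongr
    · exact hΦ _ (hw θ)
    · exact hM _ (hmem x hx θ)
  have hGb' : ∀ x ∈ ball x₀ (δ / 2), ∀ θ,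
      ‖deriv (fun x => G x θ) x‖ ≤ 2 * (ρ * (Φ * M)) / (δ / 2) := by
    intro x hx θ
    have hsub : ball x (δ / 2) ⊆ D := by
      refine (ball_subset_ball' ?_).trans hball
      have := mem_ball.1 hx
      linarith
    rw [norm_deriv_eq_norm_fderiv]
    exact norm_fderiv_le_of_bounded_on_ball (half_pos hδ)
      (fun y hy => (hGd y (hsub hy) θ).differentiableAt.differentiableWithinAt)
      fun y hy => hGb y (hsub hy) θ
  have hmeas : AEStronglyMeasurable (fun θ => deriv (fun x => G x θ) x₀)
      (volume.restrict (Ι 0 (2 * Real.pi))) := by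
    let t : ℕ → ℂ := fun n => ((δ / (n + 2) : ℝ) : ℂ)
    have ht0 : ∀ n, t n ≠ 0 := fun n => by
      simp only [t, ne_eq, Complex.ofReal_eq_zero]
      positivity
    have htD : ∀ n, x₀ + t n ∈ D := by
      intro n
      apply hball
      rw [mem_ball_iff_norm, add_sub_cancel_left, Complex.norm_real, Real.norm_eq_abs,
        abs_of_pos (by positivity), div_lt_iff₀ (by positivity)]
      nlinarith [(Nat.cast_nonneg n : (0 : ℝ) ≤ n)]
    have htl : Tendsto t atTop (𝓝[≠] 0) := by
      refine tendsto_nhdsWithin_iff.2 ⟨?_, Eventually.of_forall ht0⟩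
      have : Tendsto (fun n : ℕ => δ / ((n : ℝ) + 2)) atTop (𝓝 0) :=
        Tendsto.div_atTop tendsto_const_nhds
          (tendsto_atTop_add_const_right _ _ tendsto_natCast_atTop_atTop)
      have h2 := (Complex.continuous_ofReal.tendsto 0).comp this
      simpa [t, Function.comp_def] using h2
    refine aestronglyMeasurable_of_tendsto_ae atTop
      (f := fun n θ => (t n)⁻¹ • (G (x₀ + t n) θ - G x₀ θ)) (fun n => ?_) ?_
    · have h1 := hGc _ (htD n)
      have h2 := hGc _ hx₀
      exact Continuous.aestronglyMeasurable (by fun_prop)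
    · exact Eventually.of_forall fun θ =>
        (hasDerivAt_iff_tendsto_slope_zero.1 (hGd x₀ hx₀ θ)).comp htl
  have key := intervalIntegral.hasDerivAt_integral_of_dominated_loc_of_deriv_le
    (μ := volume) (a := 0) (b := 2 * Real.pi) (F := G)
    (F' := fun x θ => deriv (fun x => G x θ) x) (x₀ := x₀) (s := ball x₀ (δ / 2))
    (bound := fun _ => 2 * (ρ * (Φ * M)) / (δ / 2))
    (ball_mem_nhds x₀ (half_pos hδ))
    (by
      filter_upwards [hD.mem_nhds hx₀] with x hx
      exact (hGc x hx).aestronglyMeasurable)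
    ((hGc x₀ hx₀).intervalIntegrable _ _) hmeas
    (Eventually.of_forall fun θ _ x hx => hGb' x hx θ)
    intervalIntegrable_const
    (Eventually.of_forall fun θ _ x hx =>
      hGd x (hball (ball_subset_ball (by linarith) hx)) θ)
  exact key.2.differentiableAt.differentiableWithinAt

/-- Taylor expansion in the second variable. -/
theorem exists_taylor_snd [CompleteSpace E] {D : Set ℂ} (hD : IsOpen D) {ρ R M : ℝ} (hρ : 0 < ρ)
    (hR : ρ < R) {f : ℂ × ℂ → E} (hf : DifferentiableOn ℂ f (D ×ˢ ball 0 R))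
    (hM : ∀ p ∈ D ×ˢ ball (0 : ℂ) R, ‖f p‖ ≤ M) :
    ∃ c : ℕ → ℂ → E, (∀ n, DifferentiableOn ℂ (c n) D) ∧
      (∀ n, ∀ z ∈ D, ‖c n z‖ ≤ M * (ρ ^ n)⁻¹) ∧
      ∀ z ∈ D, ∀ u, ‖u‖ < ρ → HasSum (fun n => u ^ n • c n z) (f (z, u)) := by
  have hsub : sphere (0 : ℂ) ρ ⊆ ball 0 R := fun w hw => by
    have : ‖w‖ = ρ := by simpa using hw
    simpa [this] using hR
  have hw0 : ∀ w ∈ sphere (0 : ℂ) ρ, w ≠ 0 := by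
    rintro w hw rfl
    simp at hw
    linarith
  refine ⟨fun n z => (2 * Real.pi * Complex.I : ℂ)⁻¹ • ∮ w in C(0, ρ), (w ^ (n + 1))⁻¹ • f (z, w),
    fun n => ?_, fun n z hz => ?_, fun z hz u hu => ?_⟩
  · refine DifferentiableOn.const_smul ?_ _
    exact differentiableOn_circleIntegral_param hD hρ isOpen_ball hsub hf hM
      (ContinuousOn.inv₀ (by fun_prop) fun w hw => pow_ne_zero _ (hw0 w hw))
  · refine (circleIntegral.norm_two_pi_i_inv_smul_integral_le_of_norm_le_const
      (C := (ρ ^ (n + 1))⁻¹ * M) hρ.le ?_).trans (le_of_eq ?_)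
    · intro w hw
      have hw' : ‖w‖ = ρ := by simpa using hw
      rw [norm_smul, norm_inv, norm_pow, hw']
      exact mul_le_mul_of_nonneg_left (hM _ ⟨hz, hsub hw⟩) (by positivity)
    · rw [pow_succ]
      field_simp
  · have hd : DifferentiableOn ℂ (fun w => f (z, w)) (ball 0 R) :=
      hf.comp (by fun_prop) fun w hw => ⟨hz, hw⟩
    have hcb : closedBall (0 : ℂ) ρ ⊆ ball 0 R := closedBall_subset_ball hR
    have h1 := (hasSum_two_pi_I_cauchyPowerSeries_integral
      (ContinuousOn.circleIntegrable hρ.le (hd.continuousOn.mono hsub)) hu).const_smul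
      (2 * Real.pi * Complex.I : ℂ)⁻¹
    have h2 := Complex.two_pi_I_inv_smul_circleIntegral_sub_inv_smul_of_differentiable_on_off_countable
      (s := ∅) (c := 0) (R := ρ) (w := u) (f := fun w => f (z, w)) countable_empty
      (by simpa using hu) (hd.continuousOn.mono hcb) fun w hw =>
        (hd w (hcb (ball_subset_closedBall hw.1))).differentiableAt
          (isOpen_ball.mem_nhds (hcb (ball_subset_closedBall hw.1)))
    simp only [zero_add] at h1
    rw [h2] at h1
    convert h1 using 2 with n
    rw [smul_comm, ← circleIntegral.integral_smul]
    congr 1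
    refine circleIntegral.integral_congr hρ.le fun w hw => ?_
    have := hw0 w hw
    simp only [smul_smul, sub_zero]
    congr 1
    rw [div_pow, pow_succ]
    field_simp

/-- Summation of a double series by rows. -/
theorem hasSum_prod_of_summable {E : Type*} [NormedAddCommGroup E] [CompleteSpace E]
    {ι κ : Type*} {F : ι × κ → E} {b : ι × κ → ℝ}
    (hb : Summable b) (hF : ∀ p, ‖F p‖ ≤ b p) {g : κ → E} {a : E}
    (hg : ∀ n, HasSum (fun m => F (m, n)) (g n)) (ha : HasSum g a) : HasSum F a := by
  have hs : Summable F := Summable.of_norm_bounded hb hF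
  have h1 : HasSum (fun q : κ × ι => F (q.2, q.1)) (∑' p, F p) :=
    (Equiv.prodComm κ ι).hasSum_iff.2 hs.hasSum
  rw [ha.unique (h1.prod_fiberwise hg)]
  exact hs.hasSum

theorem summable_pow_natAbs {q : ℝ} (h0 : 0 ≤ q) (h1 : q < 1) :
    Summable fun m : ℤ => q ^ m.natAbs := by
  refine Summable.of_nat_of_neg_add_one ?_ ?_
  · simpa using summable_geometric_of_lt_one h0 h1
  · have : ∀ n : ℕ, (-((n : ℤ) + 1)).natAbs = n + 1 := fun n => by omega
    simp only [this, pow_succ]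
    exact (summable_geometric_of_lt_one h0 h1).mul_right q

/-- Laurent–Taylor expansion on the product of an annulus and a disc. -/
theorem exists_laurent_taylor [CompleteSpace E] {R R₁ S ρ M : ℝ} (hR₁ : 1 < R₁) (hR : R₁ < R)
    (hρ : 0 < ρ) (hS : ρ < S) {f : ℂ × ℂ → E}
    (hf : DifferentiableOn ℂ f ({z | R⁻¹ < ‖z‖ ∧ ‖z‖ < R} ×ˢ ball 0 S))
    (hM : ∀ p ∈ {z : ℂ | R⁻¹ < ‖z‖ ∧ ‖z‖ < R} ×ˢ ball (0 : ℂ) S, ‖f p‖ ≤ M) :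
    ∃ c : ℤ × ℕ → E, (∀ p, ‖c p‖ ≤ M * ((R₁ ^ p.1.natAbs)⁻¹ * (ρ ^ p.2)⁻¹)) ∧
      ∀ p : ℂ × ℂ, R₁⁻¹ < ‖p.1‖ → ‖p.1‖ < R₁ → ‖p.2‖ < ρ →
        HasSum (fun m : ℤ × ℕ => (p.1 ^ m.1 * p.2 ^ m.2) • c m) (f p) := by
  have h0 : 0 < R₁ := by linarith
  have hso : IsOpen {z : ℂ | R⁻¹ < ‖z‖ ∧ ‖z‖ < R} := by
    simp only [ofPred_and]
    exact (isOpen_lt continuous_const continuous_norm).inter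
      (isOpen_lt continuous_norm continuous_const)
  obtain ⟨c, hc1, hc2, hc3⟩ := exists_taylor_snd hso hρ hS hf hM
  choose d hd1 hd2 using fun n => exists_laurent hR₁ hR (hc1 n) fun z h1 h2 => hc2 n z ⟨h1, h2⟩
  have hinv : R⁻¹ < R₁⁻¹ := inv_strictAnti₀ h0 hR
  refine ⟨fun p => d p.2 p.1, fun p => (hd1 p.2 p.1).trans (le_of_eq (by ring)), ?_⟩
  rintro ⟨z, u⟩ hz1 hz2 hu
  simp only at hz1 hz2 hu
  have hz0 : 0 < ‖z‖ := (inv_pos.2 h0).trans hz1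
  have hM0 : 0 ≤ M := (norm_nonneg _).trans
    (hM (z, 0) ⟨⟨hinv.trans hz1, hz2.trans hR⟩, by simpa using hρ.trans hS⟩)
  set q : ℝ := max (‖z‖ / R₁) (‖z‖⁻¹ / R₁) with hq
  have hq1 : q < 1 := by
    refine max_lt ((div_lt_one h0).2 hz2) ((div_lt_one h0).2 ?_)
    exact inv_lt_of_inv_lt₀ h0 hz1
  have hq0 : 0 ≤ q := le_max_of_le_left (by positivity)
  have hzq : ∀ m : ℤ, ‖z‖ ^ m * (R₁ ^ m.natAbs)⁻¹ ≤ q ^ m.natAbs := by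
    intro m
    rcases Int.natAbs_eq m with h | h
    · conv_lhs => rw [h]
      rw [zpow_natCast, Int.natAbs_natCast, ← div_eq_mul_inv, ← div_pow]
      gcongr
      exact le_max_left _ _
    · conv_lhs => rw [h]
      rw [_root_.zpow_neg, zpow_natCast, Int.natAbs_neg, Int.natAbs_natCast, ← inv_pow,
        ← div_eq_mul_inv, ← div_pow]
      gcongr
      exact le_max_right _ _
  have hsum : Summable fun p : ℤ × ℕ => M * (q ^ p.1.natAbs * (‖u‖ / ρ) ^ p.2) := by
    refine Summable.mul_left M ?_
    exact Summable.mul_of_nonneg (f := fun m : ℤ => q ^ m.natAbs) (g := fun n : ℕ => (‖u‖ / ρ) ^ n)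
      (summable_pow_natAbs hq0 hq1)
      (summable_geometric_of_lt_one (by positivity) ((div_lt_one hρ).2 hu))
      (fun m => by positivity) (fun n => by positivity)
  refine hasSum_prod_of_summable hsum (fun p => ?_) (g := fun n => u ^ n • c n z) (fun n => ?_)
    (hc3 z ⟨hinv.trans hz1, hz2.trans hR⟩ u hu)
  · rw [norm_smul, norm_mul, norm_zpow, norm_pow]
    calc ‖z‖ ^ p.1 * ‖u‖ ^ p.2 * ‖d p.2 p.1‖
        ≤ ‖z‖ ^ p.1 * ‖u‖ ^ p.2 * (M * (ρ ^ p.2)⁻¹ * (R₁ ^ p.1.natAbs)⁻¹) := by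
          gcongr
          exact hd1 p.2 p.1
      _ = M * ((‖z‖ ^ p.1 * (R₁ ^ p.1.natAbs)⁻¹) * (‖u‖ / ρ) ^ p.2) := by
          rw [div_pow]; ring
      _ ≤ _ := by
          gcongr
          exact hzq p.1
  · have := (hd2 n z hz1 hz2).const_smul (u ^ n)
    simpa only [smul_smul, mul_comm] using this

/-- Taylor expansion on a bidisc. -/
theorem exists_taylor_bidisc [CompleteSpace E] {R R₁ S ρ M : ℝ} (hR₁ : 0 < R₁) (hR : R₁ < R)
    (hρ : 0 < ρ) (hS : ρ < S) {f : ℂ × ℂ → E}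
    (hf : DifferentiableOn ℂ f (ball 0 R ×ˢ ball 0 S))
    (hM : ∀ p ∈ ball (0 : ℂ) R ×ˢ ball (0 : ℂ) S, ‖f p‖ ≤ M) :
    ∃ c : ℕ × ℕ → E, (∀ p, ‖c p‖ ≤ M * ((R₁ ^ p.1)⁻¹ * (ρ ^ p.2)⁻¹)) ∧
      ∀ p : ℂ × ℂ, ‖p.1‖ < R₁ → ‖p.2‖ < ρ →
        HasSum (fun m : ℕ × ℕ => (p.1 ^ m.1 * p.2 ^ m.2) • c m) (f p) := by
  obtain ⟨c, hc1, hc2, hc3⟩ := exists_taylor_snd isOpen_ball hρ hS hf hM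
  have hone : ∀ n, ∃ d : ℕ → E, (∀ m, ‖d m‖ ≤ M * (ρ ^ n)⁻¹ * (R₁ ^ m)⁻¹) ∧
      ∀ z, ‖z‖ < R₁ → HasSum (fun m => z ^ m • d m) (c n z) := by
    intro n
    obtain ⟨e, -, he2, he3⟩ := exists_taylor_snd (D := univ) isOpen_univ hR₁ hR
      (f := fun p : ℂ × ℂ => c n p.2) (M := M * (ρ ^ n)⁻¹)
      ((hc1 n).comp (by fun_prop) fun p hp => hp.2) fun p hp => hc2 n _ hp.2
    exact ⟨fun m => e m 0, fun m => he2 m 0 trivial, fun z hz => he3 0 trivial z hz⟩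
  choose d hd1 hd2 using hone
  refine ⟨fun p => d p.2 p.1, fun p => (hd1 p.2 p.1).trans (le_of_eq (by ring)), ?_⟩
  rintro ⟨z, u⟩ hz hu
  simp only at hz hu
  have hM0 : 0 ≤ M := (norm_nonneg _).trans
    (hM (0, 0) ⟨by simpa using hR₁.trans hR, by simpa using hρ.trans hS⟩)
  have hsum : Summable fun p : ℕ × ℕ => M * ((‖z‖ / R₁) ^ p.1 * (‖u‖ / ρ) ^ p.2) := by
    refine Summable.mul_left M ?_
    exact Summable.mul_of_nonneg (f := fun m : ℕ => (‖z‖ / R₁) ^ m)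
      (g := fun n : ℕ => (‖u‖ / ρ) ^ n)
      (summable_geometric_of_lt_one (by positivity) ((div_lt_one hR₁).2 hz))
      (summable_geometric_of_lt_one (by positivity) ((div_lt_one hρ).2 hu))
      (fun m => by positivity) (fun n => by positivity)
  refine hasSum_prod_of_summable hsum (fun p => ?_) (g := fun n => u ^ n • c n z) (fun n => ?_)
    (hc3 z (by simpa using hz.trans hR) u hu)
  · rw [norm_smul, norm_mul, norm_pow, norm_pow]
    calc ‖z‖ ^ p.1 * ‖u‖ ^ p.2 * ‖d p.2 p.1‖
        ≤ ‖z‖ ^ p.1 * ‖u‖ ^ p.2 * (M * (ρ ^ p.2)⁻¹ * (R₁ ^ p.1)⁻¹) := by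
          gcongr
          exact hd1 p.2 p.1
      _ = _ := by
          rw [div_pow, div_pow]; ring
  · have := (hd2 n z hz).const_smul (u ^ n)
    simpa only [smul_smul, mul_comm] using this

end ExpansionsTwo

section Cartan

variable {𝔸 : Type*} [NormedRing 𝔸] [NormedAlgebra ℂ 𝔸]
variable {G : Type*}

local notation "L1" => lp (fun _ : G => 𝔸) 1

omit [NormedAlgebra ℂ 𝔸] in
theorem lp_one_summable (f : L1) : Summable fun g => ‖f g‖ := by
  simpa using (lp.memℓp f).summable (by norm_num)

omit [NormedAlgebra ℂ 𝔸] in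
theorem lp_one_norm (f : L1) : ‖f‖ = ∑' g, ‖f g‖ := by
  simpa using lp.norm_eq_tsum_rpow (by norm_num) f

omit [NormedAlgebra ℂ 𝔸] in
theorem memℓp_one {f : G → 𝔸} (hf : Summable fun g => ‖f g‖) : Memℓp f 1 :=
  memℓp_gen (by simpa using hf)

open Classical in
/-- Restriction of summable families to a subset of the index set. -/
def lpRestrict (S : Set G) : L1 →L[ℂ] L1 :=
  have hb : ∀ (f : L1) g, ‖if g ∈ S then f g else 0‖ ≤ ‖f g‖ := fun f g => by
    split_ifs <;> simp
  have hs : ∀ f : L1, Summable fun g => ‖if g ∈ S then f g else 0‖ := fun f =>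
    (lp_one_summable f).of_nonneg_of_le (fun _ => norm_nonneg _) (hb f)
  LinearMap.mkContinuous
    { toFun := fun f => ⟨fun g => if g ∈ S then f g else 0, memℓp_one (hs f)⟩
      map_add' := fun f g => by
        ext i
        change (if i ∈ S then f i + g i else 0) =
          (if i ∈ S then f i else 0) + (if i ∈ S then g i else 0)
        split_ifs <;> simp
      map_smul' := fun c f => by
        ext i
        by_cases h : i ∈ S <;> simp [h] }
    1 (fun f => by
      rw [lp_one_norm, one_mul, lp_one_norm]
      exact Summable.tsum_le_tsum (hb f) (hs f) (lp_one_summable f))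

open Classical in
theorem lpRestrict_apply (S : Set G) (f : L1) (g : G) :
    lpRestrict S f g = if g ∈ S then f g else 0 := rfl

theorem norm_lpRestrict_le (S : Set G) (f : L1) : ‖lpRestrict S f‖ ≤ ‖f‖ := by
  rw [lp_one_norm, lp_one_norm]
  refine Summable.tsum_le_tsum (fun g => ?_) (lp_one_summable _) (lp_one_summable f)
  rw [lpRestrict_apply]
  split_ifs <;> simp

/-- Evaluation of a summable family against bounded coefficients. -/
def lpEval [CompleteSpace 𝔸] (χ : G → ℂ) (hχ : ∀ g, ‖χ g‖ ≤ 1) : L1 →L[ℂ] 𝔸 :=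
  have hb : ∀ (f : L1) g, ‖χ g • f g‖ ≤ ‖f g‖ := fun f g => by
    rw [norm_smul]
    exact mul_le_of_le_one_left (norm_nonneg _) (hχ g)
  have hs : ∀ f : L1, Summable fun g => χ g • f g := fun f =>
    Summable.of_norm_bounded (lp_one_summable f) (hb f)
  LinearMap.mkContinuous
    { toFun := fun f => ∑' g, χ g • f g
      map_add' := fun f g => by
        rw [← (hs f).tsum_add (hs g)]
        simp [smul_add]
      map_smul' := fun c f => by
        rw [RingHom.id_apply, ← (hs f).tsum_const_smul]
        exact tsum_congr fun g => smul_comm _ _ _ }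
    1 (fun f => by
      rw [one_mul, lp_one_norm]
      exact tsum_of_norm_bounded (lp_one_summable f).hasSum (hb f))

theorem lpEval_apply [CompleteSpace 𝔸] (χ : G → ℂ) (hχ : ∀ g, ‖χ g‖ ≤ 1) (f : L1) :
    lpEval χ hχ f = ∑' g, χ g • f g := rfl

variable [AddCommMonoid G]

open Classical in
/-- The terms of the weighted convolution of two summable families. -/
def convTerm (w : G → ℝ) (f b : L1) (p : G × G) : L1 :=
  lp.single 1 (p.1 + p.2) (((w (p.1 + p.2) / (w p.1 * w p.2) : ℝ) : ℂ) • (f p.1 * b p.2))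

theorem norm_convTerm_le {w : G → ℝ} (hw : ∀ g, 0 < w g) (hmul : ∀ g h, w (g + h) ≤ w g * w h)
    (f b : L1) (p : G × G) : ‖convTerm w f b p‖ ≤ ‖f p.1‖ * ‖b p.2‖ := by
  classical
  have hp := mul_pos (hw p.1) (hw p.2)
  rw [convTerm, lp.norm_single (by norm_num), norm_smul, Complex.norm_real, Real.norm_eq_abs,
    abs_of_nonneg (div_nonneg (hw _).le hp.le)]
  exact (mul_le_of_le_one_left (norm_nonneg _) ((div_le_one hp).2 (hmul _ _))).trans
    (norm_mul_le _ _)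

omit [NormedAlgebra ℂ 𝔸] [AddCommMonoid G] in
theorem summable_mul_norm (f b : L1) : Summable fun p : G × G => ‖f p.1‖ * ‖b p.2‖ :=
  (lp_one_summable f).mul_of_nonneg (lp_one_summable b) (fun _ => norm_nonneg _)
    fun _ => norm_nonneg _

variable [CompleteSpace 𝔸]

theorem summable_convTerm {w : G → ℝ} (hw : ∀ g, 0 < w g)
    (hmul : ∀ g h, w (g + h) ≤ w g * w h) (f b : L1) : Summable (convTerm w f b) :=
  Summable.of_norm_bounded (summable_mul_norm f b) (norm_convTerm_le hw hmul f b)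

/-- Right convolution in a weighted Wiener algebra. -/
def lpConv (w : G → ℝ) (hw : ∀ g, 0 < w g) (hmul : ∀ g h, w (g + h) ≤ w g * w h) (b : L1) :
    L1 →L[ℂ] L1 :=
  LinearMap.mkContinuous
    { toFun := fun f => ∑' p, convTerm w f b p
      map_add' := fun f g => by
        rw [← (summable_convTerm hw hmul f b).tsum_add (summable_convTerm hw hmul g b)]
        refine tsum_congr fun p => ?_
        classical
        simp [convTerm, add_mul, smul_add, lp.single_add]
      map_smul' := fun c f => by
        rw [RingHom.id_apply, ← (summable_convTerm hw hmul f b).tsum_const_smul]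
        refine tsum_congr fun p => ?_
        classical
        simp only [convTerm, lp.coeFn_smul, Pi.smul_apply, smul_mul_assoc]
        rw [smul_comm, lp.single_smul] }
    ‖b‖ (fun f => by
      refine (tsum_of_norm_bounded (summable_mul_norm f b).hasSum
        (norm_convTerm_le hw hmul f b)).trans (le_of_eq ?_)
      rw [lp_one_norm, lp_one_norm, mul_comm,
        (lp_one_summable f).tsum_mul_tsum (lp_one_summable b) (summable_mul_norm f b)])

theorem norm_lpConv_le (w : G → ℝ) (hw : ∀ g, 0 < w g) (hmul : ∀ g h, w (g + h) ≤ w g * w h)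
    (b : L1) : ‖lpConv w hw hmul b‖ ≤ ‖b‖ :=
  LinearMap.mkContinuous_norm_le _ (norm_nonneg _) _

theorem lpEval_lpConv {w : G → ℝ} (hw : ∀ g, 0 < w g) (hmul : ∀ g h, w (g + h) ≤ w g * w h)
    {χ : G → ℂ} (hχ : ∀ g, ‖χ g / w g‖ ≤ 1) (hχm : ∀ g h, χ (g + h) = χ g * χ h) (f b : L1) :
    lpEval (fun g => χ g / w g) hχ (lpConv w hw hmul b f) =
      lpEval (fun g => χ g / w g) hχ f * lpEval (fun g => χ g / w g) hχ b := by
  classical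
  have h1 : lpConv w hw hmul b f = ∑' p, convTerm w f b p := rfl
  have hb : ∀ (f : L1) g, ‖(χ g / w g) • f g‖ ≤ ‖f g‖ := fun f g => by
    rw [norm_smul]
    exact mul_le_of_le_one_left (norm_nonneg _) (hχ g)
  rw [h1, ContinuousLinearMap.map_tsum _ (summable_convTerm hw hmul f b), lpEval_apply,
    lpEval_apply, tsum_mul_tsum_of_summable_norm
      ((lp_one_summable f).of_nonneg_of_le (fun _ => norm_nonneg _) (hb f))
      ((lp_one_summable b).of_nonneg_of_le (fun _ => norm_nonneg _) (hb b))]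
  refine tsum_congr fun p => ?_
  rw [lpEval_apply, tsum_eq_single (p.1 + p.2)]
  · rw [convTerm, lp.single_apply_self, smul_smul, hχm, smul_mul_smul_comm]
    congr 1
    have h1 : (w p.1 : ℂ) ≠ 0 := by exact_mod_cast (hw p.1).ne'
    have h2 : (w p.2 : ℂ) ≠ 0 := by exact_mod_cast (hw p.2).ne'
    have h3 : (w (p.1 + p.2) : ℂ) ≠ 0 := by exact_mod_cast (hw (p.1 + p.2)).ne'
    push_cast
    field_simp
  · intro g hg
    rw [convTerm, lp.single_apply_ne _ _ _ hg, smul_zero]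

/-- Cartan-type factorization in a weighted Wiener algebra: an element close to the identity is
turned, by multiplication on the left with an element supported in `S` up to the identity, into
one supported in the complement of `S` up to the identity. -/
theorem exists_cartan_factorization {w : G → ℝ} (hw : ∀ g, 0 < w g)
    (hmul : ∀ g h, w (g + h) ≤ w g * w h) (S : Set G) {a : G → 𝔸} {ε : ℝ} (hε : ε ≤ 1 / 4)
    (ha : Summable fun g => w g * ‖a g‖) (haε : ∑' g, w g * ‖a g‖ ≤ ε) :
    ∃ q n : G → 𝔸, (∀ g ∉ S, q g = 0) ∧ (∀ g ∈ S, n g = 0) ∧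
      (Summable fun g => w g * ‖q g‖) ∧ (Summable fun g => w g * ‖n g‖) ∧
      ∑' g, w g * ‖q g‖ ≤ 2 * ε ∧ ∑' g, w g * ‖n g‖ ≤ 4 * ε ∧
      ∀ χ : G → ℂ, (∀ g, ‖χ g‖ ≤ w g) → (∀ g h, χ (g + h) = χ g * χ h) →
        (1 + ∑' g, χ g • q g) * (1 + ∑' g, χ g • a g) = 1 + ∑' g, χ g • n g := by
  have hwC : ∀ g, (w g : ℂ) ≠ 0 := fun g => by exact_mod_cast (hw g).ne'
  have hnw : ∀ g, ‖(w g : ℂ)‖ = w g := fun g => by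
    rw [Complex.norm_real, Real.norm_eq_abs, abs_of_pos (hw g)]
  let b : L1 := ⟨fun g => (w g : ℂ) • a g, memℓp_one (by simpa only [norm_smul, hnw] using ha)⟩
  have hb : ∀ g, b g = (w g : ℂ) • a g := fun _ => rfl
  have hbε : ‖b‖ ≤ ε := by
    rw [lp_one_norm]
    simpa only [hb, norm_smul, hnw] using haε
  have hε0 : 0 ≤ ε := (norm_nonneg _).trans hbε
  let K : L1 →L[ℂ] L1 := (lpRestrict S).comp (lpConv w hw hmul b)
  have hconv : ∀ f, ‖lpConv w hw hmul b f‖ ≤ ε * ‖f‖ := fun f =>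
    (lpConv w hw hmul b).le_of_opNorm_le ((norm_lpConv_le w hw hmul b).trans hbε) f
  have hKf : ∀ f, ‖K f‖ ≤ ε * ‖f‖ := fun f => (norm_lpRestrict_le S _).trans (hconv f)
  have hK : ‖-K‖ < 1 := by
    refine (norm_neg K).trans_lt ?_
    exact (ContinuousLinearMap.opNorm_le_bound _ hε0 hKf).trans_lt (by linarith)
  let U := Units.oneSub (-K) hK
  let q : L1 := (↑U⁻¹ : L1 →L[ℂ] L1) (-lpRestrict S b)
  have hq : q + K q = -lpRestrict S b := by
    have h1 : ((↑U : L1 →L[ℂ] L1) * ↑U⁻¹) (-lpRestrict S b) = -lpRestrict S b := by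
      rw [U.mul_inv]; rfl
    rw [← h1]
    simp only [U, Units.val_oneSub, mul_apply_eq_comp]
    simp [q, U]
  let n : L1 := b + q + lpConv w hw hmul b q
  have hq' : q = -lpRestrict S b - K q := by rw [← hq]; abel
  have hqS : ∀ g ∉ S, q g = 0 := by
    intro g hg
    have h3 : q g = -lpRestrict S b g - lpRestrict S (lpConv w hw hmul b q) g := by
      conv_lhs => rw [hq']
      rfl
    rw [h3, lpRestrict_apply, lpRestrict_apply, if_neg hg, if_neg hg, neg_zero, sub_zero]
  have hnS : ∀ g ∈ S, n g = 0 := by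
    intro g hg
    have h3 : q g = -lpRestrict S b g - lpRestrict S (lpConv w hw hmul b q) g := by
      conv_lhs => rw [hq']
      rfl
    rw [lpRestrict_apply, lpRestrict_apply, if_pos hg, if_pos hg] at h3
    have h4 : n g = b g + q g + lpConv w hw hmul b q g := rfl
    rw [h4, h3]
    abel
  have hqn : ‖q‖ ≤ 2 * ε := by
    have h3 : ‖q‖ ≤ ε + ε * ‖q‖ := by
      calc ‖q‖ = ‖-lpRestrict S b - K q‖ := by rw [← hq']
        _ ≤ ‖-lpRestrict S b‖ + ‖K q‖ := norm_sub_le _ _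
        _ ≤ ε + ε * ‖q‖ := by
            rw [norm_neg]
            exact add_le_add ((norm_lpRestrict_le S b).trans hbε) (hKf q)
    nlinarith [norm_nonneg q]
  have hnn : ‖n‖ ≤ 4 * ε := by
    calc ‖n‖ ≤ ‖b‖ + ‖q‖ + ‖lpConv w hw hmul b q‖ := norm_add₃_le
      _ ≤ ε + 2 * ε + ε * ‖q‖ := by gcongr; exact hconv q
      _ ≤ ε + 2 * ε + ε * (2 * ε) := by gcongr
      _ ≤ 4 * ε := by nlinarith
  have hunw : ∀ (f : L1) g, w g * ‖((w g : ℂ)⁻¹) • f g‖ = ‖f g‖ := by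
    intro f g
    rw [norm_smul, norm_inv, hnw, ← mul_assoc, mul_inv_cancel₀ (hw g).ne', one_mul]
  refine ⟨fun g => (w g : ℂ)⁻¹ • q g, fun g => (w g : ℂ)⁻¹ • n g, ?_, ?_, ?_, ?_, ?_, ?_, ?_⟩
  · intro g hg
    simp only [hqS g hg, smul_zero]
  · intro g hg
    simp only [hnS g hg, smul_zero]
  · simpa only [hunw] using lp_one_summable q
  · simpa only [hunw] using lp_one_summable n
  · simpa only [hunw, ← lp_one_norm] using hqn
  · simpa only [hunw, ← lp_one_norm] using hnn
  intro χ hχ hχm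
  have hχ' : ∀ g, ‖χ g / w g‖ ≤ 1 := fun g => by
    rw [norm_div, hnw]
    exact (div_le_one (hw g)).2 (hχ g)
  have hev : ∀ f : L1, ∑' g, χ g • (w g : ℂ)⁻¹ • f g = lpEval (fun g => χ g / w g) hχ' f := by
    intro f
    rw [lpEval_apply]
    exact tsum_congr fun g => by rw [smul_smul, div_eq_mul_inv]
  have hev' : ∑' g, χ g • a g = lpEval (fun g => χ g / w g) hχ' b := by
    rw [← hev]
    exact tsum_congr fun g => by rw [hb, smul_smul (w g : ℂ)⁻¹, inv_mul_cancel₀ (hwC g), one_smul]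
  simp only
  rw [hev, hev, hev']
  simp only [n, map_add, lpEval_lpConv hw hmul hχ' hχm]
  noncomm_ring

end Cartan

section HolUnits

open Set Metric Filter Topology

variable {𝔸 : Type*} [NormedRing 𝔸] [NormedAlgebra ℂ 𝔸]
variable {X : Type*} [NormedAddCommGroup X] [NormedSpace ℂ X]
variable {Y : Type*} [NormedAddCommGroup Y] [NormedSpace ℂ Y]

/-- `A` is holomorphic on `s` with values in the units of `𝔸`. -/
def HolUnit (A : X → 𝔸) (s : Set X) : Prop :=
  DifferentiableOn ℂ A s ∧ ∀ p ∈ s, IsUnit (A p)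

theorem HolUnit.mono {A : X → 𝔸} {s t : Set X} (h : HolUnit A t) (hst : s ⊆ t) : HolUnit A s :=
  ⟨h.1.mono hst, fun p hp => h.2 p (hst hp)⟩

theorem HolUnit.congr {A B : X → 𝔸} {s : Set X} (h : HolUnit A s) (hAB : ∀ p ∈ s, B p = A p) :
    HolUnit B s :=
  ⟨h.1.congr hAB, fun p hp => (hAB p hp).symm ▸ h.2 p hp⟩

theorem HolUnit.mul {A B : X → 𝔸} {s : Set X} (hA : HolUnit A s) (hB : HolUnit B s) :
    HolUnit (fun p => A p * B p) s :=
  ⟨hA.1.mul hB.1, fun p hp => (hA.2 p hp).mul (hB.2 p hp)⟩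

theorem HolUnit.inv [CompleteSpace 𝔸] {A : X → 𝔸} {s : Set X} (hA : HolUnit A s) :
    HolUnit (fun p => Ring.inverse (A p)) s :=
  ⟨hA.1.inverse hA.2, fun _ hp => (hA.2 _ hp).ringInverse⟩

theorem HolUnit.comp {A : X → 𝔸} {s : Set X} {t : Set Y} {f : Y → X} (hA : HolUnit A s)
    (hf : DifferentiableOn ℂ f t) (hst : MapsTo f t s) : HolUnit (fun p => A (f p)) t :=
  ⟨hA.1.comp hf hst, fun _ hp => hA.2 _ (hst hp)⟩

theorem holUnit_const {a : 𝔸} (ha : IsUnit a) (s : Set X) : HolUnit (fun _ => a) s :=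
  ⟨differentiableOn_const a, fun _ _ => ha⟩

/-- The map `F` can be approximated on `K` by entire maps into the units. -/
def UnitApprox (K : Set X) (F : X → 𝔸) : Prop :=
  ∀ ε > 0, ∃ G : X → 𝔸, HolUnit G univ ∧ ∀ p ∈ K, ‖Ring.inverse (G p) * F p - 1‖ ≤ ε

theorem UnitApprox.congr {K : Set X} {F F' : X → 𝔸} (h : UnitApprox K F)
    (hF : ∀ p ∈ K, F' p = F p) : UnitApprox K F' := by
  intro ε hε
  obtain ⟨G, h1, h2⟩ := h ε hε
  exact ⟨G, h1, fun p hp => hF p hp ▸ h2 p hp⟩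

theorem unitApprox_const {a : 𝔸} (ha : IsUnit a) (K : Set X) : UnitApprox K fun _ => a :=
  fun ε hε => ⟨fun _ => a, holUnit_const ha _, fun p _ => by
    rw [Ring.inverse_mul_cancel _ ha]; simpa using hε.le⟩

variable [CompleteSpace 𝔸]

/-- The exponential has a holomorphic right inverse near `1`. -/
theorem exists_log_near_one : ∃ δ > 0, ∃ l : 𝔸 → 𝔸, DifferentiableOn ℂ l (ball 1 δ) ∧
    ∀ y ∈ ball (1 : 𝔸) δ, NormedSpace.exp (l y) = y := by
  have h0 : ContDiffAt ℂ 1 (NormedSpace.exp : 𝔸 → 𝔸) 0 :=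
    (NormedSpace.exp_analytic (𝕂 := ℂ) (0 : 𝔸)).contDiffAt
  have hd : HasStrictFDerivAt (NormedSpace.exp : 𝔸 → 𝔸)
      ((ContinuousLinearEquiv.refl ℂ 𝔸 : 𝔸 ≃L[ℂ] 𝔸) : 𝔸 →L[ℂ] 𝔸) 0 :=
    hasStrictFDerivAt_exp_zero
  have h1 := h0.to_localInverse hd.hasFDerivAt one_ne_zero
  have h2 : ∀ᶠ y in 𝓝 (1 : 𝔸), NormedSpace.exp
      (h0.localInverse hd.hasFDerivAt one_ne_zero y) = y := by
    have := (h0.hasStrictFDerivAt' hd.hasFDerivAt one_ne_zero).eventually_right_inverse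
    rwa [NormedSpace.exp_zero] at this
  rw [NormedSpace.exp_zero] at h1
  have h3 : ∀ᶠ y in 𝓝 (1 : 𝔸), DifferentiableAt ℂ
      (h0.localInverse hd.hasFDerivAt one_ne_zero) y :=
    (h1.eventually (by simp)).mono fun y hy => hy.differentiableAt one_ne_zero
  obtain ⟨δ, hδ, h4⟩ := Metric.eventually_nhds_iff_ball.1 (h2.and h3)
  exact ⟨δ, hδ, _, fun y hy => (h4 y hy).2.differentiableWithinAt, fun y hy => (h4 y hy).1⟩

theorem exp_neg_mul_exp (x : 𝔸) : NormedSpace.exp (-x) * NormedSpace.exp x = 1 := by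
  let _ : NormedAlgebra ℚ 𝔸 := NormedAlgebra.restrictScalars ℚ ℂ 𝔸
  rw [← NormedSpace.exp_add_of_commute (Commute.neg_left (Commute.refl x))]
  simp

theorem exp_mul_exp_neg (x : 𝔸) : NormedSpace.exp x * NormedSpace.exp (-x) = 1 := by
  simpa using exp_neg_mul_exp (-x)

theorem isUnit_exp_of_complex (x : 𝔸) : IsUnit (NormedSpace.exp x) :=
  ⟨⟨_, _, exp_mul_exp_neg x, exp_neg_mul_exp x⟩, rfl⟩

theorem inverse_exp (x : 𝔸) : Ring.inverse (NormedSpace.exp x) = NormedSpace.exp (-x) :=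
  Ring.inverse_unit ⟨_, _, exp_mul_exp_neg x, exp_neg_mul_exp x⟩

theorem differentiable_exp_of_complex : Differentiable ℂ (NormedSpace.exp : 𝔸 → 𝔸) :=
  fun x => (NormedSpace.exp_analytic (𝕂 := ℂ) x).differentiableAt

theorem UnitApprox.mul {K : Set X} (hK : IsCompact K) {F F' : X → 𝔸} (hF' : ContinuousOn F' K)
    (h : UnitApprox K F) (h' : UnitApprox K F') : UnitApprox K fun p => F p * F' p := by
  intro ε hε
  obtain ⟨G', hG'1, hG'2⟩ := h' (ε / 2) (by positivity)
  obtain ⟨a, ha⟩ := hK.exists_bound_of_continuousOn hF'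
  obtain ⟨b, hb⟩ := hK.exists_bound_of_continuousOn
    (hG'1.inv.1.continuousOn.mono (subset_univ K))
  obtain ⟨G, hG1, hG2⟩ := h (ε / 2 / ((|b| + 1) * (|a| + 1))) (by positivity)
  refine ⟨fun p => G p * G' p, hG1.mul hG'1, fun p hp => ?_⟩
  have e1 : Ring.inverse (G p * G' p) * (F p * F' p) - 1 =
      Ring.inverse (G' p) * (Ring.inverse (G p) * F p - 1) * F' p +
        (Ring.inverse (G' p) * F' p - 1) := by
    rw [Ring.inverse_mul (Or.inl (hG1.2 p trivial))]
    noncomm_ring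
  rw [e1]
  have hb' : ‖Ring.inverse (G' p)‖ ≤ |b| + 1 := (hb p hp).trans (by linarith [le_abs_self b])
  have ha' : ‖F' p‖ ≤ |a| + 1 := (ha p hp).trans (by linarith [le_abs_self a])
  calc _ ≤ ‖Ring.inverse (G' p) * (Ring.inverse (G p) * F p - 1) * F' p‖ +
        ‖Ring.inverse (G' p) * F' p - 1‖ := norm_add_le _ _
    _ ≤ ‖Ring.inverse (G' p)‖ * ‖Ring.inverse (G p) * F p - 1‖ * ‖F' p‖ + ε / 2 := by
        gcongr
        · exact (norm_mul_le _ _).trans (by gcongr; exact norm_mul_le _ _)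
        · exact hG'2 p hp
    _ ≤ (|b| + 1) * (ε / 2 / ((|b| + 1) * (|a| + 1))) * (|a| + 1) + ε / 2 := by
        gcongr
        exact hG2 p hp
    _ = ε := by field_simp; ring

theorem unitApprox_exp {K : Set X} (hK : IsCompact K) {L : X → 𝔸} (hL : ContinuousOn L K)
    (h : ∀ δ > 0, ∃ P : X → 𝔸, Differentiable ℂ P ∧ ∀ p ∈ K, ‖P p - L p‖ ≤ δ) :
    UnitApprox K fun p => NormedSpace.exp (L p) := by
  intro ε hε
  have hexp : Continuous fun x : 𝔸 => NormedSpace.exp (-x) :=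
    differentiable_exp_of_complex.continuous.comp continuous_neg
  obtain ⟨b, hb⟩ := hK.exists_bound_of_continuousOn
    (differentiable_exp_of_complex.continuous.comp_continuousOn hL)
  have hb1 : 0 < |b| + 1 := by positivity
  obtain ⟨δ, hδ, hδ'⟩ := Metric.mem_uniformity_dist.1
    ((hK.image_of_continuousOn hL).uniformContinuousAt_of_continuousAt _
      (fun a _ => hexp.continuousAt) (Metric.dist_mem_uniformity (div_pos hε hb1)))
  obtain ⟨P, hP, hPL⟩ := h (δ / 2) (by positivity)
  refine ⟨fun p => NormedSpace.exp (P p), ⟨(differentiable_exp_of_complex.comp hP).differentiableOn,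
    fun p _ => isUnit_exp_of_complex _⟩, fun p hp => ?_⟩
  have h1 : dist (L p) (P p) < δ := by
    rw [dist_comm, dist_eq_norm]; linarith [hPL p hp]
  have h2 : dist (NormedSpace.exp (-L p)) (NormedSpace.exp (-P p)) < ε / (|b| + 1) :=
    hδ' h1 (mem_image_of_mem L hp)
  rw [dist_comm, dist_eq_norm] at h2
  rw [inverse_exp, ← exp_neg_mul_exp (L p), ← sub_mul]
  have hb' : ‖NormedSpace.exp (L p)‖ ≤ |b| + 1 := (hb p hp).trans (by linarith [le_abs_self b])
  calc _ ≤ _ := norm_mul_le _ _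
    _ ≤ ε / (|b| + 1) * (|b| + 1) := by gcongr
    _ = ε := by field_simp

/-- Holomorphic functions on a bidisc are limits of polynomials. -/
theorem exists_entire_approx {R₁ R₂ ρ₁ ρ₂ : ℝ} (h₁ : 0 < ρ₁) (hR₁ : ρ₁ < R₁) (h₂ : 0 < ρ₂)
    (hR₂ : ρ₂ < R₂) {f : ℂ × ℂ → 𝔸} (hf : DifferentiableOn ℂ f (ball 0 R₁ ×ˢ ball 0 R₂))
    {δ : ℝ} (hδ : 0 < δ) : ∃ P : ℂ × ℂ → 𝔸, Differentiable ℂ P ∧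
      ∀ p ∈ closedBall (0 : ℂ) ρ₁ ×ˢ closedBall (0 : ℂ) ρ₂, ‖P p - f p‖ ≤ δ := by
  obtain ⟨s₁, hs₁, hs₁'⟩ := exists_between hR₁
  obtain ⟨s₂, hs₂, hs₂'⟩ := exists_between hR₂
  obtain ⟨r₁, hr₁, hr₁'⟩ := exists_between hs₁
  obtain ⟨r₂, hr₂, hr₂'⟩ := exists_between hs₂
  obtain ⟨M, hM⟩ := ((isCompact_closedBall (0 : ℂ) s₁).prod
    (isCompact_closedBall (0 : ℂ) s₂)).exists_bound_of_continuousOn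
    (hf.continuousOn.mono (prod_mono (closedBall_subset_ball hs₁') (closedBall_subset_ball hs₂')))
  obtain ⟨c, hc1, hc2⟩ := exists_taylor_bidisc (h₁.trans hr₁) hr₁' (h₂.trans hr₂) hr₂'
    (hf.mono (prod_mono (ball_subset_ball hs₁'.le) (ball_subset_ball hs₂'.le)))
    fun p hp => hM p (prod_mono ball_subset_closedBall ball_subset_closedBall hp)
  have h₁r : 0 < r₁ := h₁.trans hr₁
  have h₂r : 0 < r₂ := h₂.trans hr₂
  have hsum : Summable fun p : ℕ × ℕ => M * ((ρ₁ / r₁) ^ p.1 * (ρ₂ / r₂) ^ p.2) := by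
    refine Summable.mul_left M ?_
    exact Summable.mul_of_nonneg (f := fun m : ℕ => (ρ₁ / r₁) ^ m)
      (g := fun n : ℕ => (ρ₂ / r₂) ^ n)
      (summable_geometric_of_lt_one (by positivity) ((div_lt_one h₁r).2 hr₁))
      (summable_geometric_of_lt_one (by positivity) ((div_lt_one h₂r).2 hr₂))
      (fun m => by positivity) (fun n => by positivity)
  have hunif := tendstoUniformlyOn_tsum hsum
    (f := fun (m : ℕ × ℕ) (p : ℂ × ℂ) => (p.1 ^ m.1 * p.2 ^ m.2) • c m)
    (s := closedBall (0 : ℂ) ρ₁ ×ˢ closedBall (0 : ℂ) ρ₂) (by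
      rintro m ⟨z, u⟩ ⟨hz, hu⟩
      simp only [mem_closedBall, dist_zero_right] at hz hu
      rw [norm_smul, norm_mul, norm_pow, norm_pow]
      calc ‖z‖ ^ m.1 * ‖u‖ ^ m.2 * ‖c m‖
          ≤ ρ₁ ^ m.1 * ρ₂ ^ m.2 * (M * ((r₁ ^ m.1)⁻¹ * (r₂ ^ m.2)⁻¹)) := by
            gcongr; exact hc1 m
        _ = _ := by rw [div_pow, div_pow]; ring)
  obtain ⟨t, ht⟩ := (Metric.tendstoUniformlyOn_iff.1 hunif δ hδ).exists
  refine ⟨fun p => ∑ m ∈ t, (p.1 ^ m.1 * p.2 ^ m.2) • c m, by fun_prop, ?_⟩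
  rintro p hp
  have h1 := ht p hp
  have h2 := (hc2 p ((mem_closedBall_zero_iff.1 hp.1).trans_lt hr₁)
    ((mem_closedBall_zero_iff.1 hp.2).trans_lt hr₂)).tsum_eq
  rw [h2, dist_comm, dist_eq_norm] at h1
  exact h1.le

/-- Runge approximation on bidiscs for maps into the units of a Banach algebra. -/
theorem unitApprox_bidisc {R₁ R₂ ρ₁ ρ₂ : ℝ} (h₁ : 0 < ρ₁) (hR₁ : ρ₁ < R₁) (h₂ : 0 < ρ₂)
    (hR₂ : ρ₂ < R₂) {A : ℂ × ℂ → 𝔸} (hA : HolUnit A (ball 0 R₁ ×ˢ ball 0 R₂)) :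
    UnitApprox (closedBall (0 : ℂ) ρ₁ ×ˢ closedBall (0 : ℂ) ρ₂) A := by
  obtain ⟨δ, hδ, l, hl, hl'⟩ := exists_log_near_one (𝔸 := 𝔸)
  obtain ⟨s₁, hs₁, hs₁'⟩ := exists_between hR₁
  obtain ⟨s₂, hs₂, hs₂'⟩ := exists_between hR₂
  set K := closedBall (0 : ℂ) ρ₁ ×ˢ closedBall (0 : ℂ) ρ₂ with hKdef
  set K' := closedBall (0 : ℂ) s₁ ×ˢ closedBall (0 : ℂ) s₂ with hK'def
  have hK : IsCompact K := (isCompact_closedBall _ _).prod (isCompact_closedBall _ _)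
  have hK' : IsCompact K' := (isCompact_closedBall _ _).prod (isCompact_closedBall _ _)
  have hKK' : K ⊆ K' := prod_mono (closedBall_subset_closedBall hs₁.le)
    (closedBall_subset_closedBall hs₂.le)
  have hKK'' : K ⊆ ball (0 : ℂ) s₁ ×ˢ ball (0 : ℂ) s₂ :=
    prod_mono (closedBall_subset_ball hs₁) (closedBall_subset_ball hs₂)
  have hmaps : ∀ t ∈ Icc (0 : ℝ) 1, ∀ p ∈ K', t • p ∈ ball (0 : ℂ) R₁ ×ˢ ball (0 : ℂ) R₂ := by
    rintro t ⟨ht0, ht1⟩ ⟨z, u⟩ ⟨hz, hu⟩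
    simp only [mem_closedBall_zero_iff] at hz hu
    have : ∀ {w : ℂ} {a b : ℝ}, ‖w‖ ≤ a → a < b → t • w ∈ ball (0 : ℂ) b := by
      intro w a b hw hab
      rw [mem_ball_zero_iff, norm_smul, Real.norm_of_nonneg ht0]
      nlinarith [norm_nonneg w]
    exact ⟨this hz hs₁', this hu hs₂'⟩
  have hunit : ∀ t ∈ Icc (0 : ℝ) 1,
      HolUnit (fun p => A (t • p)) (ball (0 : ℂ) s₁ ×ˢ ball 0 s₂) := by
    intro t ht
    refine hA.comp (f := fun p : ℂ × ℂ => t • p) (by fun_prop) fun p hp => hmaps t ht p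
      (prod_mono ball_subset_closedBall ball_subset_closedBall hp)
  have hcont : ContinuousOn (fun x : (ℝ × ℝ) × (ℂ × ℂ) =>
      Ring.inverse (A (x.1.1 • x.2)) * A (x.1.2 • x.2)) ((Icc 0 1 ×ˢ Icc 0 1) ×ˢ K') := by
    refine ContinuousOn.mul (hA.inv.1.continuousOn.comp (by fun_prop) ?_)
      (hA.1.continuousOn.comp (by fun_prop) ?_)
    · rintro x ⟨hx, hp⟩
      exact hmaps _ hx.1 _ hp
    · rintro x ⟨hx, hp⟩
      exact hmaps _ hx.2 _ hp
  have huc := ((isCompact_Icc.prod isCompact_Icc).prod hK').uniformContinuousOn_of_continuous hcont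
  obtain ⟨η, hη, hη'⟩ := Metric.uniformContinuousOn_iff.1 huc δ hδ
  obtain ⟨N, hN⟩ := exists_nat_gt (1 / η)
  have hN0 : (0 : ℝ) < N := (by positivity : (0 : ℝ) < 1 / η).trans hN
  have hstep : ∀ j : ℕ, j ≤ N → UnitApprox K fun p => A (((j : ℝ) / N) • p) := by
    intro j
    induction j with
    | zero =>
      intro _
      refine (unitApprox_const (a := A 0) (hA.2 0 ?_) K).congr fun p hp => by simp
      exact ⟨mem_ball_self (h₁.trans hR₁), mem_ball_self (h₂.trans hR₂)⟩
    | succ j ih =>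
      intro hj
      have ht : (j : ℝ) / N ∈ Icc (0 : ℝ) 1 := ⟨by positivity, by
        rw [div_le_one hN0]; exact_mod_cast (Nat.le_of_succ_le hj)⟩
      have ht' : ((j + 1 : ℕ) : ℝ) / N ∈ Icc (0 : ℝ) 1 := ⟨by positivity, by
        rw [div_le_one hN0]; exact_mod_cast hj⟩
      set t : ℝ := (j : ℝ) / N with htdef
      set t' : ℝ := ((j + 1 : ℕ) : ℝ) / N with ht'def
      have htt' : |t' - t| < η := by
        have : t' - t = 1 / N := by rw [htdef, ht'def]; push_cast; field_simp; ring
        rw [this, abs_of_pos (by positivity), div_lt_iff₀ hN0]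
        rwa [div_lt_iff₀ hη, mul_comm] at hN
      set F : ℂ × ℂ → 𝔸 := fun p => Ring.inverse (A (t • p)) * A (t' • p) with hF
      have hFu : HolUnit F (ball (0 : ℂ) s₁ ×ˢ ball 0 s₂) := (hunit t ht).inv.mul (hunit t' ht')
      have hFδ : ∀ p ∈ ball (0 : ℂ) s₁ ×ˢ ball (0 : ℂ) s₂, F p ∈ ball (1 : 𝔸) δ := by
        intro p hp
        have hp' := prod_mono ball_subset_closedBall ball_subset_closedBall hp
        have := hη' ((t, t'), p) ⟨⟨ht, ht'⟩, hp'⟩ ((t, t), p) ⟨⟨ht, ht⟩, hp'⟩ (by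
          simpa [Prod.dist_eq, Real.dist_eq, hη] using htt')
        simp only [Ring.inverse_mul_cancel _ ((hunit t ht).2 p hp)] at this
        exact this
      have hL : DifferentiableOn ℂ (fun p => l (F p)) (ball (0 : ℂ) s₁ ×ˢ ball 0 s₂) :=
        hl.comp hFu.1 hFδ
      have hG : UnitApprox K F :=
        (unitApprox_exp hK (hL.continuousOn.mono hKK'') fun ε hε =>
          exists_entire_approx h₁ hs₁ h₂ hs₂ hL hε).congr
          fun p hp => (hl' _ (hFδ p (hKK'' hp))).symm
      refine ((ih (Nat.le_of_succ_le hj)).mul hK (hFu.1.continuousOn.mono hKK'') hG).congr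
        fun p hp => ?_
      rw [hF, ← mul_assoc, Ring.mul_inverse_cancel _ ((hunit t ht).2 p (hKK'' hp)), one_mul]
  refine (hstep N le_rfl).congr fun p _ => ?_
  rw [div_self hN0.ne', one_smul]

end HolUnits

section HolUnitTools

open Set Metric Filter Topology

variable {𝔸 : Type*} [NormedRing 𝔸] [NormedAlgebra ℂ 𝔸]
variable {X : Type*} [NormedAddCommGroup X] [NormedSpace ℂ X]

theorem HolUnit.glue {f g : X → 𝔸} {s t : Set X} (hs : IsOpen s) (ht : IsOpen t)
    (hf : HolUnit f s) (hg : HolUnit g t) (hfg : ∀ p ∈ s, p ∈ t → f p = g p) :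
    ∃ h : X → 𝔸, HolUnit h (s ∪ t) ∧ (∀ p ∈ s, h p = f p) ∧ ∀ p ∈ t, h p = g p := by
  classical
  have h1 : ∀ p ∈ s, s.piecewise f g p = f p := fun p hp => piecewise_eq_of_mem _ _ _ hp
  have h2 : ∀ p ∈ t, s.piecewise f g p = g p := fun p hp => by
    by_cases hps : p ∈ s
    · rw [h1 p hps, hfg p hps hp]
    · exact piecewise_eq_of_notMem _ _ _ hps
  refine ⟨s.piecewise f g, ⟨?_, ?_⟩, h1, h2⟩
  · exact (hf.1.congr h1).union_of_isOpen (hg.1.congr h2) hs ht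
  · rintro p (hp | hp)
    · rw [h1 p hp]; exact hf.2 p hp
    · rw [h2 p hp]; exact hg.2 p hp

variable [CompleteSpace 𝔸]

omit [NormedAlgebra ℂ 𝔸] in
theorem isUnit_one_add_of_norm_lt {x : 𝔸} (h : ‖x‖ < 1) : IsUnit (1 + x) := by
  simpa using isUnit_one_sub_of_norm_lt_one (x := -x) (by simpa using h)

omit [NormedAlgebra ℂ 𝔸] in
theorem norm_inverse_one_add_sub_one_le {x : 𝔸} {η : ℝ} (h : ‖x‖ ≤ η) (hη : η ≤ 1 / 2) :
    ‖Ring.inverse (1 + x) - 1‖ ≤ 2 * η := by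
  set y := Ring.inverse (1 + x) - 1 with hy
  have h1 : (1 + x) * (1 + y) = 1 := by
    rw [hy, add_sub_cancel, Ring.mul_inverse_cancel _ (isUnit_one_add_of_norm_lt (by linarith))]
  have h2 : y = -x - x * y := by
    have : (1 + x) * (1 + y) = 1 + (y + x + x * y) := by noncomm_ring
    rw [this] at h1
    have h3 : y + x + x * y = 0 := by simpa using h1
    have : y = (y + x + x * y) - x - x * y := by abel
    rw [h3] at this
    rw [zero_sub] at this
    exact this
  have h3 : ‖y‖ ≤ η + η * ‖y‖ := by
    calc ‖y‖ = ‖-x - x * y‖ := by rw [← h2]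
      _ ≤ ‖x‖ + ‖x‖ * ‖y‖ :=
          (norm_sub_le _ _).trans (by rw [norm_neg]; gcongr; exact norm_mul_le _ _)
      _ ≤ _ := by gcongr
  nlinarith [norm_nonneg y, norm_nonneg x]

theorem holUnit_one_add_tsum {G : Type*} {s : Set X} (hs : IsOpen s) {q : G → 𝔸} {w : G → ℝ}
    {χ : G → X → ℂ} {ε : ℝ} (hε : ε < 1) (hsum : Summable fun g => w g * ‖q g‖)
    (hq : ∑' g, w g * ‖q g‖ ≤ ε)
    (hχ : ∀ g, q g ≠ 0 → DifferentiableOn ℂ (χ g) s ∧ ∀ x ∈ s, ‖χ g x‖ ≤ w g) :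
    HolUnit (fun x => 1 + ∑' g, χ g x • q g) s ∧ ∀ x ∈ s, ‖∑' g, χ g x • q g‖ ≤ ε := by
  have hb : ∀ g, ∀ x ∈ s, ‖χ g x • q g‖ ≤ w g * ‖q g‖ := by
    intro g x hx
    by_cases hg : q g = 0
    · simp [hg]
    · rw [norm_smul]
      exact mul_le_mul_of_nonneg_right ((hχ g hg).2 x hx) (norm_nonneg _)
  have hn : ∀ x ∈ s, ‖∑' g, χ g x • q g‖ ≤ ε := fun x hx =>
    (tsum_of_norm_bounded hsum.hasSum fun g => hb g x hx).trans hq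
  refine ⟨⟨?_, fun x hx => isUnit_one_add_of_norm_lt ((hn x hx).trans_lt hε)⟩, hn⟩
  refine (differentiableOn_const _).add (differentiableOn_tsum_of_norm_le hs (fun g => ?_) hsum hb)
  by_cases hg : q g = 0
  · simp [hg]
  · exact (hχ g hg).1.smul (differentiableOn_const _)

/-- A sequence of holomorphic unit-valued maps whose successive quotients tend to `1` rapidly on
an exhaustion converges to a holomorphic unit-valued map. -/
theorem exists_limit_of_quotient_close {Ω : ℕ → Set X} (hΩ : ∀ n, IsOpen (Ω n)) (hmono : Monotone Ω)
    (hcover : ∀ p, ∃ n, p ∈ Ω n) {A : ℕ → X → 𝔸} (hA : ∀ n, HolUnit (A n) (Ω n))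
    (hclose : ∀ n, ∀ p ∈ Ω n, ‖Ring.inverse (A n p) * A (n + 1) p - 1‖ ≤ 1 / 8 * (1 / 2) ^ n) :
    ∃ B : X → 𝔸, HolUnit B univ ∧ ∀ p, Tendsto (fun n => A n p) atTop (𝓝 (B p)) := by
  have hlocal : ∀ N, ∃ B : X → 𝔸, HolUnit B (Ω N) ∧
      ∀ p ∈ Ω N, Tendsto (fun n => A n p) atTop (𝓝 (B p)) := by
    intro N
    set P : ℕ → X → 𝔸 := fun n p => Ring.inverse (A N p) * A (N + n) p with hP
    have hPu : ∀ n, HolUnit (P n) (Ω N) := fun n =>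
      (hA N).inv.mul ((hA (N + n)).mono (hmono (Nat.le_add_right _ _)))
    have hP0 : ∀ p ∈ Ω N, P 0 p = 1 := fun p hp => Ring.inverse_mul_cancel _ ((hA N).2 p hp)
    have hrec : ∀ n, ∀ p ∈ Ω N, P (n + 1) p - P n p =
        P n p * (Ring.inverse (A (N + n) p) * A (N + n + 1) p - 1) := by
      intro n p hp
      have hu := (hA (N + n)).2 p (hmono (Nat.le_add_right _ _) hp)
      rw [mul_sub, mul_one]
      simp only [hP]
      rw [mul_assoc, ← mul_assoc (A (N + n) p), Ring.mul_inverse_cancel _ hu, one_mul, add_assoc]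
    have hq : ∀ n, ∀ p ∈ Ω N,
        ‖Ring.inverse (A (N + n) p) * A (N + n + 1) p - 1‖ ≤ 1 / 8 * (1 / 2) ^ n := by
      intro n p hp
      refine (hclose (N + n) p (hmono (Nat.le_add_right _ _) hp)).trans ?_
      gcongr 1 / 8 * ?_
      exact pow_le_pow_of_le_one (by norm_num) (by norm_num) (Nat.le_add_left _ _)
    have hb : ∀ n, ∀ p ∈ Ω N, ‖P n p - 1‖ ≤ 1 / 2 * (1 - (1 / 2) ^ n) := by
      intro n p hp
      induction n with
      | zero => simp [hP0 p hp]
      | succ n ih =>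
        have e : P (n + 1) p - 1 = (P n p - 1) +
            ((Ring.inverse (A (N + n) p) * A (N + n + 1) p - 1) +
            (P n p - 1) * (Ring.inverse (A (N + n) p) * A (N + n + 1) p - 1)) := by
          have := hrec n p hp
          rw [← sub_add_cancel (P (n + 1) p) (P n p), this]
          noncomm_ring
        rw [e]
        set d := Ring.inverse (A (N + n) p) * A (N + n + 1) p - 1 with hd
        have h1 : ‖(P n p - 1) * d‖ ≤ 1 * ‖d‖ := (norm_mul_le _ _).trans (by
          gcongr
          have : (0 : ℝ) ≤ (1 / 2) ^ n := by positivity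
          linarith)
        have h2 := norm_add_le (P n p - 1) (d + (P n p - 1) * d)
        have h3 := norm_add_le d ((P n p - 1) * d)
        have h4 := hq n p hp
        rw [pow_succ]
        linarith
    have hd : ∀ n, ∀ p ∈ Ω N, ‖P (n + 1) p - P n p‖ ≤ 1 / 4 * (1 / 2) ^ n := by
      intro n p hp
      rw [hrec n p hp]
      set d := Ring.inverse (A (N + n) p) * A (N + n + 1) p - 1 with hd
      have e : P n p * d = d + (P n p - 1) * d := by noncomm_ring
      rw [e]
      have h1 : ‖(P n p - 1) * d‖ ≤ 1 * ‖d‖ := (norm_mul_le _ _).trans (by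
        gcongr
        have := hb n p hp
        have : (0 : ℝ) ≤ (1 / 2) ^ n := by positivity
        linarith)
      have h3 := norm_add_le d ((P n p - 1) * d)
      have h4 := hq n p hp
      linarith
    have hs : Summable fun n : ℕ => 1 / 4 * (1 / 2 : ℝ) ^ n := summable_geometric_two.mul_left _
    have hst : ∑' n : ℕ, 1 / 4 * (1 / 2 : ℝ) ^ n = 1 / 2 := by
      rw [tsum_mul_left, tsum_geometric_two]; norm_num
    have hdiff : DifferentiableOn ℂ (fun p => ∑' n, (P (n + 1) p - P n p)) (Ω N) :=
      differentiableOn_tsum_of_norm_le (hΩ N) (fun n => (hPu (n + 1)).1.sub (hPu n).1) hs hd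
    have hlim : ∀ p ∈ Ω N, Tendsto (fun n => P n p) atTop
        (𝓝 (1 + ∑' n, (P (n + 1) p - P n p))) := by
      intro p hp
      have := ((Summable.of_norm_bounded hs fun n => hd n p hp).hasSum.tendsto_sum_nat).const_add 1
      refine this.congr fun n => ?_
      rw [Finset.sum_range_sub (fun n => P n p), hP0 p hp]
      abel
    have hBu : HolUnit (fun p => A N p * (1 + ∑' n, (P (n + 1) p - P n p))) (Ω N) := by
      refine (hA N).mul ⟨(differentiableOn_const _).add hdiff, fun p hp => ?_⟩
      refine isUnit_one_add_of_norm_lt ((tsum_of_norm_bounded hs.hasSum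
        fun n => hd n p hp).trans_lt ?_)
      rw [hst]; norm_num
    refine ⟨_, hBu, fun p hp => ?_⟩
    rw [← tendsto_add_atTop_iff_nat N]
    refine ((hlim p hp).const_mul (A N p)).congr fun n => ?_
    simp only [hP]
    rw [← mul_assoc, Ring.mul_inverse_cancel _ ((hA N).2 p hp), one_mul, add_comm]
  choose B hB1 hB2 using hlocal
  choose N hN using hcover
  have heq : ∀ p n, p ∈ Ω n → B (N p) p = B n p := fun p n hp =>
    tendsto_nhds_unique (hB2 _ p (hN p)) (hB2 n p hp)
  refine ⟨fun p => B (N p) p, ⟨fun p _ => ?_, fun p _ => (hB1 _).2 p (hN p)⟩,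
    fun p => hB2 _ p (hN p)⟩
  have h1 : DifferentiableAt ℂ (B (N p)) p := ((hB1 (N p)).1 p (hN p)).differentiableAt
    ((hΩ _).mem_nhds (hN p))
  refine (h1.congr_of_eventuallyEq ?_).differentiableWithinAt
  filter_upwards [(hΩ _).mem_nhds (hN p)] with y hy using heq y _ hy

/-- Cartan factorization near an annulus of a family that is uniformly close to the identity. -/
theorem exists_annulus_factorization : ∃ δ > 0, ∀ (S : ℝ) (_ : 0 < S) (F : ℂ × ℂ → 𝔸),
    DifferentiableOn ℂ F ({z | (4 : ℝ)⁻¹ < ‖z‖ ∧ ‖z‖ < 4} ×ˢ ball 0 S) →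
    (∀ p ∈ {z : ℂ | (4 : ℝ)⁻¹ < ‖z‖ ∧ ‖z‖ < 4} ×ˢ ball (0 : ℂ) S, ‖F p - 1‖ ≤ δ) →
    ∃ P N : ℂ × ℂ → 𝔸, HolUnit P (ball 0 2 ×ˢ ball 0 (S / 4)) ∧
      HolUnit N (ball 0 2 ×ˢ ball 0 (S / 4)) ∧
      ∀ z u : ℂ, (2 : ℝ)⁻¹ < ‖z‖ → ‖z‖ < 2 → ‖u‖ < S / 4 →
        P (z, u) * F (z, u) = N (z⁻¹, u) := by
  have hs0 : Summable fun p : ℤ × ℕ => (2 / 3 : ℝ) ^ p.1.natAbs * (1 / 2 : ℝ) ^ p.2 :=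
    Summable.mul_of_nonneg (f := fun m : ℤ => (2 / 3 : ℝ) ^ m.natAbs)
      (g := fun n : ℕ => (1 / 2 : ℝ) ^ n)
      (summable_pow_natAbs (by norm_num) (by norm_num)) summable_geometric_two
      (fun m => by positivity) (fun n => by positivity)
  set C := ∑' p : ℤ × ℕ, (2 / 3 : ℝ) ^ p.1.natAbs * (1 / 2 : ℝ) ^ p.2 with hC
  have hC0 : 0 ≤ C := tsum_nonneg fun p => by positivity
  refine ⟨1 / (8 * (C + 1)), by positivity, fun S hS F hF hδ => ?_⟩
  set δ := 1 / (8 * (C + 1)) with hδdef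
  obtain ⟨c, hc1, hc2⟩ := exists_laurent_taylor (R₁ := 3) (R := 4) (by norm_num) (by norm_num)
    (ρ := S / 2) (S := S) (by positivity) (by linarith) (f := fun p => F p - 1)
    (hF.sub (differentiableOn_const _)) hδ
  set w : ℤ × ℕ → ℝ := fun g => 2 ^ g.1.natAbs * (S / 4) ^ g.2 with hw
  have hwc : ∀ g, w g * ‖c g‖ ≤ δ * ((2 / 3 : ℝ) ^ g.1.natAbs * (1 / 2 : ℝ) ^ g.2) := by
    intro g
    calc w g * ‖c g‖ ≤ w g * (δ * ((3 ^ g.1.natAbs)⁻¹ * ((S / 2) ^ g.2)⁻¹)) := by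
          gcongr; exact hc1 g
      _ = δ * ((2 / 3 : ℝ) ^ g.1.natAbs * ((S / 4) / (S / 2)) ^ g.2) := by
          have e1 : (2 / 3 : ℝ) ^ g.1.natAbs = 2 ^ g.1.natAbs * (3 ^ g.1.natAbs)⁻¹ := by
            rw [div_pow, div_eq_mul_inv]
          have e2 : ((S / 4) / (S / 2)) ^ g.2 = (S / 4) ^ g.2 * ((S / 2) ^ g.2)⁻¹ := by
            rw [div_pow, div_eq_mul_inv]
          rw [e1, e2]; simp only [hw]; ring
      _ = _ := by
          congr 3
          field_simp; norm_num
  have hsum : Summable fun g => w g * ‖c g‖ :=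
    Summable.of_nonneg_of_le (fun g => by positivity) hwc (hs0.mul_left δ)
  have hle : ∑' g, w g * ‖c g‖ ≤ 1 / 8 := by
    refine (hsum.tsum_le_tsum hwc (hs0.mul_left δ)).trans ?_
    rw [tsum_mul_left, ← hC, hδdef, div_mul_eq_mul_div,
      div_le_div_iff₀ (by positivity) (by norm_num)]
    linarith
  obtain ⟨q, n, hq0, hn0, hqs, hns, hq1, hn1, hfac⟩ := exists_cartan_factorization (w := w)
    (fun g => by positivity) (fun g h => by
      calc w (g + h) ≤ 2 ^ (g.1.natAbs + h.1.natAbs) * (S / 4) ^ (g.2 + h.2) := by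
            simp only [hw, Prod.fst_add, Prod.snd_add]
            gcongr
            · norm_num
            · exact Int.natAbs_add_le _ _
        _ = _ := by rw [pow_add, pow_add]; simp only [hw]; ring)
    {g | 0 ≤ g.1} (by norm_num : (1 / 8 : ℝ) ≤ 1 / 4) hsum hle
  have hdomo : IsOpen (ball (0 : ℂ) 2 ×ˢ ball (0 : ℂ) (S / 4)) := isOpen_ball.prod isOpen_ball
  refine ⟨fun p => 1 + ∑' g : ℤ × ℕ, (p.1 ^ g.1.toNat * p.2 ^ g.2) • q g,
    fun p => 1 + ∑' g : ℤ × ℕ, (p.1 ^ (-g.1).toNat * p.2 ^ g.2) • n g, ?_, ?_, ?_⟩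
  · refine (holUnit_one_add_tsum hdomo (w := w) (ε := 1 / 4) (by norm_num) hqs (by linarith)
      (χ := fun (g : ℤ × ℕ) (p : ℂ × ℂ) => p.1 ^ g.1.toNat * p.2 ^ g.2) fun g hg => ?_).1
    have hg0 : 0 ≤ g.1 := by by_contra h; exact hg (hq0 g h)
    refine ⟨by fun_prop, ?_⟩
    rintro ⟨z, u⟩ ⟨hz, hu⟩
    simp only [mem_ball_zero_iff] at hz hu
    rw [norm_mul, norm_pow, norm_pow]
    have : g.1.toNat = g.1.natAbs := by omega
    simp only [this, hw]
    gcongr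
  · refine (holUnit_one_add_tsum hdomo (w := w) (ε := 1 / 2) (by norm_num) hns (by linarith)
      (χ := fun (g : ℤ × ℕ) (p : ℂ × ℂ) => p.1 ^ (-g.1).toNat * p.2 ^ g.2) fun g hg => ?_).1
    have hg0 : g.1 < 0 := by by_contra h; exact hg (hn0 g (not_lt.1 h))
    refine ⟨by fun_prop, ?_⟩
    rintro ⟨z, u⟩ ⟨hz, hu⟩
    simp only [mem_ball_zero_iff] at hz hu
    rw [norm_mul, norm_pow, norm_pow]
    have : (-g.1).toNat = g.1.natAbs := by omega
    simp only [this, hw]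
    gcongr
  · intro z u hz1 hz2 hu
    have hz0 : z ≠ 0 := by rintro rfl; norm_num at hz1
    have hFs := (hc2 (z, u) (lt_trans (by norm_num) hz1) (hz2.trans (by norm_num))
      (hu.trans (by linarith : S / 4 < S / 2))).tsum_eq
    have hzz : ∀ m : ℤ, ‖z‖ ^ m ≤ 2 ^ m.natAbs := by
      intro m
      obtain ⟨n, rfl | rfl⟩ := m.eq_nat_or_neg
      · rw [zpow_natCast, Int.natAbs_natCast]; gcongr
      · rw [_root_.zpow_neg, zpow_natCast, Int.natAbs_neg, Int.natAbs_natCast, ← inv_pow]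
        gcongr
        rw [inv_le_comm₀ (norm_pos_iff.2 hz0) (by norm_num)]
        exact hz1.le
    have key := hfac (fun g => z ^ g.1 * u ^ g.2) (fun g => by
        rw [norm_mul, norm_pow, norm_zpow]
        exact mul_le_mul (hzz _) (by gcongr) (by positivity) (by positivity)) (fun g h => by
        rw [Prod.fst_add, Prod.snd_add, zpow_add₀ hz0, pow_add]; ring)
    simp only at hFs
    rw [hFs, add_sub_cancel] at key
    simp only
    convert key using 3
    · refine tsum_congr fun g => ?_
      by_cases hg : 0 ≤ g.1
      · congr 2
        rw [← zpow_natCast, Int.toNat_of_nonneg hg]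
      · rw [hq0 g hg, smul_zero, smul_zero]
    · funext g
      by_cases hg : 0 ≤ g.1
      · rw [hn0 g hg, smul_zero, smul_zero]
      · congr 2
        rw [← zpow_natCast, Int.toNat_of_nonneg (by omega), _root_.inv_zpow,
          _root_.zpow_neg, inv_inv]

end HolUnitTools

section Frames

open Set Metric Filter Topology

variable {𝔸 : Type*} [NormedRing 𝔸] [NormedAlgebra ℂ 𝔸]

theorem coordChange_coordChange (k : ℕ) {p : ℂ × ℂ} (hp : p.1 ≠ 0) :
    coordChange k (coordChange k p) = p := by
  ext
  · simp [coordChange]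
  · simp [coordChange, hp]

theorem coordChange_fst_ne_zero (k : ℕ) {p : ℂ × ℂ} (hp : p.1 ≠ 0) : (coordChange k p).1 ≠ 0 :=
  inv_ne_zero hp

theorem differentiableOn_coordChange (k : ℕ) : DifferentiableOn ℂ (coordChange k) overlap := by
  intro p hp
  have hp' : p.1 ≠ 0 := hp
  have h1 : DifferentiableAt ℂ (fun p : ℂ × ℂ => p.1⁻¹) p := differentiableAt_fst.inv hp'
  exact (h1.prodMk (by fun_prop)).differentiableWithinAt

theorem isOpen_overlap : IsOpen overlap := isOpen_ne_fun continuous_fst continuous_const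

theorem isOpen_setOf_norm_lt {X : Type*} [TopologicalSpace X] {f g : X → ℂ} (hf : Continuous f)
    (hg : Continuous g) (a b : ℝ) : IsOpen {p | ‖f p‖ < a ∧ ‖g p‖ < b} :=
  (isOpen_lt hf.norm continuous_const).inter (isOpen_lt hg.norm continuous_const)

/-- The part of a chart of `Z_k` on which the fibre coordinate is bounded by `C`, and the fibre
coordinate of the other chart is bounded by `D`. -/
def tube (k : ℕ) (C D : ℝ) : Set (ℂ × ℂ) := {p | ‖p.2‖ < C ∧ ‖p.1 ^ k * p.2‖ < D}

theorem isOpen_tube (k : ℕ) (C D : ℝ) : IsOpen (tube k C D) :=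
  isOpen_setOf_norm_lt continuous_snd ((continuous_fst.pow k).mul continuous_snd) C D

theorem tube_mono {k : ℕ} {C C' D D' : ℝ} (hC : C ≤ C') (hD : D ≤ D') :
    tube k C D ⊆ tube k C' D' := fun _ hp => ⟨hp.1.trans_le hC, hp.2.trans_le hD⟩

theorem coordChange_mem_tube {k : ℕ} {C D : ℝ} {p : ℂ × ℂ} (hp : p.1 ≠ 0) (h : p ∈ tube k C D) :
    coordChange k p ∈ tube k D C := by
  refine ⟨h.2, ?_⟩
  have : (coordChange k p).1 ^ k * (coordChange k p).2 = p.2 :=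
    congrArg Prod.snd (coordChange_coordChange k hp)
  rw [this]
  exact h.1

/-- A pair of holomorphic gauges trivializing the transition matrix `T` on a tube. -/
structure Frame (k : ℕ) (T A B : ℂ × ℂ → 𝔸) (C D : ℝ) : Prop where
  left : HolUnit A (tube k C D)
  right : HolUnit B (tube k D C)
  eq : ∀ p, p.1 ≠ 0 → p ∈ tube k C D → A p = T p * B (coordChange k p)

theorem Frame.mono {k : ℕ} {T A B : ℂ × ℂ → 𝔸} {C C' D D' : ℝ} (h : Frame k T A B C' D')
    (hC : C ≤ C') (hD : D ≤ D') : Frame k T A B C D :=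
  ⟨h.left.mono (tube_mono hC hD), h.right.mono (tube_mono hD hC),
    fun p hp hpt => h.eq p hp (tube_mono hC hD hpt)⟩

/-- The transition matrix seen from the other chart. -/
def swapT (k : ℕ) (T : ℂ × ℂ → 𝔸) (p : ℂ × ℂ) : 𝔸 := Ring.inverse (T (coordChange k p))

theorem HolUnit.swapT [CompleteSpace 𝔸] {T : ℂ × ℂ → 𝔸} (k : ℕ) (hT : HolUnit T overlap) :
    HolUnit (swapT k T) overlap :=
  hT.inv.comp (differentiableOn_coordChange k) fun _ hp => coordChange_fst_ne_zero k hp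

theorem Frame.swap {k : ℕ} {T A B : ℂ × ℂ → 𝔸} {C D : ℝ} (hT : HolUnit T overlap)
    (h : Frame k T A B C D) : Frame k (swapT k T) B A D C := by
  refine ⟨h.right, h.left, fun q hq hqt => ?_⟩
  have h1 := h.eq _ (coordChange_fst_ne_zero k hq) (coordChange_mem_tube hq hqt)
  rw [coordChange_coordChange k hq] at h1
  rw [h1, swapT, Ring.inverse_mul_cancel_left _ _ (hT.2 _ (coordChange_fst_ne_zero k hq))]

theorem swapT_swapT (k : ℕ) {T : ℂ × ℂ → 𝔸} (hT : HolUnit T overlap) {p : ℂ × ℂ}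
    (hp : p.1 ≠ 0) : swapT k (swapT k T) p = T p := by
  rw [swapT, swapT, coordChange_coordChange k hp]
  obtain ⟨u, hu⟩ := hT.2 p hp
  rw [← hu, Ring.inverse_unit, Ring.inverse_unit, inv_inv]

/-- A frame near the zero section extends away from it along any bounded region. -/
theorem Frame.of_pieces [CompleteSpace 𝔸] {k : ℕ} {T : ℂ × ℂ → 𝔸} (hT : HolUnit T overlap)
    {U V : Set (ℂ × ℂ)} {A B : ℂ × ℂ → 𝔸} {C D : ℝ}
    (hUo : IsOpen U) (hVo : IsOpen V) (hA : HolUnit A U) (hB : HolUnit B V)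
    (hAB : ∀ p ∈ U, p.1 ≠ 0 → coordChange k p ∈ V → A p = T p * B (coordChange k p))
    (hU : ∀ p ∈ tube k C D, p ∉ U → p.1 ≠ 0 ∧ coordChange k p ∈ V)
    (hV : ∀ q ∈ tube k D C, q ∉ V → q.1 ≠ 0 ∧ coordChange k q ∈ U) :
    ∃ A' B', Frame k T A' B' C D ∧ (∀ p ∈ U, A' p = A p) ∧ ∀ q ∈ V, B' q = B q := by
  have hcont : ContinuousOn (coordChange k) overlap :=
    (differentiableOn_coordChange k).continuousOn
  have hU' : IsOpen (overlap ∩ coordChange k ⁻¹' U) :=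
    hcont.isOpen_inter_preimage isOpen_overlap hUo
  have hV' : IsOpen (overlap ∩ coordChange k ⁻¹' V) :=
    hcont.isOpen_inter_preimage isOpen_overlap hVo
  obtain ⟨A', hA', hA'1, hA'2⟩ := hA.glue (g := fun p => T p * B (coordChange k p)) hUo hV'
    ((hT.mono inter_subset_left).mul (hB.comp ((differentiableOn_coordChange k).mono
      inter_subset_left) fun p hp => hp.2)) fun p hp hp' => hAB p hp hp'.1 hp'.2
  obtain ⟨B', hB', hB'1, hB'2⟩ := hB.glue (g := fun p => swapT k T p * A (coordChange k p)) hVo hU'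
    (((hT.swapT k).mono inter_subset_left).mul (hA.comp ((differentiableOn_coordChange k).mono
      inter_subset_left) fun p hp => hp.2)) fun q hq hq' => by
        have hq0 : q.1 ≠ 0 := hq'.1
        have := hAB _ hq'.2 (coordChange_fst_ne_zero k hq0) (by
          rwa [coordChange_coordChange k hq0])
        rw [coordChange_coordChange k hq0] at this
        rw [this, swapT, Ring.inverse_mul_cancel_left _ _ (hT.2 _ (coordChange_fst_ne_zero k hq0))]
  refine ⟨A', B', ⟨hA'.mono fun p hp => ?_, hB'.mono fun p hp => ?_, fun p hp hpt => ?_⟩,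
    hA'1, hB'1⟩
  · by_cases h : p ∈ U
    · exact Or.inl h
    · exact Or.inr (hU p hp h)
  · by_cases h : p ∈ V
    · exact Or.inl h
    · exact Or.inr (hV p hp h)
  · by_cases h : coordChange k p ∈ V
    · rw [hB'1 _ h, hA'2 p ⟨hp, h⟩]
    · have h2 := hV _ (coordChange_mem_tube hp hpt) h
      rw [hB'2 _ h2, swapT, coordChange_coordChange k hp,
          Ring.mul_inverse_cancel_left _ _ (hT.2 p hp),
        hA'1 p]
      rw [coordChange_coordChange k hp] at h2
      exact h2.2

variable [CompleteSpace 𝔸]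

/-- A bundle which is trivialized on the zero section is trivial on a neighbourhood of it. -/
theorem exists_initial_frame {k : ℕ} {T : ℂ × ℂ → 𝔸} (hT : HolUnit T overlap)
    (hT1 : ∀ z : ℂ, z ≠ 0 → T (z, 0) = 1) :
    ∃ r > 0, ∀ D, ∃ A B, Frame k T A B r D := by
  obtain ⟨δ, hδ, hfac⟩ := exists_annulus_factorization (𝔸 := 𝔸)
  set K : Set ℂ := closedBall 0 4 ∩ {z | (4 : ℝ)⁻¹ ≤ ‖z‖} with hK
  have hKc : IsCompact K := (isCompact_closedBall (0 : ℂ) 4).inter_right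
    (isClosed_le continuous_const continuous_norm)
  have hK0 : ∀ z ∈ K, z ≠ 0 := by
    rintro z ⟨-, hz⟩ rfl
    norm_num at hz
  have huc := (hKc.prod (isCompact_closedBall (0 : ℂ) 1)).uniformContinuousOn_of_continuous
    (hT.1.continuousOn.mono fun p hp => hK0 p.1 hp.1)
  obtain ⟨η, hη, hη'⟩ := Metric.uniformContinuousOn_iff.1 huc δ hδ
  set S : ℝ := min η 1 with hS
  have hS0 : 0 < S := lt_min hη one_pos
  have hsub : {z : ℂ | (4 : ℝ)⁻¹ < ‖z‖ ∧ ‖z‖ < 4} ⊆ K := fun z hz =>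
    ⟨by simpa using hz.2.le, hz.1.le⟩
  obtain ⟨P, N, hP, hN, hPN⟩ := hfac S hS0 T
    (hT.1.mono fun p hp => hK0 p.1 (hsub hp.1)) (by
      rintro ⟨z, u⟩ ⟨hz, hu⟩
      have hu' : ‖u‖ < S := by simpa using hu
      have := hη' (z, u) ⟨hsub hz, by simpa using hu'.le.trans (min_le_right _ _)⟩
        (z, 0) ⟨hsub hz, by simp⟩ (by
          simpa [Prod.dist_eq, hη] using hu'.trans_le (min_le_left _ _))
      rw [hT1 z (hK0 z (hsub hz)), dist_eq_norm] at this
      exact this.le)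
  refine ⟨S / 4, by positivity, fun D => ?_⟩
  obtain ⟨A, B, h, -⟩ := Frame.of_pieces (k := k) (C := S / 4) (D := D) hT
    (U := {p | ‖p.1‖ < 2 ∧ ‖p.2‖ < S / 4}) (V := {q | ‖q.1‖ < 2 ∧ ‖q.1 ^ k * q.2‖ < S / 4})
    (A := fun p => Ring.inverse (P p)) (B := fun q => Ring.inverse (N (q.1, q.1 ^ k * q.2)))
    (isOpen_setOf_norm_lt continuous_fst continuous_snd _ _)
    (isOpen_setOf_norm_lt continuous_fst ((continuous_fst.pow k).mul continuous_snd) _ _)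
    (hP.inv.mono fun p hp => by simpa using hp)
    (hN.inv.comp (f := fun q : ℂ × ℂ => (q.1, q.1 ^ k * q.2)) (by fun_prop)
      fun q hq => by simpa using hq)
    (by
      rintro ⟨z, u⟩ ⟨hz, hu⟩ hz0 ⟨hc1, hc2⟩
      simp only at hz hu hz0
      simp only [coordChange] at hc1
      have h2 : (2 : ℝ)⁻¹ < ‖z‖ := by
        rw [norm_inv] at hc1
        rwa [inv_lt_comm₀ (by norm_num) (norm_pos_iff.2 hz0)]
      have e : (coordChange k (z, u)).1 ^ k * (coordChange k (z, u)).2 = u :=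
        congrArg Prod.snd (coordChange_coordChange k (p := (z, u)) hz0)
      rw [e]
      have h3 := hPN z u h2 hz hu
      have hPu := hP.2 (z, u) (by simpa using ⟨hz, hu⟩)
      have hNu := hN.2 (z⁻¹, u) (by
        simp only [mem_prod, mem_ball_zero_iff]; exact ⟨hc1, hu⟩)
      change Ring.inverse (P (z, u)) = T (z, u) * Ring.inverse (N (z⁻¹, u))
      rw [← h3] at hNu ⊢
      rw [Ring.inverse_mul (Or.inl hPu), Ring.mul_inverse_cancel_left _ _ (hT.2 (z, u) hz0)])
    (by
      rintro ⟨z, u⟩ ⟨hu, hv⟩ hp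
      simp only at hu hv
      have hz : 2 ≤ ‖z‖ := by
        by_contra h
        exact hp ⟨not_le.1 h, hu⟩
      have hz0 : z ≠ 0 := by rintro rfl; norm_num at hz
      refine ⟨hz0, ?_, ?_⟩
      · simp only [coordChange, norm_inv]
        exact (inv_anti₀ (by norm_num) hz).trans_lt (by norm_num)
      · have e : (coordChange k (z, u)).1 ^ k * (coordChange k (z, u)).2 = u :=
          congrArg Prod.snd (coordChange_coordChange k (p := (z, u)) hz0)
        rwa [e])
    (by
      rintro ⟨z, u⟩ ⟨hu, hv⟩ hp
      simp only at hu hv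
      have hz : 2 ≤ ‖z‖ := by
        by_contra h
        exact hp ⟨not_le.1 h, hv⟩
      have hz0 : z ≠ 0 := by rintro rfl; norm_num at hz
      refine ⟨hz0, ?_, hv⟩
      simp only [coordChange, norm_inv]
      exact (inv_anti₀ (by norm_num) hz).trans_lt (by norm_num))
  exact ⟨A, B, h⟩

end Frames

section Bumps

open Set Metric Filter Topology

variable {𝔸 : Type*} [NormedRing 𝔸] [NormedAlgebra ℂ 𝔸]

theorem pow_mul_pow_le_of_mul_le {x y ρ c : ℝ} (hx : 0 ≤ x) (hy : 0 ≤ y) (hxρ : x ≤ ρ)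
    {k m n : ℕ} (hxy : x ^ k * y ≤ ρ ^ k * c) (hmn : k * n ≤ m) :
    x ^ m * y ^ n ≤ ρ ^ m * c ^ n := by
  obtain ⟨j, rfl⟩ := Nat.exists_eq_add_of_le hmn
  calc x ^ (k * n + j) * y ^ n = x ^ j * (x ^ k * y) ^ n := by rw [pow_add, pow_mul, mul_pow]; ring
    _ ≤ ρ ^ j * (ρ ^ k * c) ^ n := by
        have := hx.trans hxρ
        gcongr
    _ = _ := by rw [pow_add, pow_mul, mul_pow]; ring

theorem pow_mul_pow_le_of_le_mul {x y ρ c : ℝ} (hx : 0 ≤ x) (hy : 0 ≤ y) (hρ : 0 < ρ) (hyc : y ≤ c)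
    {k m n : ℕ} (hxy : x ^ k * y ≤ ρ ^ k * c) (hmn : m ≤ k * n) :
    x ^ m * y ^ n ≤ ρ ^ m * c ^ n := by
  rcases le_total x ρ with h | h
  · gcongr
  · obtain ⟨j, hj⟩ := Nat.exists_eq_add_of_le hmn
    refine le_of_mul_le_mul_left ?_ (pow_pos hρ j)
    calc ρ ^ j * (x ^ m * y ^ n) ≤ x ^ j * (x ^ m * y ^ n) := by gcongr
      _ = (x ^ k * y) ^ n := by rw [mul_pow, ← pow_mul, hj, pow_add]; ring
      _ ≤ (ρ ^ k * c) ^ n := by gcongr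
      _ = _ := by rw [mul_pow, ← pow_mul, hj, pow_add]; ring

/-- Two pairs of gauges are `ε`-close on a tube. -/
structure GaugeClose (k : ℕ) (A B A₁ B₁ : ℂ × ℂ → 𝔸) (C D ε : ℝ) : Prop where
  left : ∀ p ∈ tube k C D, ‖Ring.inverse (A p) * A₁ p - 1‖ ≤ ε
  right : ∀ q ∈ tube k D C, ‖Ring.inverse (B q) * B₁ q - 1‖ ≤ ε

omit [NormedAlgebra ℂ 𝔸] in
theorem norm_inverse_mul_sub_one_le {a b c : 𝔸} (hb : IsUnit b) {ε : ℝ}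
    (h1 : ‖Ring.inverse a * b - 1‖ ≤ ε) (h2 : ‖Ring.inverse b * c - 1‖ ≤ ε) :
    ‖Ring.inverse a * c - 1‖ ≤ 2 * ε + ε ^ 2 := by
  set x := Ring.inverse a * b - 1 with hx
  set y := Ring.inverse b * c - 1 with hy
  have e : Ring.inverse a * c - 1 = x + y + x * y := by
    have : Ring.inverse a * c = (x + 1) * (y + 1) := by
      rw [hx, hy, sub_add_cancel, sub_add_cancel, mul_assoc, Ring.mul_inverse_cancel_left _ _ hb]
    rw [this]
    noncomm_ring
  rw [e]
  calc _ ≤ ‖x‖ + ‖y‖ + ‖x‖ * ‖y‖ := (norm_add_le _ _).trans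
        (add_le_add (norm_add_le _ _) (norm_mul_le _ _))
    _ ≤ ε + ε + ε * ε := by
        have := (norm_nonneg _).trans h1
        gcongr
    _ = _ := by ring

variable [CompleteSpace 𝔸]

/-- Change a frame slightly on a tube so that it extends along the first fibre coordinate. -/
theorem Frame.exists_bump_left {k : ℕ} (hk : 1 ≤ k) {T A B : ℂ × ℂ → 𝔸} (hT : HolUnit T overlap)
    {C D C' D' : ℝ} (h : Frame k T A B C D) (hC'0 : 0 < C') (hC' : C' < C) (hD'0 : 0 < D')
    (hD' : D' < D) {ε : ℝ} (hε : 0 < ε) (C'' : ℝ) :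
    ∃ A₁ B₁, Frame k T A₁ B₁ C'' D' ∧ GaugeClose k A B A₁ B₁ C' D' ε := by
  obtain ⟨ρ, hρ, hρk⟩ : ∃ ρ : ℝ, 0 < ρ ∧ ρ ^ k * C' = D' := by
    refine ⟨(D' / C') ^ (k : ℝ)⁻¹, by positivity, ?_⟩
    rw [Real.rpow_inv_natCast_pow (by positivity) (by omega), div_mul_cancel₀ _ hC'0.ne']
  obtain ⟨lam, hlam, hlamC, hlamD⟩ : ∃ l : ℝ, 1 < l ∧ l * C' < C ∧ l ^ (k + 1) * D' < D := by
    have h1 : ∀ᶠ l : ℝ in 𝓝 1, l * C' < C :=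
      (continuous_id.mul continuous_const).tendsto' 1 C' (by simp) |>.eventually_lt_const hC'
    have h2 : ∀ᶠ l : ℝ in 𝓝 1, l ^ (k + 1) * D' < D :=
      ((continuous_id.pow (k + 1)).mul continuous_const).tendsto' 1 D' (by simp)
        |>.eventually_lt_const hD'
    have h3 := (eventually_mem_nhdsWithin (a := (1 : ℝ)) (s := Ioi 1)).and
      (eventually_nhdsWithin_of_eventually_nhds (h1.and h2))
    obtain ⟨l, hl⟩ := h3.exists
    exact ⟨l, hl⟩
  obtain ⟨s, hs, hslam⟩ := exists_between hlam
  obtain ⟨μ, hμ, hμs⟩ := exists_between hs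
  have hs0 : 0 < s := by linarith
  have hμ0 : 0 < μ := by linarith
  have hsub : ball (0 : ℂ) (lam * ρ) ×ˢ ball (0 : ℂ) (lam * C') ⊆ tube k C D := by
    rintro ⟨z, u⟩ ⟨hz, hu⟩
    simp only [mem_ball_zero_iff] at hz hu
    refine ⟨hu.trans hlamC, ?_⟩
    rw [norm_mul, norm_pow]
    calc ‖z‖ ^ k * ‖u‖ ≤ (lam * ρ) ^ k * (lam * C') := by gcongr
      _ = lam ^ (k + 1) * D' := by rw [← hρk]; ring
      _ < D := hlamD
  have hsub' : ball (0 : ℂ) (s * ρ) ×ˢ ball (0 : ℂ) (s * C') ⊆ tube k C D :=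
    (Set.prod_mono (ball_subset_ball (by gcongr)) (ball_subset_ball (by gcongr))).trans hsub
  have hsum0 : Summable fun p : ℕ × ℕ => (μ⁻¹) ^ p.1 * (μ⁻¹) ^ p.2 :=
    Summable.mul_of_nonneg (f := fun m : ℕ => μ⁻¹ ^ m) (g := fun n : ℕ => μ⁻¹ ^ n)
      (summable_geometric_of_lt_one (by positivity) (inv_lt_one_of_one_lt₀ hμ))
      (summable_geometric_of_lt_one (by positivity) (inv_lt_one_of_one_lt₀ hμ))
      (fun m => by positivity) (fun n => by positivity)
  set C₀ := ∑' p : ℕ × ℕ, (μ⁻¹) ^ p.1 * (μ⁻¹) ^ p.2 with hC₀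
  have hC₀0 : 0 ≤ C₀ := tsum_nonneg fun p => by positivity
  set η : ℝ := min (1 / 8) (ε / 8) with hη
  have hη0 : 0 < η := by positivity
  have hη1 : η ≤ 1 / 8 := min_le_left _ _
  have hη2 : η ≤ ε / 8 := min_le_right _ _
  set δ : ℝ := η / (C₀ + 1) with hδ
  obtain ⟨G, hG, hGA⟩ := unitApprox_bidisc (ρ₁ := s * ρ) (R₁ := lam * ρ) (ρ₂ := s * C')
    (R₂ := lam * C') (by positivity) (by gcongr) (by positivity) (by gcongr) (h.left.mono hsub)
    δ (by positivity)
  obtain ⟨c, hc1, hc2⟩ := exists_taylor_bidisc (R₁ := μ * ρ) (R := s * ρ) (ρ := μ * C')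
    (S := s * C') (by positivity) (by gcongr) (by positivity) (by gcongr)
    (f := fun p => Ring.inverse (G p) * A p - 1) (M := δ)
    (((hG.inv.1.mono (subset_univ _)).mul (h.left.mono hsub').1).sub (differentiableOn_const _))
    fun p hp => hGA p (Set.prod_mono ball_subset_closedBall ball_subset_closedBall hp)
  set w : ℕ × ℕ → ℝ := fun g => ρ ^ g.1 * C' ^ g.2 with hw
  have hwc : ∀ g, w g * ‖c g‖ ≤ δ * ((μ⁻¹) ^ g.1 * (μ⁻¹) ^ g.2) := by
    intro g
    calc w g * ‖c g‖ ≤ w g * (δ * (((μ * ρ) ^ g.1)⁻¹ * ((μ * C') ^ g.2)⁻¹)) := by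
          gcongr; exact hc1 g
      _ = δ * ((μ⁻¹) ^ g.1 * (μ⁻¹) ^ g.2) *
          ((ρ ^ g.1 * (ρ ^ g.1)⁻¹) * (C' ^ g.2 * (C' ^ g.2)⁻¹)) := by
          simp only [hw, mul_pow, mul_inv, inv_pow]; ring
      _ = _ := by
          rw [mul_inv_cancel₀ (by positivity), mul_inv_cancel₀ (by positivity)]; ring
  have hsum : Summable fun g => w g * ‖c g‖ :=
    Summable.of_nonneg_of_le (fun g => by positivity) hwc (hsum0.mul_left δ)
  have hle : ∑' g, w g * ‖c g‖ ≤ η := by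
    refine (hsum.tsum_le_tsum hwc (hsum0.mul_left δ)).trans ?_
    rw [tsum_mul_left, ← hC₀, hδ, div_mul_eq_mul_div, div_le_iff₀ (by positivity)]
    nlinarith
  obtain ⟨q, n, hq0, hn0, hqs, hns, hq1, hn1, hfac⟩ := exists_cartan_factorization (w := w)
    (fun g => by positivity) (fun g h => le_of_eq (by
      simp only [hw, Prod.fst_add, Prod.snd_add, pow_add]; ring))
    {g | k * g.2 < g.1} (by linarith : η ≤ 1 / 4) hsum hle
  set Q : ℂ × ℂ → 𝔸 := fun p => 1 + ∑' g : ℕ × ℕ, (p.1 ^ g.1 * p.2 ^ g.2) • q g with hQdef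
  set N : ℂ × ℂ → 𝔸 := fun p => 1 + ∑' g : ℕ × ℕ, (p.1 ^ g.1 * p.2 ^ g.2) • n g with hNdef
  set N' : ℂ × ℂ → 𝔸 :=
    fun p => 1 + ∑' g : ℕ × ℕ, (p.1 ^ (k * g.2 - g.1) * p.2 ^ g.2) • n g with hN'def
  set W : Set (ℂ × ℂ) := {p | ‖p.1‖ < ρ ∧ ‖p.1 ^ k * p.2‖ < D'} with hW
  have hWo : IsOpen W :=
    isOpen_setOf_norm_lt continuous_fst ((continuous_fst.pow k).mul continuous_snd) _ _
  have hQ : HolUnit Q W := by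
    refine (holUnit_one_add_tsum hWo (w := w) (ε := 2 * η) (by linarith) hqs hq1
      (χ := fun (g : ℕ × ℕ) (p : ℂ × ℂ) => p.1 ^ g.1 * p.2 ^ g.2) fun g hg => ?_).1
    have hg0 : k * g.2 < g.1 := by by_contra h; exact hg (hq0 g h)
    refine ⟨by fun_prop, fun p hp => ?_⟩
    rw [norm_mul, norm_pow, norm_pow]
    refine pow_mul_pow_le_of_mul_le (norm_nonneg _) (norm_nonneg _) hp.1.le ?_ hg0.le
    rw [hρk, ← norm_pow, ← norm_mul]
    exact hp.2.le
  have hN := holUnit_one_add_tsum (isOpen_tube k C' D') (w := w) (ε := 4 * η) (by linarith) hns hn1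
      (χ := fun (g : ℕ × ℕ) (p : ℂ × ℂ) => p.1 ^ g.1 * p.2 ^ g.2) fun g hg => by
    have hg0 : g.1 ≤ k * g.2 := by by_contra h; exact hg (hn0 g (not_le.1 h))
    refine ⟨by fun_prop, fun p hp => ?_⟩
    rw [norm_mul, norm_pow, norm_pow]
    refine pow_mul_pow_le_of_le_mul (norm_nonneg _) (norm_nonneg _) hρ hp.1.le ?_ hg0
    rw [hρk, ← norm_pow, ← norm_mul]
    exact hp.2.le
  have hN' := holUnit_one_add_tsum (isOpen_tube k D' C') (w := w) (ε := 4 * η) (by linarith) hns hn1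
      (χ := fun (g : ℕ × ℕ) (p : ℂ × ℂ) => p.1 ^ (k * g.2 - g.1) * p.2 ^ g.2) fun g hg => by
    have hg0 : g.1 ≤ k * g.2 := by by_contra h; exact hg (hn0 g (not_le.1 h))
    refine ⟨by fun_prop, fun p hp => ?_⟩
    rw [norm_mul, norm_pow, norm_pow]
    refine (pow_mul_pow_le_of_le_mul (norm_nonneg _) (norm_nonneg _) (inv_pos.2 hρ) hp.1.le
      (k := k) ?_ (Nat.sub_le _ _)).trans (le_of_eq ?_)
    · rw [← norm_pow, ← norm_mul, ← hρk, inv_pow, inv_mul_cancel_left₀ (by positivity)]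
      exact hp.2.le
    · obtain ⟨j, hj⟩ := Nat.exists_eq_add_of_le hg0
      have : k * g.2 - g.1 = j := by omega
      rw [this, ← hρk, mul_pow, ← pow_mul, hj, pow_add]
      simp only [hw, inv_pow]
      field_simp
  have hNN' : ∀ p : ℂ × ℂ, p.1 ≠ 0 → N' (coordChange k p) = N p := by
    intro p hp
    simp only [hN'def, hNdef, coordChange]
    congr 1
    refine tsum_congr fun g => ?_
    by_cases hg : k * g.2 < g.1
    · rw [hn0 g hg, smul_zero, smul_zero]
    · obtain ⟨j, hj⟩ := Nat.exists_eq_add_of_le (not_lt.1 hg)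
      have : k * g.2 - g.1 = j := by omega
      rw [this, mul_pow, ← pow_mul, hj, pow_add, inv_pow]
      congr 1
      field_simp
  have hkey : ∀ p ∈ tube k C' D', p ∈ W →
      A p * Ring.inverse (N p) = G p * Ring.inverse (Q p) := by
    intro p hp hpW
    have hF := (hc2 p (hpW.1.trans (by nlinarith)) (hp.1.trans (by nlinarith))).tsum_eq
    have e := hfac (fun g => p.1 ^ g.1 * p.2 ^ g.2) (fun g => by
      have := hp.1.le
      have := hpW.1.le
      rw [norm_mul, norm_pow, norm_pow]
      simp only [hw]
      gcongr) fun g h => by simp only [Prod.fst_add, Prod.snd_add, pow_add]; ring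
    rw [hF, add_sub_cancel] at e
    have e' : Q p * (Ring.inverse (G p) * A p) = N p := e
    have hAu := h.left.2 p (tube_mono hC'.le hD'.le hp)
    have hGu := hG.2 p trivial
    rw [← e', Ring.inverse_mul (Or.inl (hQ.2 p hpW)), Ring.inverse_mul (Or.inl hGu.ringInverse)]
    obtain ⟨v, hv⟩ := hGu
    rw [← mul_assoc, ← mul_assoc, Ring.mul_inverse_cancel _ hAu, one_mul, ← hv, Ring.inverse_unit,
      Ring.inverse_unit, inv_inv]
  obtain ⟨A', hA', hA'1, hA'2⟩ := ((h.left.mono (tube_mono hC'.le hD'.le)).mul hN.1.inv).glue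
    (isOpen_tube k C' D') hWo ((hG.mono (subset_univ _)).mul hQ.inv) hkey
  have hB' := (h.right.mono (tube_mono hD'.le hC'.le)).mul hN'.1.inv
  obtain ⟨A₁, B₁, hf, hA₁, hB₁⟩ := Frame.of_pieces (k := k) (C := C'') (D := D') hT
    ((isOpen_tube k C' D').union hWo) (isOpen_tube k D' C') hA' hB'
    (by
      intro p _ hp0 hpV
      have hp : p ∈ tube k C' D' := by
        have := coordChange_mem_tube (coordChange_fst_ne_zero k hp0) hpV
        rwa [coordChange_coordChange k hp0] at this
      rw [hA'1 p hp]
      change A p * Ring.inverse (N p) =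
        T p * (B (coordChange k p) * Ring.inverse (N' (coordChange k p)))
      rw [hNN' p hp0, h.eq p hp0 (tube_mono hC'.le hD'.le hp), mul_assoc])
    (by
      intro p hp hpU
      exfalso
      rw [mem_union, not_or] at hpU
      have h1 : ρ ≤ ‖p.1‖ := by
        by_contra h1
        exact hpU.2 ⟨not_le.1 h1, hp.2⟩
      refine hpU.1 ⟨?_, hp.2⟩
      have h2 := hp.2
      rw [norm_mul, norm_pow, ← hρk] at h2
      refine lt_of_mul_lt_mul_left (a := ρ ^ k) (lt_of_le_of_lt ?_ h2) (by positivity)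
      gcongr)
    (by
      intro p hp hpV
      have h1 : C' ≤ ‖p.1‖ ^ k * ‖p.2‖ := by
        by_contra h1
        exact hpV ⟨hp.1, by rw [norm_mul, norm_pow]; exact not_le.1 h1⟩
      have h2 : ρ⁻¹ < ‖p.1‖ := by
        by_contra h2
        rw [not_lt] at h2
        have h3 : ‖p.1‖ ^ k * ‖p.2‖ ≤ (ρ⁻¹) ^ k * ‖p.2‖ := by gcongr
        have h4 : (ρ⁻¹) ^ k * ‖p.2‖ < (ρ⁻¹) ^ k * D' := by
          have := hp.1
          gcongr
        have h5 : (ρ⁻¹) ^ k * D' = C' := by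
          rw [← hρk, inv_pow, inv_mul_cancel_left₀ (by positivity)]
        linarith
      have h0 : p.1 ≠ 0 := norm_pos_iff.1 ((inv_pos.2 hρ).trans h2)
      refine ⟨h0, Or.inr ⟨?_, ?_⟩⟩
      · simp only [coordChange, norm_inv]
        rwa [inv_lt_comm₀ (norm_pos_iff.2 h0) hρ]
      · have : (coordChange k p).1 ^ k * (coordChange k p).2 = p.2 :=
          congrArg Prod.snd (coordChange_coordChange k h0)
        rw [this]
        exact hp.1)
  refine ⟨A₁, B₁, hf, fun p hp => ?_, fun q hq => ?_⟩
  · rw [hA₁ p (Or.inl hp), hA'1 p hp,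
      Ring.inverse_mul_cancel_left _ _ (h.left.2 p (tube_mono hC'.le hD'.le hp))]
    exact (norm_inverse_one_add_sub_one_le (hN.2 p hp) (by linarith)).trans (by linarith)
  · rw [hB₁ q hq,
      Ring.inverse_mul_cancel_left _ _ (h.right.2 q (tube_mono hD'.le hC'.le hq))]
    exact (norm_inverse_one_add_sub_one_le (hN'.2 q hq) (by linarith)).trans (by linarith)

theorem Frame.exists_bump_right {k : ℕ} (hk : 1 ≤ k) {T A B : ℂ × ℂ → 𝔸} (hT : HolUnit T overlap)
    {C D C' D' : ℝ} (h : Frame k T A B C D) (hC'0 : 0 < C') (hC' : C' < C) (hD'0 : 0 < D')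
    (hD' : D' < D) {ε : ℝ} (hε : 0 < ε) (D'' : ℝ) :
    ∃ A₁ B₁, Frame k T A₁ B₁ C' D'' ∧ GaugeClose k A B A₁ B₁ C' D' ε := by
  obtain ⟨B₁, A₁, h1, h2⟩ := (h.swap hT).exists_bump_left hk (hT.swapT k) hD'0 hD' hC'0 hC' hε D''
  have h3 := h1.swap (hT.swapT k)
  exact ⟨A₁, B₁, ⟨h3.left, h3.right, fun p hp hpt => by
    rw [h3.eq p hp hpt, swapT_swapT k hT hp]⟩, h2.right, h2.left⟩

theorem Frame.exists_extension {k : ℕ} (hk : 1 ≤ k) {T A B : ℂ × ℂ → 𝔸} (hT : HolUnit T overlap)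
    {C D C₀ D₀ : ℝ} (h : Frame k T A B C D) (hC₀0 : 0 < C₀) (hC₀ : C₀ < C) (hD₀0 : 0 < D₀)
    (hD₀ : D₀ < D) {ε : ℝ} (hε : 0 < ε) (C₁ D₁ : ℝ) :
    ∃ A₁ B₁, Frame k T A₁ B₁ C₁ D₁ ∧ GaugeClose k A B A₁ B₁ C₀ D₀ ε := by
  obtain ⟨D', hD', hD'D⟩ := exists_between hD₀
  set η : ℝ := min (ε / 3) 1 with hη
  have hη0 : 0 < η := by positivity
  have hη1 : η ≤ 1 := min_le_right _ _
  have hη2 : η ≤ ε / 3 := min_le_left _ _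
  set C' : ℝ := max C₀ C₁ with hC'
  have hC₀' : C₀ ≤ C' := le_max_left _ _
  obtain ⟨A₁, B₁, hf₁, hc₁⟩ := h.exists_bump_left hk hT hC₀0 hC₀ (hD₀0.trans hD') hD'D hη0
    (C' + 1)
  obtain ⟨A₂, B₂, hf₂, hc₂⟩ := hf₁.exists_bump_right hk hT (hC₀0.trans_le hC₀')
    (lt_add_one C') hD₀0 hD' hη0 D₁
  refine ⟨A₂, B₂, hf₂.mono (le_max_right _ _) le_rfl, fun p hp => ?_, fun q hq => ?_⟩
  · refine (norm_inverse_mul_sub_one_le (hf₁.left.2 p (tube_mono (by linarith) hD'.le hp))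
      (hc₁.left p (tube_mono le_rfl hD'.le hp)) (hc₂.left p (tube_mono hC₀' le_rfl hp))).trans ?_
    nlinarith
  · refine (norm_inverse_mul_sub_one_le (hf₁.right.2 q (tube_mono hD'.le (by linarith) hq))
      (hc₁.right q (tube_mono hD'.le le_rfl hq)) (hc₂.right q (tube_mono le_rfl hC₀' hq))).trans ?_
    nlinarith

/-- A bundle on `Z_k` which is trivialized on the zero section is holomorphically trivial. -/
theorem exists_global_frame {k : ℕ} (hk : 1 ≤ k) {T : ℂ × ℂ → 𝔸} (hT : HolUnit T overlap)
    (hT1 : ∀ z : ℂ, z ≠ 0 → T (z, 0) = 1) :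
    ∃ A B : ℂ × ℂ → 𝔸, HolUnit A univ ∧ HolUnit B univ ∧
      ∀ p, p.1 ≠ 0 → A p = T p * B (coordChange k p) := by
  obtain ⟨r, hr, hr'⟩ := exists_initial_frame (k := k) hT hT1
  obtain ⟨A₀, B₀, h₀⟩ := hr' 1
  obtain ⟨A₁, B₁, h₁, -⟩ := h₀.exists_extension hk hT (C₀ := r / 2) (D₀ := 1 / 2) (by positivity)
    (by linarith) (by norm_num) (by norm_num) one_pos 2 2
  have hstep : ∀ (n : ℕ) (P : (ℂ × ℂ → 𝔸) × (ℂ × ℂ → 𝔸)),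
      Frame k T P.1 P.2 (n + 2) (n + 2) → ∃ P' : (ℂ × ℂ → 𝔸) × (ℂ × ℂ → 𝔸),
        Frame k T P'.1 P'.2 ((n + 1 : ℕ) + 2) ((n + 1 : ℕ) + 2) ∧
          GaugeClose k P.1 P.2 P'.1 P'.2 (n + 1) (n + 1) (1 / 8 * (1 / 2) ^ n) := by
    intro n P hP
    obtain ⟨A', B', h1, h2⟩ := hP.exists_extension hk hT (C₀ := n + 1) (D₀ := n + 1)
      (by positivity) (by linarith) (by positivity) (by linarith)
      (ε := 1 / 8 * (1 / 2) ^ n) (by positivity) ((n + 1 : ℕ) + 2) ((n + 1 : ℕ) + 2)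
    exact ⟨(A', B'), h1, h2⟩
  choose! next hnext1 hnext2 using hstep
  set seq : ℕ → (ℂ × ℂ → 𝔸) × (ℂ × ℂ → 𝔸) := fun n => Nat.rec (A₁, B₁) next n with hseq
  have hframe : ∀ n : ℕ, Frame k T (seq n).1 (seq n).2 (n + 2) (n + 2) := by
    intro n
    induction n with
    | zero => exact h₁.mono (by norm_num) (by norm_num)
    | succ n ih => exact hnext1 n _ ih
  have hclose : ∀ n : ℕ, GaugeClose k (seq n).1 (seq n).2 (seq (n + 1)).1 (seq (n + 1)).2
      (n + 1) (n + 1) (1 / 8 * (1 / 2) ^ n) := fun n => hnext2 n _ (hframe n)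
  have hmono : Monotone fun n : ℕ => tube k ((n : ℝ) + 1) ((n : ℝ) + 1) := by
    intro m n hmn
    have : (m : ℝ) ≤ n := by exact_mod_cast hmn
    exact tube_mono (by linarith) (by linarith)
  have hcover : ∀ p : ℂ × ℂ, ∃ n : ℕ, p ∈ tube k ((n : ℝ) + 1) ((n : ℝ) + 1) := by
    intro p
    obtain ⟨n, hn⟩ := exists_nat_gt (max ‖p.2‖ ‖p.1 ^ k * p.2‖)
    exact ⟨n, by linarith [le_max_left ‖p.2‖ ‖p.1 ^ k * p.2‖],
      by linarith [le_max_right ‖p.2‖ ‖p.1 ^ k * p.2‖]⟩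
  obtain ⟨A, hA, hAlim⟩ := exists_limit_of_quotient_close (fun n => isOpen_tube k _ _) hmono hcover
    (fun n => (hframe n).left.mono (tube_mono (by linarith) (by linarith)))
    fun n => (hclose n).left
  obtain ⟨B, hB, hBlim⟩ := exists_limit_of_quotient_close (fun n => isOpen_tube k _ _) hmono hcover
    (fun n => (hframe n).right.mono (tube_mono (by linarith) (by linarith)))
    fun n => (hclose n).right
  refine ⟨A, B, hA, hB, fun p hp => ?_⟩
  refine tendsto_nhds_unique (hAlim p) ?_
  refine ((hBlim (coordChange k p)).const_mul (T p)).congr' ?_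
  obtain ⟨N, hN⟩ := hcover p
  filter_upwards [eventually_ge_atTop N] with n hn
  refine ((hframe n).eq p hp ?_).symm
  exact tube_mono (by linarith) (by linarith) (hmono hn hN)

end Bumps

section MatrixFamilies

open Set Metric Filter Topology

attribute [local instance] Matrix.linftyOpNormedRing Matrix.linftyOpNormedAlgebra

variable {n : Type*} [Fintype n] [DecidableEq n]
variable {X : Type*} [NormedAddCommGroup X] [NormedSpace ℂ X]

theorem differentiableOn_matrix_iff {A : X → Matrix n n ℂ} {s : Set X} :
    DifferentiableOn ℂ A s ↔ ∀ i j, DifferentiableOn ℂ (fun p => A p i j) s := by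
  constructor
  · intro h i j
    have := (LinearMap.toContinuousLinearMap
      (Matrix.entryLinearMap ℂ ℂ i j : Matrix n n ℂ →ₗ[ℂ] ℂ)).differentiable.comp_differentiableOn h
    exact this
  · intro h
    have : A = fun p => ∑ i, ∑ j, A p i j • Matrix.single i j (1 : ℂ) := by
      funext p
      conv_lhs => rw [Matrix.matrix_eq_sum_single (A p)]
      simp [Matrix.smul_single]
    rw [this]
    exact DifferentiableOn.fun_sum fun i _ => DifferentiableOn.fun_sum fun j _ =>
      (h i j).smul_const _

omit [NormedSpace ℂ X] in
theorem continuousOn_det {A : X → Matrix n n ℂ} {s : Set X} (hA : ContinuousOn A s) :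
    ContinuousOn (fun p => (A p).det) s :=
  (Continuous.matrix_det continuous_id).comp_continuousOn hA

theorem continuousOn_eqOn_of_eqOn_punctured {f g : ℂ → ℂ} {s : Set ℂ} (hs : IsOpen s) {c : ℂ}
    (hf : ContinuousOn f s) (hg : ContinuousOn g s) (h : ∀ z ∈ s, z ≠ c → f z = g z) :
    ∀ z ∈ s, f z = g z := by
  intro z hz
  rcases eq_or_ne z c with rfl | hzc
  · have h1 := (hf.continuousAt (hs.mem_nhds hz)).tendsto.mono_left (nhdsWithin_le_nhds (s := {z}ᶜ))
    have h2 := (hg.continuousAt (hs.mem_nhds hz)).tendsto.mono_left (nhdsWithin_le_nhds (s := {z}ᶜ))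
    refine tendsto_nhds_unique h1 (h2.congr' ?_)
    filter_upwards [self_mem_nhdsWithin, nhdsWithin_le_nhds (hs.mem_nhds hz)] with y hy hys
    exact (h y hys hy).symm
  · exact h z hz hzc

/-- The identity matrix with the `i`-th diagonal entry replaced by `x`. -/
def dilation {R : Type*} [CommRing R] (i : n) (x : R) : Matrix n n R :=
  Matrix.diagonal (Function.update 1 i x)

theorem det_dilation {R : Type*} [CommRing R] (i : n) (x : R) : (dilation i x).det = x := by
  rw [dilation, Matrix.det_diagonal, Finset.prod_update_of_mem (Finset.mem_univ i)]
  simp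

theorem dilation_mul {R : Type*} [CommRing R] (i : n) (x y : R) :
    dilation i x * dilation i y = dilation i (x * y) := by
  rw [dilation, dilation, dilation, Matrix.diagonal_mul_diagonal]
  congr 1
  funext j
  by_cases h : j = i
  · subst h; simp
  · simp [h]

theorem differentiableOn_dilation {i : n} {f : X → ℂ} {s : Set X} (hf : DifferentiableOn ℂ f s) :
    DifferentiableOn ℂ (fun z => dilation i (f z)) s := by
  rw [differentiableOn_matrix_iff]
  intro a b
  by_cases hab : a = b
  · subst hab
    by_cases ha : a = i
    · subst ha; simpa [dilation] using hf
    · simp [dilation, ha]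
  · simp [dilation, hab]

/-- If a holomorphic family of matrices degenerates at `c`, then a factor `z - c` can be split off
one column. -/
theorem exists_split_column {Q : ℂ → Matrix n n ℂ} {s : Set ℂ} (hs : IsOpen s) {c : ℂ} (hc : c ∈ s)
    (hQ : DifferentiableOn ℂ Q s) (hdet : (Q c).det = 0) :
    ∃ (h : Matrix n n ℂ) (i : n) (Q' : ℂ → Matrix n n ℂ), IsUnit h ∧ DifferentiableOn ℂ Q' s ∧
      ∀ z, Q z * h = Q' z * dilation i (z - c) := by
  obtain ⟨v, hv, hQv⟩ := Matrix.exists_mulVec_eq_zero_iff.2 hdet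
  obtain ⟨i, hi⟩ := Function.ne_iff.1 hv
  set h : Matrix n n ℂ := Matrix.updateCol 1 i v with hh
  have hdeth : h.det = v i := by
    rw [hh, ← Matrix.cramer_apply, Matrix.cramer_one]; rfl
  have hcol : ∀ z a, (Q z * h) a i = (Q z *ᵥ v) a := by
    intro z a
    simp [Matrix.mul_apply, Matrix.mulVec, dotProduct, hh]
  have hQent := differentiableOn_matrix_iff.1 hQ
  refine ⟨h, i, fun z => Matrix.of fun a b => if b = i then dslope (fun z => (Q z *ᵥ v) a) c z
    else (Q z * h) a b, ?_, ?_, ?_⟩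
  · rw [Matrix.isUnit_iff_isUnit_det, hdeth]
    exact isUnit_iff_ne_zero.2 hi
  · rw [differentiableOn_matrix_iff]
    intro a b
    by_cases hb : b = i
    · simp only [Matrix.of_apply, hb, if_true]
      rw [Complex.differentiableOn_dslope (hs.mem_nhds hc)]
      simp only [Matrix.mulVec, dotProduct]
      exact DifferentiableOn.fun_sum fun j _ => (hQent a j).mul_const _
    · simp only [Matrix.of_apply, hb, if_false, Matrix.mul_apply]
      exact DifferentiableOn.fun_sum fun j _ => (hQent a j).mul_const _
  · intro z
    ext a b
    rw [dilation, Matrix.mul_diagonal]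
    by_cases hb : b = i
    · subst hb
      simp only [Matrix.of_apply, if_true, Function.update_self]
      rw [hcol, mul_comm, ← smul_eq_mul, sub_smul_dslope, hQv]
      simp
    · simp [hb]

/-- Split off a factor `z - c` from one column, keeping track of the determinant. -/
theorem exists_split_column_det {Q : ℂ → Matrix n n ℂ} {s : Set ℂ} (hs : IsOpen s) {c : ℂ}
    (hc : c ∈ s) (hQ : DifferentiableOn ℂ Q s) {φ : ℂ → ℂ} (hφ : ContinuousOn φ s)
    (hdet : ∀ z ∈ s, (Q z).det = (z - c) * φ z) :
    ∃ (h : Matrix n n ℂ) (i : n) (Q' : ℂ → Matrix n n ℂ), IsUnit h ∧ DifferentiableOn ℂ Q' s ∧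
      (∀ z, Q z * h = Q' z * dilation i (z - c)) ∧ ∀ z ∈ s, (Q' z).det = φ z * h.det := by
  obtain ⟨h, i, Q', h1, h2, h3⟩ := exists_split_column hs hc hQ (by simp [hdet c hc])
  refine ⟨h, i, Q', h1, h2, h3, continuousOn_eqOn_of_eqOn_punctured hs (c := c)
    (continuousOn_det h2.continuousOn) (hφ.mul continuousOn_const) fun z hz hzc => ?_⟩
  have h4 := congrArg Matrix.det (h3 z)
  rw [Matrix.det_mul, Matrix.det_mul, det_dilation, hdet z hz] at h4
  refine mul_left_cancel₀ (sub_ne_zero.2 hzc) ?_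
  rw [mul_comm (z - c) (Q' z).det, ← h4]
  ring

/-- Move the zeros of the determinant of a holomorphic family of matrices on a disc to the origin
by changing the gauge at infinity. -/
theorem exists_gauge_moving_zeros {T₀ : ℂ → Matrix n n ℂ} {f : ℂ → ℂ} (s : Multiset ℂ) :
    ∀ (m : ℕ) (Q b : ℂ → Matrix n n ℂ) (u : ℂ → ℂ), DifferentiableOn ℂ Q (ball 0 2) →
      HolUnit b (ball 0 2) → ContinuousOn u (ball 0 2) → (∀ z ∈ ball (0 : ℂ) 2, u z ≠ 0) →
      (∀ z ∈ ball (0 : ℂ) 2, (Q z).det = z ^ m * (s.map fun c => z - c).prod * u z) →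
      (∀ c ∈ s, ‖c‖ ≤ 2⁻¹) →
      (∀ z : ℂ, 2⁻¹ < ‖z‖ → ‖z‖ < 2 → T₀ z * b z⁻¹ = f z • Q z) →
      ∃ (m' : ℕ) (Q' b' : ℂ → Matrix n n ℂ) (u' : ℂ → ℂ), DifferentiableOn ℂ Q' (ball 0 2) ∧
        HolUnit b' (ball 0 2) ∧ ContinuousOn u' (ball 0 2) ∧ (∀ z ∈ ball (0 : ℂ) 2, u' z ≠ 0) ∧
        (∀ z ∈ ball (0 : ℂ) 2, (Q' z).det = z ^ m' * u' z) ∧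
        ∀ z : ℂ, 2⁻¹ < ‖z‖ → ‖z‖ < 2 → T₀ z * b' z⁻¹ = f z • Q' z := by
  induction s using Multiset.induction_on with
  | empty =>
    intro m Q b u hQ hb hu hu0 hdet _ hT
    exact ⟨m, Q, b, u, hQ, hb, hu, hu0, fun z hz => by simpa using hdet z hz, hT⟩
  | cons c s ih =>
    intro m Q b u hQ hb hu hu0 hdet hroots hT
    have hc : ‖c‖ ≤ 2⁻¹ := hroots c (Multiset.mem_cons_self c s)
    have hcball : c ∈ ball (0 : ℂ) 2 := by
      rw [mem_ball_zero_iff]; exact hc.trans_lt (by norm_num)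
    have hprod : Continuous fun z : ℂ => (s.map fun c => z - c).prod :=
      continuous_multiset_prod s fun i _ => by fun_prop
    obtain ⟨h, i, Q', hh, hQ', hQQ', hdet'⟩ := exists_split_column_det isOpen_ball hcball hQ
      (φ := fun z => z ^ m * (s.map fun c => z - c).prod * u z)
      (((continuous_pow m).mul hprod).continuousOn.mul hu) fun z hz => by
        rw [hdet z hz, Multiset.map_cons, Multiset.prod_cons]; ring
    have hne : ∀ ξ : ℂ, ‖ξ‖ < 2 → 1 - c * ξ ≠ 0 := by
      intro ξ hξ h0
      have h1 : ‖c * ξ‖ = 1 := by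
        rw [← sub_eq_zero.1 h0, norm_one]
      rw [norm_mul] at h1
      nlinarith [norm_nonneg c, norm_nonneg ξ]
    have hdeth : h.det ≠ 0 := ((Matrix.isUnit_iff_isUnit_det h).1 hh).ne_zero
    refine ih (m + 1) (fun z => Q' z * dilation i z)
      (fun ξ => b ξ * (h * dilation i (1 - c * ξ)⁻¹)) (fun z => u z * h.det)
      (hQ'.mul (differentiableOn_dilation differentiableOn_id))
      (hb.mul ⟨(differentiableOn_const h).mul (differentiableOn_dilation
        (DifferentiableOn.inv (by fun_prop) fun ξ hξ => hne ξ (by simpa using hξ))),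
          fun ξ hξ => hh.mul ?_⟩)
      (hu.mul continuousOn_const) (fun z hz => mul_ne_zero (hu0 z hz) hdeth) (fun z hz => ?_)
      (fun c' hc' => hroots c' (Multiset.mem_cons_of_mem hc')) fun z hz1 hz2 => ?_
    · rw [Matrix.isUnit_iff_isUnit_det, det_dilation]
      exact isUnit_iff_ne_zero.2 (inv_ne_zero (hne ξ (by simpa using hξ)))
    · rw [Matrix.det_mul, det_dilation, hdet' z hz]
      ring
    · have hz0 : z ≠ 0 := by rintro rfl; norm_num at hz1
      have hzc : z - c ≠ 0 := by
        intro h0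
        rw [sub_eq_zero.1 h0] at hz1
        linarith
      have hz : z * (1 - c * z⁻¹) = z - c := by field_simp
      have e : (z - c) * (1 - c * z⁻¹)⁻¹ = z := by
        rw [← hz, mul_assoc, mul_inv_cancel₀, mul_one]
        intro h0
        rw [h0, mul_zero] at hz
        exact hzc hz.symm
      rw [← mul_assoc, hT z hz1 hz2, smul_mul_assoc, ← mul_assoc, hQQ' z,
        mul_assoc, dilation_mul, e]

/-- A holomorphic family of matrices degenerating only at the origin of a disc is the product of a
polynomial matrix and an invertible holomorphic family. -/
theorem exists_polynomial_mul_holUnit (m : ℕ) : ∀ (Q : ℂ → Matrix n n ℂ) (u : ℂ → ℂ),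
    DifferentiableOn ℂ Q (ball 0 2) → ContinuousOn u (ball 0 2) →
    (∀ z ∈ ball (0 : ℂ) 2, u z ≠ 0) → (∀ z ∈ ball (0 : ℂ) 2, (Q z).det = z ^ m * u z) →
    ∃ (M : ℕ) (L L' : Matrix n n (Polynomial ℂ)) (g : ℂ → Matrix n n ℂ),
      L * L' = (Polynomial.X ^ M : Polynomial ℂ) • 1 ∧ HolUnit g (ball 0 2) ∧
      ∀ z ∈ ball (0 : ℂ) 2, Q z = L.map (Polynomial.eval z) * g z := by
  induction m with
  | zero =>
    intro Q u hQ hu hu0 hdet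
    refine ⟨0, 1, 1, Q, by simp, ⟨hQ, fun z hz => ?_⟩, fun z hz => ?_⟩
    · rw [Matrix.isUnit_iff_isUnit_det, hdet z hz]
      simpa using hu0 z hz
    · rw [Matrix.map_one _ Polynomial.eval_zero Polynomial.eval_one, one_mul]
  | succ m ih =>
    intro Q u hQ hu hu0 hdet
    have h0 : (0 : ℂ) ∈ ball (0 : ℂ) 2 := mem_ball_self two_pos
    obtain ⟨h, i, Q', hh, hQ', hQQ', hdet'⟩ := exists_split_column_det (Q := fun z => (Q z)ᵀ)
      isOpen_ball h0
      (differentiableOn_matrix_iff.2 fun a b => differentiableOn_matrix_iff.1 hQ b a)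
      (φ := fun z => z ^ m * u z) ((continuous_pow m).continuousOn.mul hu) fun z hz => by
        rw [Matrix.det_transpose, hdet z hz]; ring
    have hdeth : h.det ≠ 0 := ((Matrix.isUnit_iff_isUnit_det h).1 hh).ne_zero
    obtain ⟨M, L, L', g, hL, hg, hQL⟩ := ih (fun z => (Q' z)ᵀ) (fun z => u z * h.det)
      (differentiableOn_matrix_iff.2 fun a b => differentiableOn_matrix_iff.1 hQ' b a)
      (hu.mul continuousOn_const) (fun z hz => mul_ne_zero (hu0 z hz) hdeth) fun z hz => by
        rw [Matrix.det_transpose, hdet' z hz]; ring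
    obtain ⟨v, hv⟩ := (Matrix.isUnit_transpose h).2 hh
    set W : Matrix n n ℂ := ((v⁻¹ : (Matrix n n ℂ)ˣ) : Matrix n n ℂ) with hW
    have hWh : W * hᵀ = 1 := by rw [hW, ← hv]; simp
    have hDD : ∃ D' : Matrix n n (Polynomial ℂ), dilation i (Polynomial.X : Polynomial ℂ) * D' =
        (Polynomial.X : Polynomial ℂ) • 1 := by
      refine ⟨Matrix.diagonal (Function.update (fun _ => Polynomial.X) i 1), ?_⟩
      rw [dilation, Matrix.diagonal_mul_diagonal, Matrix.smul_one_eq_diagonal]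
      congr 1
      funext j
      by_cases hj : j = i
      · subst hj; simp
      · simp [hj]
    obtain ⟨D', hD'⟩ := hDD
    refine ⟨M + 1, W.map Polynomial.C * (dilation i Polynomial.X * L),
      L' * (D' * hᵀ.map Polynomial.C), g, ?_, hg, fun z hz => ?_⟩
    · have e1 : W.map Polynomial.C * hᵀ.map Polynomial.C = 1 := by
        rw [← Matrix.map_mul, hWh, Matrix.map_one _ Polynomial.C_0 Polynomial.C_1]
      calc _ = W.map Polynomial.C * (dilation i Polynomial.X * (L * L') * D') *
            hᵀ.map Polynomial.C := by simp only [mul_assoc]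
        _ = (Polynomial.X ^ M : Polynomial ℂ) • (W.map Polynomial.C *
            (dilation i Polynomial.X * D') * hᵀ.map Polynomial.C) := by
            rw [hL]; simp
        _ = _ := by
            rw [hD']
            simp only [mul_smul_comm, mul_one, smul_mul_assoc, e1, smul_smul, pow_succ]
    · have e2 : (W.map Polynomial.C).map (Polynomial.eval z) = W := by
        ext a b; simp
      have e3 : (dilation i (Polynomial.X : Polynomial ℂ)).map (Polynomial.eval z) =
          dilation i z := by
        ext a b
        by_cases hab : a = b
        · subst hab
          by_cases ha : a = i
          · subst ha; simp [dilation]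
          · simp [dilation, ha]
        · simp [dilation, hab]
      have e4 : ∀ A B : Matrix n n (Polynomial ℂ), (A * B).map (Polynomial.eval z) =
          A.map (Polynomial.eval z) * B.map (Polynomial.eval z) := fun A B =>
        Matrix.map_mul (f := Polynomial.evalRingHom z)
      have e5 := congrArg Matrix.transpose (hQQ' z)
      rw [Matrix.transpose_mul, Matrix.transpose_mul, Matrix.transpose_transpose, hQL z hz,
        dilation, Matrix.diagonal_transpose, ← dilation, sub_zero] at e5
      rw [e4, e4, e2, e3, mul_assoc, mul_assoc, ← e5, ← mul_assoc, hWh, one_mul]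

end MatrixFamilies

section LaurentApproximation

open Set Metric Filter Topology

variable {𝔸 : Type*} [NormedRing 𝔸] [NormedAlgebra ℂ 𝔸] [CompleteSpace 𝔸]

theorem norm_zpow_le_pow_natAbs {R : ℝ} (hR : 0 < R) {z : ℂ} (h1 : R⁻¹ ≤ ‖z‖) (h2 : ‖z‖ ≤ R)
    (m : ℤ) : ‖z ^ m‖ ≤ R ^ m.natAbs := by
  rw [norm_zpow]
  have hz : 0 < ‖z‖ := (inv_pos.2 hR).trans_le h1
  rcases Int.natAbs_eq m with h | h
  · rw [h, zpow_natCast, Int.natAbs_natCast]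
    gcongr
  · rw [h, _root_.zpow_neg, zpow_natCast, Int.natAbs_neg, Int.natAbs_natCast, ← inv_pow]
    gcongr
    exact inv_le_of_inv_le₀ hR h1

/-- A holomorphic family of units on `ℂ*` is approximated on an annulus by Laurent polynomials. -/
theorem exists_laurent_polynomial_approx {T₀ : ℂ → 𝔸} (hT : HolUnit T₀ {z | z ≠ 0}) {δ : ℝ}
    (hδ : 0 < δ) : ∃ (N : ℕ) (t : Finset ℕ) (c : ℕ → 𝔸), ∀ z : ℂ, (4 : ℝ)⁻¹ < ‖z‖ → ‖z‖ < 4 →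
      ‖Ring.inverse (T₀ z) * ((z ^ N)⁻¹ • ∑ i ∈ t, z ^ i • c i) - 1‖ ≤ δ := by
  have hbd : ∀ F : ℂ → 𝔸, ContinuousOn F {z | z ≠ 0} →
      ∃ M, ∀ z : ℂ, (6 : ℝ)⁻¹ < ‖z‖ → ‖z‖ < 6 → ‖F z‖ ≤ M := by
    intro F hF
    have hK : IsCompact (closedBall (0 : ℂ) 6 ∩ {z : ℂ | (6 : ℝ)⁻¹ ≤ ‖z‖}) :=
      (isCompact_closedBall _ _).inter_right (isClosed_le continuous_const continuous_norm)
    obtain ⟨M, hM⟩ := hK.exists_bound_of_continuousOn (f := F)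
      (hF.mono fun z hz => norm_pos_iff.1 (lt_of_lt_of_le (by norm_num) hz.2))
    exact ⟨M, fun z h1 h2 => hM z ⟨by rw [mem_closedBall_zero_iff]; exact h2.le, h1.le⟩⟩
  obtain ⟨M, hM⟩ := hbd T₀ hT.1.continuousOn
  obtain ⟨M', hM'⟩ := hbd _ hT.inv.1.continuousOn
  obtain ⟨c, hc1, hc2⟩ := exists_laurent (R₁ := 5) (R := 6) (by norm_num) (by norm_num) (f := T₀)
    (hT.1.mono fun z hz => norm_pos_iff.1 (lt_trans (by norm_num) hz.1)) hM
  set s : Set ℂ := {z | (4 : ℝ)⁻¹ < ‖z‖ ∧ ‖z‖ < 4} with hs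
  have hunif := tendstoUniformlyOn_tsum (f := fun (m : ℤ) (z : ℂ) => z ^ m • c m)
    (u := fun m : ℤ => M * (4 / 5 : ℝ) ^ m.natAbs) (s := s)
    ((summable_pow_natAbs (by norm_num) (by norm_num)).mul_left M) fun m z hz => by
      rw [norm_smul]
      calc ‖z ^ m‖ * ‖c m‖ ≤ 4 ^ m.natAbs * (M * (5 ^ m.natAbs)⁻¹) := by
            gcongr
            · exact norm_zpow_le_pow_natAbs (by norm_num) hz.1.le hz.2.le m
            · exact hc1 m
        _ = M * (4 / 5 : ℝ) ^ m.natAbs := by rw [div_pow]; ring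
  have hM0 : 0 < |M'| + 1 := by positivity
  rw [Metric.tendstoUniformlyOn_iff] at hunif
  obtain ⟨t, ht⟩ := (hunif (δ / (|M'| + 1)) (by positivity)).exists
  set N : ℕ := t.sup Int.natAbs with hN
  have hNt : ∀ m ∈ t, ((m + N).toNat : ℤ) = m + N := by
    intro m hm
    have : m.natAbs ≤ N := Finset.le_sup (f := Int.natAbs) hm
    omega
  refine ⟨N, t.image fun m : ℤ => (m + N).toNat, fun i => c (i - N), fun z h1 h2 => ?_⟩
  have hz : z ≠ 0 := norm_pos_iff.1 (lt_trans (by norm_num) h1)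
  have hsum : (z ^ N)⁻¹ • ∑ i ∈ t.image (fun m : ℤ => (m + N).toNat), z ^ i • c (i - N)
      = ∑ m ∈ t, z ^ m • c m := by
    rw [Finset.sum_image, Finset.smul_sum]
    · refine Finset.sum_congr rfl fun m hm => ?_
      rw [hNt m hm, add_sub_cancel_right, smul_smul]
      congr 1
      rw [← zpow_natCast z (m + N).toNat, hNt m hm, zpow_add₀ hz, zpow_natCast]
      field_simp
    · intro m hm m' hm' h
      have h' : (m + N).toNat = (m' + N).toNat := h
      have h1 := hNt m hm
      have h2 := hNt m' hm'
      rw [h'] at h1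
      linarith
  rw [hsum]
  have hd := (ht z ⟨h1, h2⟩).le
  rw [(hc2 z (lt_trans (by norm_num) h1) (h2.trans (by norm_num))).tsum_eq, dist_comm,
    dist_eq_norm] at hd
  have hi : ‖Ring.inverse (T₀ z)‖ ≤ |M'| + 1 :=
    (hM' z (lt_trans (by norm_num) h1) (h2.trans (by norm_num))).trans
      ((le_abs_self _).trans (by linarith))
  have e : Ring.inverse (T₀ z) * (∑ m ∈ t, z ^ m • c m) - 1
      = Ring.inverse (T₀ z) * ((∑ m ∈ t, z ^ m • c m) - T₀ z) := by
    rw [mul_sub, Ring.inverse_mul_cancel _ (hT.2 z hz)]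
  rw [e]
  calc _ ≤ ‖Ring.inverse (T₀ z)‖ * ‖(∑ m ∈ t, z ^ m • c m) - T₀ z‖ := norm_mul_le _ _
    _ ≤ (|M'| + 1) * (δ / (|M'| + 1)) := by gcongr
    _ = δ := by field_simp

end LaurentApproximation

section Grothendieck

open Set Metric Filter Topology

attribute [local instance] Matrix.linftyOpNormedRing Matrix.linftyOpNormedAlgebra

variable {n : Type*} [Fintype n] [DecidableEq n]

omit [Fintype n] [DecidableEq n] in
theorem map_eval_sum_X_pow (t : Finset ℕ) (c : ℕ → Matrix n n ℂ) (z : ℂ) :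
    (∑ i ∈ t, (Polynomial.X ^ i : Polynomial ℂ) • (c i).map Polynomial.C).map (Polynomial.eval z)
      = ∑ i ∈ t, z ^ i • c i := by
  ext a b
  simp only [Matrix.map_apply, Matrix.sum_apply, Matrix.smul_apply, smul_eq_mul,
    Polynomial.eval_finsetSum, Polynomial.eval_mul, Polynomial.eval_pow, Polynomial.eval_X,
    Polynomial.eval_C]

theorem det_map_eval (L : Matrix n n (Polynomial ℂ)) (z : ℂ) :
    (L.map (Polynomial.eval z)).det = L.det.eval z :=
  (RingHom.map_det (Polynomial.evalRingHom z) L).symm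

theorem differentiable_map_eval (L : Matrix n n (Polynomial ℂ)) :
    Differentiable ℂ fun z => L.map (Polynomial.eval z) := by
  rw [← differentiableOn_univ, differentiableOn_matrix_iff]
  exact fun i j => (L i j).differentiable.differentiableOn

/-- A holomorphic transition matrix over `ℂ*` becomes a Laurent polynomial matrix, invertible
over `ℂ*`, after a change of gauge near the two closed unit discs. -/
theorem exists_laurent_polynomial_gauge {T₀ : ℂ → Matrix n n ℂ} (hT : HolUnit T₀ {z | z ≠ 0}) :
    ∃ (N M : ℕ) (L L' : Matrix n n (Polynomial ℂ)) (g b : ℂ → Matrix n n ℂ),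
      L * L' = (Polynomial.X ^ M : Polynomial ℂ) • 1 ∧ HolUnit g (ball 0 2) ∧
      HolUnit b (ball 0 2) ∧ ∀ z : ℂ, 2⁻¹ < ‖z‖ → ‖z‖ < 2 →
        T₀ z * b z⁻¹ = (z ^ N)⁻¹ • (L.map (Polynomial.eval z) * g z) := by
  have : CompleteSpace (Matrix n n ℂ) := FiniteDimensional.complete ℂ _
  obtain ⟨δ, hδ, hfac⟩ := exists_annulus_factorization (𝔸 := Matrix n n ℂ)
  obtain ⟨N, t, c, happ⟩ := exists_laurent_polynomial_approx hT (δ := min (δ / 2) (1 / 2))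
    (by positivity)
  set Lp : Matrix n n (Polynomial ℂ) :=
    ∑ i ∈ t, (Polynomial.X ^ i : Polynomial ℂ) • (c i).map Polynomial.C with hLp
  have hLpz : ∀ z, Lp.map (Polynomial.eval z) = ∑ i ∈ t, z ^ i • c i := map_eval_sum_X_pow t c
  set L0 : ℂ → Matrix n n ℂ := fun z => (z ^ N)⁻¹ • Lp.map (Polynomial.eval z) with hL0
  have happ' : ∀ z : ℂ, (4 : ℝ)⁻¹ < ‖z‖ → ‖z‖ < 4 →
      ‖Ring.inverse (T₀ z) * L0 z - 1‖ ≤ min (δ / 2) (1 / 2) := by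
    intro z h1 h2
    simp only [hL0, hLpz]
    exact happ z h1 h2
  have hne : ∀ z : ℂ, (4 : ℝ)⁻¹ < ‖z‖ → z ≠ 0 :=
    fun z h1 => norm_pos_iff.1 (lt_trans (by norm_num) h1)
  have hu : ∀ z : ℂ, (4 : ℝ)⁻¹ < ‖z‖ → ‖z‖ < 4 → IsUnit (Ring.inverse (T₀ z) * L0 z) := by
    intro z h1 h2
    have := isUnit_one_add_of_norm_lt (((happ' z h1 h2).trans (min_le_right _ _)).trans_lt
      (by norm_num : (1 / 2 : ℝ) < 1))
    rwa [add_sub_cancel] at this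
  have hL0u : ∀ z : ℂ, (4 : ℝ)⁻¹ < ‖z‖ → ‖z‖ < 4 → IsUnit (L0 z) := by
    intro z h1 h2
    have := (hT.2 z (hne z h1)).mul (hu z h1 h2)
    rwa [Ring.mul_inverse_cancel_left _ _ (hT.2 z (hne z h1))] at this
  have hdetne : ∀ z : ℂ, (4 : ℝ)⁻¹ < ‖z‖ → ‖z‖ < 4 → Lp.det.eval z ≠ 0 := by
    intro z h1 h2
    have h3 := (Matrix.isUnit_iff_isUnit_det _).1 (hL0u z h1 h2)
    rw [hL0, Matrix.det_smul, det_map_eval] at h3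
    exact right_ne_zero_of_mul h3.ne_zero
  have hFd : DifferentiableOn ℂ (fun p : ℂ × ℂ => Ring.inverse (Ring.inverse (T₀ p.1) * L0 p.1))
      ({z : ℂ | (4 : ℝ)⁻¹ < ‖z‖ ∧ ‖z‖ < 4} ×ˢ ball 0 4) := by
    have : DifferentiableOn ℂ (fun z => Ring.inverse (T₀ z) * L0 z)
        {z : ℂ | (4 : ℝ)⁻¹ < ‖z‖ ∧ ‖z‖ < 4} := by
      refine (hT.inv.1.mono fun z hz => hne z hz.1).mul ?_
      have hzN : DifferentiableOn ℂ (fun z : ℂ => (z ^ N)⁻¹) {z : ℂ | (4 : ℝ)⁻¹ < ‖z‖ ∧ ‖z‖ < 4} :=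
        (differentiable_id.pow N).differentiableOn.inv fun z hz => pow_ne_zero _ (hne z hz.1)
      exact hzN.smul (differentiable_map_eval Lp).differentiableOn
    have h2 : HolUnit (fun z => Ring.inverse (T₀ z) * L0 z)
        {z : ℂ | (4 : ℝ)⁻¹ < ‖z‖ ∧ ‖z‖ < 4} := ⟨this, fun z hz => hu z hz.1 hz.2⟩
    exact (h2.inv.comp differentiable_fst.differentiableOn fun p hp => hp.1).1
  have hF1 : ∀ p ∈ {z : ℂ | (4 : ℝ)⁻¹ < ‖z‖ ∧ ‖z‖ < 4} ×ˢ ball (0 : ℂ) 4,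
      ‖Ring.inverse (Ring.inverse (T₀ p.1) * L0 p.1) - 1‖ ≤ δ := by
    intro p hp
    have h := happ' p.1 hp.1.1 hp.1.2
    have := norm_inverse_one_add_sub_one_le h (min_le_right _ _)
    rw [add_sub_cancel] at this
    refine this.trans ?_
    linarith [min_le_left (δ / 2) (1 / 2 : ℝ)]
  obtain ⟨P, Nr, hP, hNr, hPN⟩ := hfac 4 (by norm_num) _ hFd hF1
  set a : ℂ → Matrix n n ℂ := fun z => Ring.inverse (P (z, 0)) with ha
  set b : ℂ → Matrix n n ℂ := fun z => Ring.inverse (Nr (z, 0)) with hb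
  have hmaps : MapsTo (fun z : ℂ => (z, (0 : ℂ))) (ball 0 2) (ball 0 2 ×ˢ ball 0 (4 / 4)) :=
    fun z hz => ⟨hz, by simp⟩
  have hd0 : DifferentiableOn ℂ (fun z : ℂ => (z, (0 : ℂ))) (ball 0 2) := by fun_prop
  have hau : HolUnit a (ball 0 2) := (hP.comp hd0 hmaps).inv
  have hbu : HolUnit b (ball 0 2) := (hNr.comp hd0 hmaps).inv
  have hsplit : ∀ z, Lp.det.eval z = Lp.det.leadingCoeff *
      (Lp.det.roots.map fun c => z - c).prod := fun z =>
    (IsAlgClosed.splits Lp.det).eval_eq_prod_roots z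
  have hdet0 : Lp.det ≠ 0 := by
    intro h
    exact hdetne 1 (by norm_num) (by norm_num) (by rw [h, Polynomial.eval_zero])
  set s := Lp.det.roots.filter fun c => ‖c‖ < 2 with hs
  set s' := Lp.det.roots.filter fun c => ¬ ‖c‖ < 2 with hs'
  have hss : s + s' = Lp.det.roots := Multiset.filter_add_not _ _
  set u : ℂ → ℂ := fun z => Lp.det.leadingCoeff * (s'.map fun c => z - c).prod * (a z).det with hu'
  have huc : ContinuousOn u (ball 0 2) := by
    have hprod : Continuous fun z : ℂ => (s'.map fun c => z - c).prod :=
      continuous_multiset_prod s' fun i _ => by fun_prop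
    exact (continuous_const.mul hprod).continuousOn.mul (continuousOn_det hau.1.continuousOn)
  have hu0 : ∀ z ∈ ball (0 : ℂ) 2, u z ≠ 0 := by
    intro z hz
    refine mul_ne_zero (mul_ne_zero (Polynomial.leadingCoeff_ne_zero.2 hdet0) ?_)
      ((Matrix.isUnit_iff_isUnit_det _).1 (hau.2 z hz)).ne_zero
    rw [Ne, Multiset.prod_eq_zero_iff, Multiset.mem_map]
    rintro ⟨w, hw, hzw⟩
    rw [sub_eq_zero] at hzw
    subst hzw
    exact (Multiset.mem_filter.1 hw).2 (by simpa using hz)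
  have hdetQ : ∀ z ∈ ball (0 : ℂ) 2, (Lp.map (Polynomial.eval z) * a z).det =
      z ^ 0 * (s.map fun c => z - c).prod * u z := by
    intro z hz
    rw [Matrix.det_mul, det_map_eval, hsplit, ← hss, Multiset.map_add, Multiset.prod_add, hu']
    ring
  have hsroots : ∀ c ∈ s, ‖c‖ ≤ 2⁻¹ := by
    intro w hw
    have hw' := Multiset.mem_filter.1 hw
    by_contra! hlt
    exact hdetne w (lt_trans (by norm_num) hlt) (hw'.2.trans (by norm_num))
      (Polynomial.isRoot_of_mem_roots hw'.1)
  have hTb : ∀ z : ℂ, 2⁻¹ < ‖z‖ → ‖z‖ < 2 →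
      T₀ z * b z⁻¹ = (z ^ N)⁻¹ • (Lp.map (Polynomial.eval z) * a z) := by
    intro z h1 h2
    have h1' : (4 : ℝ)⁻¹ < ‖z‖ := lt_trans (by norm_num) h1
    have h2' : ‖z‖ < 4 := lt_trans h2 (by norm_num)
    have hzb : z ∈ ball (0 : ℂ) 2 := by rwa [mem_ball_zero_iff]
    have hzb' : z⁻¹ ∈ ball (0 : ℂ) 2 := by
      rw [mem_ball_zero_iff, norm_inv]
      exact inv_lt_of_inv_lt₀ (by norm_num) h1
    have hkey := hPN z 0 h1 h2 (by norm_num)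
    simp only at hkey
    have hT0 : T₀ z = L0 z * Ring.inverse (Ring.inverse (T₀ z) * L0 z) := by
      set w := Ring.inverse (T₀ z) * L0 z with hw
      have : L0 z = T₀ z * w := by
        rw [hw, Ring.mul_inverse_cancel_left _ _ (hT.2 z (hne z h1'))]
      rw [this, mul_assoc, Ring.mul_inverse_cancel _ (hu z h1' h2'), mul_one]
    have hinv : Ring.inverse (Ring.inverse (T₀ z) * L0 z) = a z * Nr (z⁻¹, 0) := by
      rw [← hkey, ha, Ring.inverse_mul_cancel_left _ _ (hP.2 _ (hmaps hzb))]
    rw [hT0, hinv, hb]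
    simp only [mul_assoc]
    rw [Ring.mul_inverse_cancel _ (hNr.2 _ (hmaps hzb')), mul_one, hL0]
    simp only [smul_mul_assoc]
  obtain ⟨m', Q', b', u', hQ', hb', hu1, hu2, hdet', hT'⟩ := exists_gauge_moving_zeros
    (T₀ := T₀) (f := fun z => (z ^ N)⁻¹) s 0 (fun z => Lp.map (Polynomial.eval z) * a z) b u
    ((differentiable_map_eval Lp).differentiableOn.mul hau.1) hbu huc hu0 hdetQ hsroots hTb
  obtain ⟨M, L, L', g, hLL, hg, hQg⟩ := exists_polynomial_mul_holUnit m' Q' u' hQ' hu1 hu2 hdet'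
  refine ⟨N, M, L, L', g, b', hLL, hg, hb', fun z h1 h2 => ?_⟩
  rw [hT' z h1 h2, hQg z (by rwa [mem_ball_zero_iff])]

end Grothendieck

section NormalForm

open Set Metric Filter Topology

attribute [local instance] Matrix.linftyOpNormedRing Matrix.linftyOpNormedAlgebra

variable {n : Type*} [Fintype n] [DecidableEq n]

omit [DecidableEq n] in
theorem map_eval_mul (L L' : Matrix n n (Polynomial ℂ)) (z : ℂ) :
    (L * L').map (Polynomial.eval z) = L.map (Polynomial.eval z) * L'.map (Polynomial.eval z) :=
  Matrix.map_mul (f := Polynomial.evalRingHom z)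

theorem map_eval_mul_of_mul_eq {L L' : Matrix n n (Polynomial ℂ)} {M : ℕ}
    (h : L * L' = (Polynomial.X ^ M : Polynomial ℂ) • 1) (z : ℂ) :
    L.map (Polynomial.eval z) * L'.map (Polynomial.eval z) = z ^ M • 1 := by
  rw [← map_eval_mul, h]
  ext i j
  by_cases hij : i = j
  · subst hij; simp
  · simp [hij]

theorem isUnit_map_eval_of_mul_eq {L L' : Matrix n n (Polynomial ℂ)} {M : ℕ}
    (h : L * L' = (Polynomial.X ^ M : Polynomial ℂ) • 1) {z : ℂ} (hz : z ≠ 0) :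
    IsUnit (L.map (Polynomial.eval z)) := by
  refine (Matrix.isUnit_iff_isUnit_det _).2 (isUnit_iff_ne_zero.2 fun h0 => ?_)
  have := congrArg Matrix.det (map_eval_mul_of_mul_eq h z)
  rw [Matrix.det_mul, h0, zero_mul, Matrix.det_smul, Matrix.det_one, mul_one] at this
  exact pow_ne_zero _ (pow_ne_zero _ hz) this.symm

theorem isUnit_smul_of_ne_zero {c : ℂ} (hc : c ≠ 0) {A : Matrix n n ℂ} (hA : IsUnit A) :
    IsUnit (c • A) := by
  have := hA.smul (Units.mk0 c hc)
  exact this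

/-- Up to holomorphic gauge, every transition matrix on `Z_k` is the product of a Laurent
polynomial matrix in `z` and a matrix that is holomorphic over the first chart. -/
theorem exists_laurent_mul_entire {k : ℕ} (hk : 1 ≤ k) {T : ℂ × ℂ → Matrix n n ℂ}
    (hT : HolUnit T overlap) :
    ∃ (N M : ℕ) (L L' : Matrix n n (Polynomial ℂ)) (A B : ℂ × ℂ → Matrix n n ℂ),
      L * L' = (Polynomial.X ^ M : Polynomial ℂ) • 1 ∧ HolUnit A univ ∧ HolUnit B univ ∧
      ∀ p : ℂ × ℂ, p.1 ≠ 0 →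
        T p * B (coordChange k p) = (p.1 ^ N)⁻¹ • (L.map (Polynomial.eval p.1) * A p) := by
  have : CompleteSpace (Matrix n n ℂ) := FiniteDimensional.complete ℂ _
  have hzero : DifferentiableOn ℂ (fun z : ℂ => (z, (0 : ℂ))) {z | z ≠ 0} := by fun_prop
  have hT₀ : HolUnit (fun z => T (z, 0)) {z | z ≠ 0} := hT.comp hzero fun z hz => hz
  obtain ⟨N, M, L, L', g, b, hLL, hg, hb, hTgb⟩ := exists_laurent_polynomial_gauge hT₀
  set K : ℂ → Matrix n n ℂ := fun z => (z ^ N)⁻¹ • L.map (Polynomial.eval z) with hK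
  have hKu : HolUnit K {z | z ≠ 0} := by
    refine ⟨?_, fun z hz => ?_⟩
    · have hzN : DifferentiableOn ℂ (fun z : ℂ => (z ^ N)⁻¹) {z : ℂ | z ≠ 0} :=
        (differentiable_id.pow N).differentiableOn.inv fun z hz => pow_ne_zero _ hz
      exact hzN.smul (differentiable_map_eval L).differentiableOn
    · exact isUnit_smul_of_ne_zero (inv_ne_zero (pow_ne_zero _ hz))
        (isUnit_map_eval_of_mul_eq hLL hz)
  have hfst : DifferentiableOn ℂ (Prod.fst : ℂ × ℂ → ℂ) overlap :=
    differentiable_fst.differentiableOn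
  have hK2 : HolUnit (fun p : ℂ × ℂ => Ring.inverse (K p.1)) overlap :=
    hKu.inv.comp hfst fun p hp => hp
  have hT1 : HolUnit (fun p : ℂ × ℂ => Ring.inverse (K p.1) * T (p.1, 0)) overlap :=
    hK2.mul (hT₀.comp hfst fun p hp => hp)
  have hnorm : ∀ {z : ℂ}, z ≠ 0 → ‖z⁻¹‖ < 2 → 2⁻¹ < ‖z‖ := by
    intro z hz h
    rw [norm_inv] at h
    exact inv_lt_of_inv_lt₀ (norm_pos_iff.2 hz) h
  have hout : ∀ z : ℂ, ¬ ‖z‖ < 2 → z ≠ 0 ∧ ‖z⁻¹‖ < 2 := by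
    intro z hz
    rw [not_lt] at hz
    have hz0 : z ≠ 0 := norm_pos_iff.1 (by linarith)
    refine ⟨hz0, ?_⟩
    rw [norm_inv]
    exact (inv_anti₀ two_pos hz).trans_lt (by norm_num)
  obtain ⟨A', B', hfr, -, -⟩ := Frame.of_pieces (k := k) hT1 (U := {p | ‖p.1‖ < 2})
    (V := {p | ‖p.1‖ < 2}) (A := fun p => g p.1) (B := fun p => b p.1) (C := 1) (D := 1)
    (isOpen_lt continuous_fst.norm continuous_const)
    (isOpen_lt continuous_fst.norm continuous_const)
    (hg.comp differentiable_fst.differentiableOn fun p hp => by simpa using hp)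
    (hb.comp differentiable_fst.differentiableOn fun p hp => by simpa using hp)
    (fun p hp hp1 hp2 => by
      have h1 := hTgb p.1 (hnorm hp1 hp2) hp
      have h2 : (K p.1) * g p.1 = T (p.1, 0) * b (p.1)⁻¹ := by
        rw [h1, hK]; simp only [smul_mul_assoc]
      show g p.1 = Ring.inverse (K p.1) * T (p.1, 0) * b (p.1)⁻¹
      rw [mul_assoc, ← h2, Ring.inverse_mul_cancel_left _ _ (hKu.2 _ hp1)])
    (fun p _ hp => hout p.1 hp) (fun p _ hp => hout p.1 hp)
  have htube : MapsTo (fun z : ℂ => (z, (0 : ℂ))) univ (tube k 1 1) := fun z _ => by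
    constructor <;> simp
  have hd0 : DifferentiableOn ℂ (fun z : ℂ => (z, (0 : ℂ))) univ := by fun_prop
  have hG := hfr.left.comp hd0 htube
  have hH := hfr.right.comp hd0 htube
  have hinv : DifferentiableOn ℂ (fun p : ℂ × ℂ => p.1⁻¹) overlap := hfst.inv fun p hp => hp
  have hGH : ∀ z : ℂ, z ≠ 0 → A' (z, 0) = Ring.inverse (K z) * T (z, 0) * B' (z⁻¹, 0) := by
    intro z hz
    have := hfr.eq (z, 0) hz (htube (mem_univ z))
    simpa [coordChange] using this
  obtain ⟨A, B, hA, hB, hAB⟩ := exists_global_frame hk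
    (T := fun p => Ring.inverse (A' (p.1, 0)) * (Ring.inverse (K p.1) * T p) * B' (p.1⁻¹, 0))
    (((hG.inv.comp hfst fun p _ => mem_univ _).mul (hK2.mul hT)).mul
      (hH.comp hinv fun p _ => mem_univ _)) (fun z hz => by
      show Ring.inverse (A' (z, 0)) * (Ring.inverse (K z) * T (z, 0)) * B' (z⁻¹, 0) = 1
      rw [mul_assoc, ← hGH z hz, Ring.inverse_mul_cancel _ (hG.2 z (mem_univ z))])
  refine ⟨N, M, L, L', fun p => A' (p.1, 0) * A p, fun q => B' (q.1, 0) * B q, hLL,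
    (hG.comp differentiable_fst.differentiableOn fun p _ => mem_univ _).mul hA,
    (hH.comp differentiable_fst.differentiableOn fun p _ => mem_univ _).mul hB, fun p hp => ?_⟩
  have hcc : (coordChange k p).1 = p.1⁻¹ := rfl
  simp only [hcc]
  rw [hAB p hp]
  have e1 : (p.1 ^ N)⁻¹ • (L.map (Polynomial.eval p.1) * (A' (p.1, 0) *
      (Ring.inverse (A' (p.1, 0)) * (Ring.inverse (K p.1) * T p) * B' (p.1⁻¹, 0) *
        B (coordChange k p)))) = K p.1 * (Ring.inverse (K p.1) *
          (T p * (B' (p.1⁻¹, 0) * B (coordChange k p)))) := by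
    rw [hK]
    simp only [smul_mul_assoc, mul_assoc]
    rw [Ring.mul_inverse_cancel_left _ _ (hG.2 p.1 (mem_univ _))]
  rw [e1, Ring.mul_inverse_cancel_left _ _ (hKu.2 _ hp)]

end NormalForm

section Division

open Set Metric Filter Topology

variable {E : Type*} [NormedAddCommGroup E] [NormedSpace ℂ E]

theorem exists_fst_smul_on_ball [CompleteSpace E] {f : ℂ × ℂ → E} (hf : Differentiable ℂ f)
    (hf0 : ∀ u, f (0, u) = 0) {R : ℝ} (hR : 0 < R) :
    ∃ g : ℂ × ℂ → E, DifferentiableOn ℂ g (ball 0 R ×ˢ ball 0 R) ∧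
      ∀ p ∈ ball (0 : ℂ) R ×ˢ ball (0 : ℂ) R, f p = p.1 • g p := by
  set F : ℂ × ℂ → E := fun q => f (q.2, q.1) with hF
  have hFd : Differentiable ℂ F := hf.comp (by fun_prop)
  obtain ⟨M, hM⟩ := ((isCompact_closedBall (0 : ℂ) R).prod
    (isCompact_closedBall (0 : ℂ) (3 * R))).exists_bound_of_continuousOn
    hFd.continuous.continuousOn
  obtain ⟨c, hc1, hc2, hc3⟩ := exists_taylor_snd (D := ball (0 : ℂ) R) isOpen_ball
    (ρ := 2 * R) (R := 3 * R) (by positivity) (by linarith) hFd.differentiableOn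
    fun p hp => hM p (Set.prod_mono ball_subset_closedBall ball_subset_closedBall hp)
  have hc0 : ∀ u ∈ ball (0 : ℂ) R, c 0 u = 0 := by
    intro u hu
    have h1 := hc3 u hu 0 (by simpa using hR)
    have h2 := hasSum_single (f := fun n : ℕ => (0 : ℂ) ^ n • c n u) 0 fun n hn => by simp [hn]
    have h3 := h2.unique h1
    simpa [hF, hf0] using h3
  have hbound : ∀ i, ∀ p ∈ ball (0 : ℂ) R ×ˢ ball (0 : ℂ) R,
      ‖p.1 ^ i • c (i + 1) p.2‖ ≤ M * (2 * R)⁻¹ * (1 / 2) ^ i := by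
    rintro i ⟨z, u⟩ ⟨hz, hu⟩
    rw [norm_smul, norm_pow]
    calc ‖z‖ ^ i * ‖c (i + 1) u‖ ≤ R ^ i * (M * ((2 * R) ^ (i + 1))⁻¹) := by
          gcongr
          · exact (mem_ball_zero_iff.1 hz).le
          · exact hc2 _ u hu
      _ = M * (2 * R)⁻¹ * (1 / 2) ^ i := by
          rw [pow_succ, mul_pow, div_pow, one_pow]
          field_simp
  have hsumb : Summable fun i : ℕ => M * (2 * R)⁻¹ * (1 / 2 : ℝ) ^ i :=
    (summable_geometric_of_lt_one (by norm_num) (by norm_num)).mul_left _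
  refine ⟨fun p => ∑' i : ℕ, p.1 ^ i • c (i + 1) p.2, ?_, ?_⟩
  · refine differentiableOn_tsum_of_norm_le (isOpen_ball.prod isOpen_ball) (fun i => ?_) hsumb
      hbound
    have h1 : DifferentiableOn ℂ (fun p : ℂ × ℂ => c (i + 1) p.2) (ball 0 R ×ˢ ball 0 R) :=
      (hc1 (i + 1)).comp differentiable_snd.differentiableOn fun p hp => hp.2
    have h2 : DifferentiableOn ℂ (fun p : ℂ × ℂ => p.1 ^ i) (ball 0 R ×ˢ ball 0 R) := by fun_prop
    exact h2.smul h1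
  · rintro ⟨z, u⟩ ⟨hz, hu⟩
    have h1 := hc3 u hu z (by
      rw [mem_ball_zero_iff] at hz
      simp only at hz
      linarith)
    have h2 := (hasSum_nat_add_iff' 1).2 h1
    simp only [Finset.range_one, Finset.sum_singleton, pow_zero, one_smul, hc0 u hu, sub_zero] at h2
    have h3 : HasSum (fun i : ℕ => z • (z ^ i • c (i + 1) u)) (F (u, z)) := by
      simpa only [smul_smul, ← pow_succ'] using h2
    have h4 : Summable fun i : ℕ => z ^ i • c (i + 1) u :=
      Summable.of_norm_bounded hsumb fun i => hbound i (z, u) ⟨hz, hu⟩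
    exact h3.unique (h4.hasSum.const_smul z)

/-- An entire function of two variables vanishing on the line `z = 0` is divisible by `z`. -/
theorem exists_fst_smul [CompleteSpace E] {f : ℂ × ℂ → E} (hf : Differentiable ℂ f)
    (hf0 : ∀ u, f (0, u) = 0) :
    ∃ g : ℂ × ℂ → E, Differentiable ℂ g ∧ ∀ p, f p = p.1 • g p := by
  classical
  set g : ℂ × ℂ → E := fun p => if p.1 = 0 then fderiv ℂ f p (1, 0) else p.1⁻¹ • f p with hg
  refine ⟨g, fun p => ?_, fun p => ?_⟩
  · set R : ℝ := ‖p‖ + 1 with hR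
    have hR0 : 0 < R := by positivity
    obtain ⟨h, hh, hfh⟩ := exists_fst_smul_on_ball hf hf0 hR0
    have hopen : IsOpen (ball (0 : ℂ) R ×ˢ ball (0 : ℂ) R) := isOpen_ball.prod isOpen_ball
    have hp : p ∈ ball (0 : ℂ) R ×ˢ ball (0 : ℂ) R := by
      constructor
      · rw [mem_ball_zero_iff]; exact (norm_fst_le p).trans_lt (lt_add_one _)
      · rw [mem_ball_zero_iff]; exact (norm_snd_le p).trans_lt (lt_add_one _)
    refine ((hh p hp).differentiableAt (hopen.mem_nhds hp)).congr_of_eventuallyEq ?_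
    filter_upwards [hopen.mem_nhds hp] with q hq
    by_cases hq0 : q.1 = 0
    · simp only [hg, hq0, if_true]
      have hhq := (hh q hq).differentiableAt (hopen.mem_nhds hq)
      have h1 : f =ᶠ[𝓝 q] fun q => q.1 • h q := by
        filter_upwards [hopen.mem_nhds hq] with q' hq' using hfh q' hq'
      have h2 := (hasFDerivAt_fst (𝕜 := ℂ) (p := q)).fun_smul hhq.hasFDerivAt
      rw [h1.fderiv_eq, HasFDerivAt.fderiv h2]
      simp [hq0]
    · simp only [hg, hq0, if_false]
      rw [hfh q hq, smul_smul, inv_mul_cancel₀ hq0, one_smul]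
  · by_cases hp0 : p.1 = 0
    · have : p = (0, p.2) := Prod.ext hp0 rfl
      rw [this, hf0]; simp
    · simp only [hg, hp0, if_false]
      rw [smul_smul, mul_inv_cancel₀ hp0, one_smul]

theorem exists_polynomial_add_pow_mul {f : ℂ → ℂ} (hf : Differentiable ℂ f) (j : ℕ) :
    ∃ (q : Polynomial ℂ) (h : ℂ → ℂ), Differentiable ℂ h ∧ ∀ u, f u = q.eval u + u ^ j * h u := by
  induction j with
  | zero => exact ⟨0, f, hf, fun u => by simp⟩
  | succ j ih =>
    obtain ⟨q, h, hh, hq⟩ := ih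
    refine ⟨q + Polynomial.C (h 0) * Polynomial.X ^ j, dslope h 0, ?_, fun u => ?_⟩
    · rw [← differentiableOn_univ, Complex.differentiableOn_dslope univ_mem]
      exact hh.differentiableOn
    · have := sub_smul_dslope h 0 u
      rw [hq u]
      simp only [Polynomial.eval_add, Polynomial.eval_mul, Polynomial.eval_C, Polynomial.eval_pow,
        Polynomial.eval_X]
      rw [sub_zero, smul_eq_mul] at this
      linear_combination (-(u ^ j)) * this

end Division

section Regular

theorem regularOnOverlap_const (c : ℂ) : RegularOnOverlap fun _ => c :=
  ⟨MvPolynomial.C c, fun p _ => by simp⟩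

theorem RegularOnOverlap.add {f g : ℂ × ℂ → ℂ} (hf : RegularOnOverlap f)
    (hg : RegularOnOverlap g) : RegularOnOverlap fun p => f p + g p := by
  obtain ⟨P, hP⟩ := hf
  obtain ⟨Q, hQ⟩ := hg
  exact ⟨P + Q, fun p hp => by simp only [hP p hp, hQ p hp, map_add]⟩

theorem RegularOnOverlap.mul {f g : ℂ × ℂ → ℂ} (hf : RegularOnOverlap f)
    (hg : RegularOnOverlap g) : RegularOnOverlap fun p => f p * g p := by
  obtain ⟨P, hP⟩ := hf
  obtain ⟨Q, hQ⟩ := hg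
  exact ⟨P * Q, fun p hp => by simp only [hP p hp, hQ p hp, map_mul]⟩

theorem RegularOnOverlap.sum {ι : Type*} {s : Finset ι} {f : ι → ℂ × ℂ → ℂ}
    (hf : ∀ i ∈ s, RegularOnOverlap (f i)) : RegularOnOverlap fun p => ∑ i ∈ s, f i p := by
  choose! P hP using hf
  exact ⟨∑ i ∈ s, P i, fun p hp => by
    rw [map_sum]; exact Finset.sum_congr rfl fun i hi => hP i hi p hp⟩

theorem RegularOnOverlap.eval {f : ℂ × ℂ → ℂ} (hf : RegularOnOverlap f) (q : Polynomial ℂ) :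
    RegularOnOverlap fun p => q.eval (f p) := by
  obtain ⟨P, hP⟩ := hf
  refine ⟨Polynomial.aeval P q, fun p hp => ?_⟩
  have := Polynomial.aeval_algHom_apply
    (MvPolynomial.aeval ![p.1, p.1⁻¹, p.2] : MvPolynomial (Fin 3) ℂ →ₐ[ℂ] ℂ) P q
  simp only [MvPolynomial.aeval_eq_eval, Polynomial.coe_aeval_eq_eval] at this
  simp only [hP p hp]
  exact this

theorem regularOnOverlap_fst : RegularOnOverlap fun p => p.1 :=
  ⟨MvPolynomial.X 0, fun p _ => by simp⟩

theorem regularOnOverlap_snd : RegularOnOverlap fun p => p.2 :=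
  ⟨MvPolynomial.X 2, fun p _ => by simp⟩

theorem regularOnOverlap_inv_pow (N : ℕ) : RegularOnOverlap fun p => (p.1 ^ N)⁻¹ :=
  ⟨MvPolynomial.X 1 ^ N, fun p _ => by simp⟩

theorem regularOnOverlap_matrix_mul {n : Type*} [Fintype n] {A B : ℂ × ℂ → Matrix n n ℂ}
    (hA : ∀ i j, RegularOnOverlap fun p => A p i j)
    (hB : ∀ i j, RegularOnOverlap fun p => B p i j) (i j : n) :
    RegularOnOverlap fun p => (A p * B p) i j := by
  simp only [Matrix.mul_apply]
  exact RegularOnOverlap.sum fun l _ => (hA i l).mul (hB l j)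

end Regular

section Truncation

open Set Metric Filter Topology

attribute [local instance] Matrix.linftyOpNormedRing Matrix.linftyOpNormedAlgebra

variable {n : Type*} [Fintype n] [DecidableEq n]

/-- Up to a nonvanishing scalar and a gauge on the second chart, `A` is a regular unit times
`1 + z ^ j • R`. -/
def ReducesTo (k : ℕ) (A : ℂ × ℂ → Matrix n n ℂ) (j : ℕ) (R : ℂ × ℂ → Matrix n n ℂ) : Prop :=
  ∃ (s : ℂ × ℂ → ℂ) (B P : ℂ × ℂ → Matrix n n ℂ), Differentiable ℂ s ∧ (∀ p, s p ≠ 0) ∧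
    HolUnit B univ ∧ HolUnit P univ ∧ (∀ a b, RegularOnOverlap fun p => P p a b) ∧
    ∀ p : ℂ × ℂ, p.1 ≠ 0 →
      s p • (A p * B (coordChange k p)) = P p * (1 + p.1 ^ j • R p)

/-- The summand `ρ` can be removed from the restriction to `z = 0` of the remainder. -/
def Removable (k : ℕ) (A : ℂ × ℂ → Matrix n n ℂ) (j : ℕ) (ρ : ℂ → Matrix n n ℂ) : Prop :=
  ∀ R : ℂ × ℂ → Matrix n n ℂ, Differentiable ℂ R → ReducesTo k A j R →
    ∃ R' : ℂ × ℂ → Matrix n n ℂ, Differentiable ℂ R' ∧ ReducesTo k A j R' ∧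
      ∀ u, R' (0, u) = R (0, u) - ρ u

variable {k j : ℕ} {A : ℂ × ℂ → Matrix n n ℂ}

theorem removable_zero : Removable k A j 0 := fun R hR hA => ⟨R, hR, hA, fun u => by simp⟩

theorem Removable.add {ρ σ : ℂ → Matrix n n ℂ} (hρ : Removable k A j ρ) (hσ : Removable k A j σ) :
    Removable k A j (ρ + σ) := by
  intro R hR hA
  obtain ⟨R₁, hR₁, hA₁, h₁⟩ := hρ R hR hA
  obtain ⟨R₂, hR₂, hA₂, h₂⟩ := hσ R₁ hR₁ hA₁
  exact ⟨R₂, hR₂, hA₂, fun u => by rw [h₂, h₁, Pi.add_apply]; abel⟩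

theorem Removable.sum {ι : Type*} {s : Finset ι} {ρ : ι → ℂ → Matrix n n ℂ}
    (h : ∀ i ∈ s, Removable k A j (ρ i)) : Removable k A j (∑ i ∈ s, ρ i) :=
  Finset.sum_induction ρ (Removable k A j) (fun _ _ => Removable.add) removable_zero h

theorem removable_smul_one (hj : 1 ≤ j) {f : ℂ → ℂ} (hf : Differentiable ℂ f) :
    Removable k A j fun u => f u • 1 := by
  rintro R hR ⟨s, B, P, hs, hs0, hB, hP, hPr, h⟩
  set e : ℂ → ℂ := fun w => Complex.exp (-w) with he
  have hed : Differentiable ℂ e := Complex.differentiable_exp.comp differentiable_neg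
  set ψ : ℂ → ℂ := dslope e 0 with hψ
  have hψd : Differentiable ℂ ψ := by
    rw [← differentiableOn_univ, hψ, Complex.differentiableOn_dslope univ_mem]
    exact hed.differentiableOn
  have hψ0 : ψ 0 = -1 := by
    have h1 : HasDerivAt e (Complex.exp (-0) * -1) 0 := (hasDerivAt_neg (0 : ℂ)).cexp
    rw [hψ, dslope_same, h1.deriv]
    simp
  have heψ : ∀ w, e w = 1 + w * ψ w := by
    intro w
    have := sub_smul_dslope e 0 w
    have he0 : e 0 = 1 := by simp [he]
    rw [sub_zero, smul_eq_mul, he0] at this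
    rw [hψ, this]; ring
  set w : ℂ × ℂ → ℂ := fun p => p.1 ^ j * f p.2 with hw
  have hf2 : Differentiable ℂ fun p : ℂ × ℂ => f p.2 := hf.comp differentiable_snd
  have hwd : Differentiable ℂ w := (differentiable_fst.pow j).mul hf2
  refine ⟨fun p => e (w p) • R p + (f p.2 * ψ (w p)) • 1, ?_,
    ⟨fun p => e (w p) * s p, B, P, (hed.comp hwd).mul hs,
      fun p => mul_ne_zero (Complex.exp_ne_zero _) (hs0 p), hB, hP, hPr, fun p hp => ?_⟩,
    fun u => ?_⟩
  · exact ((hed.comp hwd).smul hR).add ((hf2.mul (hψd.comp hwd)).smul_const _)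
  · have h1 : (1 : Matrix n n ℂ) + p.1 ^ j • (e (w p) • R p + (f p.2 * ψ (w p)) • 1) =
        e (w p) • (1 + p.1 ^ j • R p) := by
      have h2 : e (w p) • (1 : Matrix n n ℂ) = 1 + (p.1 ^ j * f p.2 * ψ (w p)) • 1 := by
        conv_lhs => rw [heψ]
        rw [add_smul, one_smul]
      rw [smul_add (e (w p)), h2]
      simp only [smul_add, smul_smul]
      rw [mul_comm (e (w p)), mul_assoc]
      abel
    rw [h1, mul_smul, h p hp, mul_smul_comm]
  · have hw0 : w (0, u) = 0 := by simp [hw, Nat.ne_of_gt hj]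
    simp only [hw0, hψ0]
    simp [he, sub_eq_add_neg]

theorem isUnit_one_add_smul {N : Matrix n n ℂ} (hN : N * N = 0) (c : ℂ) : IsUnit (1 + c • N) := by
  refine IsUnit.of_mul_eq_one (1 - c • N) ?_
  rw [mul_sub, add_mul, add_mul, smul_mul_smul_comm, hN]
  simp

theorem removable_polynomial_smul {N : Matrix n n ℂ} (hN : N * N = 0) (hj : 1 ≤ j)
    (q : Polynomial ℂ) : Removable k A j fun u => q.eval u • N := by
  rintro R hR ⟨s, B, P, hs, hs0, hB, hP, hPr, h⟩
  have hqd : Differentiable ℂ fun p : ℂ × ℂ => q.eval p.2 :=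
    q.differentiable.comp differentiable_snd
  have hpd : Differentiable ℂ fun p : ℂ × ℂ => p.1 ^ j := differentiable_fst.pow j
  have hQd : Differentiable ℂ fun p : ℂ × ℂ => 1 + (p.1 ^ j * q.eval p.2) • N :=
    (differentiable_const _).add ((hpd.mul hqd).smul_const N)
  refine ⟨fun p => R p - q.eval p.2 • N - (p.1 ^ j * q.eval p.2) • (N * R p), ?_,
    ⟨s, B, fun p => P p * (1 + (p.1 ^ j * q.eval p.2) • N), hs, hs0, hB,
      hP.mul ⟨hQd.differentiableOn, fun p _ => isUnit_one_add_smul hN _⟩,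
      regularOnOverlap_matrix_mul hPr fun a b => ?_, fun p hp => ?_⟩, fun u => ?_⟩
  · exact (hR.sub (hqd.smul_const N)).sub
      ((hpd.mul hqd).smul ((differentiable_const N).mul hR))
  · simp only [Matrix.add_apply, Matrix.smul_apply, smul_eq_mul]
    refine (regularOnOverlap_const _).add (RegularOnOverlap.mul (RegularOnOverlap.mul ?_
      (regularOnOverlap_snd.eval q)) (regularOnOverlap_const _))
    simpa using regularOnOverlap_fst.eval (Polynomial.X ^ j)
  · rw [h p hp, mul_assoc]
    congr 1
    have : N * (N * R p) = 0 := by rw [← mul_assoc, hN, zero_mul]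
    simp only [add_mul, mul_sub, mul_add, one_mul, mul_one, smul_sub, smul_add, smul_mul_assoc,
      mul_smul_comm, smul_smul, hN, this, smul_zero]
    rw [mul_comm (p.1 ^ j) (p.1 ^ j * Polynomial.eval p.2 q)]
    abel
  · simp [Nat.ne_of_gt hj]

theorem removable_pow_mul_smul (hk : 1 ≤ k) {N : Matrix n n ℂ} (hN : N * N = 0) (hj : 1 ≤ j)
    {f : ℂ → ℂ} (hf : Differentiable ℂ f) : Removable k A j fun u => (u ^ j * f u) • N := by
  rintro R hR ⟨s, B, P, hs, hs0, hB, hP, hPr, h⟩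
  have hf2 : Differentiable ℂ fun p : ℂ × ℂ => p.2 ^ j * f p.2 :=
    (differentiable_snd.pow j).mul (hf.comp differentiable_snd)
  have hpd : Differentiable ℂ fun p : ℂ × ℂ => p.1 ^ j := differentiable_fst.pow j
  set g : ℂ × ℂ → ℂ := fun q => -((q.1 ^ (k - 1) * q.2) ^ j * f (q.1 ^ k * q.2)) with hg
  have hgd : Differentiable ℂ g := by
    have h1 : Differentiable ℂ fun q : ℂ × ℂ => f (q.1 ^ k * q.2) := hf.comp (by fun_prop)
    have h2 : Differentiable ℂ fun q : ℂ × ℂ => (q.1 ^ (k - 1) * q.2) ^ j := by fun_prop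
    exact (h2.mul h1).neg
  have hGd : Differentiable ℂ fun q : ℂ × ℂ => 1 + g q • N :=
    (differentiable_const _).add (hgd.smul_const N)
  have hgc : ∀ p : ℂ × ℂ, p.1 ≠ 0 → g (coordChange k p) = -(p.1 ^ j * (p.2 ^ j * f p.2)) := by
    intro p hp
    have h1 : p.1⁻¹ ^ k * (p.1 ^ k * p.2) = p.2 := by
      rw [← mul_assoc, inv_pow, inv_mul_cancel₀ (pow_ne_zero _ hp), one_mul]
    have h2 : p.1⁻¹ ^ (k - 1) * (p.1 ^ k * p.2) = p.1 * p.2 := by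
      obtain ⟨l, rfl⟩ := Nat.exists_eq_add_of_le' hk
      rw [Nat.add_sub_cancel, ← mul_assoc, inv_pow, pow_succ,
        inv_mul_cancel_left₀ (pow_ne_zero _ hp)]
    simp only [hg, coordChange, h1, h2]
    ring
  refine ⟨fun p => R p - (p.2 ^ j * f p.2) • N - (p.1 ^ j * (p.2 ^ j * f p.2)) • (R p * N), ?_,
    ⟨s, fun q => B q * (1 + g q • N), P, hs, hs0,
      hB.mul ⟨hGd.differentiableOn, fun q _ => isUnit_one_add_smul hN _⟩, hP, hPr,
      fun p hp => ?_⟩, fun u => ?_⟩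
  · exact (hR.sub (hf2.smul_const N)).sub ((hpd.mul hf2).smul (hR.mul (differentiable_const N)))
  · rw [← mul_assoc, ← smul_mul_assoc, h p hp, mul_assoc, hgc p hp]
    congr 1
    simp only [add_mul, mul_add, one_mul, mul_one, smul_sub, smul_add, smul_mul_assoc,
      mul_smul_comm, smul_smul, neg_smul, mul_neg]
    rw [mul_comm (p.1 ^ j * (p.2 ^ j * f p.2)) (p.1 ^ j)]
    abel
  · simp [Nat.ne_of_gt hj]

theorem removable_smul_of_sq_eq_zero (hk : 1 ≤ k) {N : Matrix n n ℂ} (hN : N * N = 0) (hj : 1 ≤ j)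
    {f : ℂ → ℂ} (hf : Differentiable ℂ f) : Removable k A j fun u => f u • N := by
  obtain ⟨q, h, hh, hq⟩ := exists_polynomial_add_pow_mul hf j
  have := (removable_polynomial_smul (k := k) (A := A) hN hj q).add
    (removable_pow_mul_smul hk hN hj hh)
  refine (congrArg (Removable k A j) ?_).mp this
  funext u
  rw [hq u, add_smul, Pi.add_apply]

/-- The identity and the square-zero matrices span the matrix algebra. -/
theorem mem_of_one_mem_of_sq_zero_mem (S : Submodule ℂ (Matrix n n ℂ)) (h1 : 1 ∈ S)
    (hS : ∀ N : Matrix n n ℂ, N * N = 0 → N ∈ S) (C : Matrix n n ℂ) : C ∈ S := by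
  have hoff : ∀ a b : n, a ≠ b → Matrix.single a b (1 : ℂ) ∈ S := fun a b hab =>
    hS _ (Matrix.single_mul_single_of_ne _ _ _ _ hab.symm _)
  have hdiff : ∀ a b : n, Matrix.single a a (1 : ℂ) - Matrix.single b b 1 ∈ S := by
    intro a b
    rcases eq_or_ne a b with rfl | hab
    · simp
    · have h := hS (Matrix.single a a 1 + Matrix.single a b 1 - Matrix.single b a 1 -
        Matrix.single b b (1 : ℂ)) (by
          simp [mul_sub, sub_mul, mul_add, add_mul, Matrix.single_mul_single_of_ne, hab, hab.symm])
      have h2 := S.add_mem (S.sub_mem h (hoff a b hab)) (hoff b a hab.symm)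
      convert h2 using 1
      abel
  have hdiag : ∀ a : n, Matrix.single a a (1 : ℂ) ∈ S := by
    intro a
    have hc : (Fintype.card n : ℂ) ≠ 0 := by
      have : Nonempty n := ⟨a⟩
      exact_mod_cast Fintype.card_ne_zero
    have h2 : (Fintype.card n : ℂ) • Matrix.single a a (1 : ℂ) =
        1 + ∑ b, (Matrix.single a a (1 : ℂ) - Matrix.single b b 1) := by
      rw [Finset.sum_sub_distrib, Matrix.sum_single_one]
      simp [Nat.cast_smul_eq_nsmul]
    have h3 : (Fintype.card n : ℂ) • Matrix.single a a (1 : ℂ) ∈ S :=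
      h2 ▸ S.add_mem h1 (S.sum_mem fun b _ => hdiff a b)
    exact (S.smul_mem_iff hc).1 h3
  rw [Matrix.matrix_eq_sum_single C]
  refine S.sum_mem fun a _ => S.sum_mem fun b _ => ?_
  have : Matrix.single a b (C a b) = C a b • Matrix.single a b (1 : ℂ) := by
    simp [Matrix.smul_single]
  rw [this]
  refine S.smul_mem _ ?_
  rcases eq_or_ne a b with rfl | hab
  · exact hdiag a
  · exact hoff a b hab

theorem removable_smul (hk : 1 ≤ k) (hj : 1 ≤ j) (C : Matrix n n ℂ) :
    ∀ f : ℂ → ℂ, Differentiable ℂ f → Removable k A j fun u => f u • C := by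
  let S : Submodule ℂ (Matrix n n ℂ) :=
    { carrier := {C | ∀ f : ℂ → ℂ, Differentiable ℂ f → Removable k A j fun u => f u • C}
      zero_mem' := fun f _ => by
        simp only [smul_zero]
        exact removable_zero
      add_mem' := fun {C D} hC hD f hf => by
        simp only [smul_add]
        exact (hC f hf).add (hD f hf)
      smul_mem' := fun c C hC f hf => by
        simpa only [smul_smul] using hC (fun u => f u * c) (hf.mul_const c) }
  exact mem_of_one_mem_of_sq_zero_mem S (fun f hf => removable_smul_one hj hf)
    (fun N hN f hf => removable_smul_of_sq_eq_zero hk hN hj hf) C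

theorem removable_of_differentiable (hk : 1 ≤ k) (hj : 1 ≤ j) {ρ : ℂ → Matrix n n ℂ}
    (hρ : Differentiable ℂ ρ) : Removable k A j ρ := by
  rw [← differentiableOn_univ, differentiableOn_matrix_iff] at hρ
  have : ρ = ∑ a, ∑ b, fun u => ρ u a b • Matrix.single a b (1 : ℂ) := by
    funext u
    conv_lhs => rw [Matrix.matrix_eq_sum_single (ρ u)]
    simp [Matrix.smul_single]
  rw [this]
  exact Removable.sum fun a _ => Removable.sum fun b _ =>
    removable_smul hk hj _ _ (differentiableOn_univ.1 (hρ a b))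

theorem ReducesTo.exists_succ (hk : 1 ≤ k) (hj : 1 ≤ j) {R : ℂ × ℂ → Matrix n n ℂ}
    (hR : Differentiable ℂ R) (h : ReducesTo k A j R) :
    ∃ R' : ℂ × ℂ → Matrix n n ℂ, Differentiable ℂ R' ∧ ReducesTo k A (j + 1) R' := by
  have : CompleteSpace (Matrix n n ℂ) := FiniteDimensional.complete ℂ _
  have h0 : Differentiable ℂ fun u : ℂ => R (0, u) := hR.comp (by fun_prop)
  obtain ⟨R₁, hR₁, h₁, hz⟩ := removable_of_differentiable hk hj h0 R hR h
  obtain ⟨R₂, hR₂, hdiv⟩ := exists_fst_smul hR₁ fun u => by rw [hz, sub_self]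
  obtain ⟨s, B, P, hs, hs0, hB, hP, hPr, hA⟩ := h₁
  refine ⟨R₂, hR₂, s, B, P, hs, hs0, hB, hP, hPr, fun p hp => ?_⟩
  rw [hA p hp, hdiv p, smul_smul, pow_succ]

theorem HolUnit.exists_reducesTo (hk : 1 ≤ k) (hA : HolUnit A univ) (j : ℕ) :
    ∃ R : ℂ × ℂ → Matrix n n ℂ, Differentiable ℂ R ∧ ReducesTo k A (j + 1) R := by
  have : CompleteSpace (Matrix n n ℂ) := FiniteDimensional.complete ℂ _
  induction j with
  | zero =>
    have h0 : Differentiable ℂ fun p : ℂ × ℂ => ((0 : ℂ), p.2) := by fun_prop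
    have hA0 : HolUnit (fun p : ℂ × ℂ => Ring.inverse (A (0, p.2))) univ :=
      hA.inv.comp h0.differentiableOn fun p _ => mem_univ _
    have hV : Differentiable ℂ fun q : ℂ × ℂ => ((0 : ℂ), q.1 ^ k * q.2) := by fun_prop
    obtain ⟨R, hR, hdiv⟩ := exists_fst_smul
      (f := fun p => A p * Ring.inverse (A (0, p.2)) - 1)
      ((differentiableOn_univ.1 (hA.mul hA0).1).sub_const _) fun u => by
        rw [Ring.mul_inverse_cancel _ (hA.2 _ (mem_univ _)), sub_self]
    refine ⟨R, hR, fun _ => 1, fun q => Ring.inverse (A (0, q.1 ^ k * q.2)), fun _ => 1,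
      differentiable_const _, fun _ => one_ne_zero,
      hA.inv.comp hV.differentiableOn fun p _ => mem_univ _, holUnit_const isUnit_one _,
      fun a b => regularOnOverlap_const _, fun p hp => ?_⟩
    have h1 : p.1⁻¹ ^ k * (p.1 ^ k * p.2) = p.2 := by
      rw [← mul_assoc, inv_pow, inv_mul_cancel₀ (pow_ne_zero _ hp), one_mul]
    simp only [coordChange, h1, zero_add, pow_one, one_smul, one_mul, ← hdiv]
    abel
  | succ j ih =>
    obtain ⟨R, hR, h⟩ := ih
    exact h.exists_succ hk (Nat.le_add_left 1 j) hR

end Truncation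

section Algebraization

open Set Metric Filter Topology

attribute [local instance] Matrix.linftyOpNormedRing Matrix.linftyOpNormedAlgebra

variable {n : Type*} [Fintype n] [DecidableEq n]

/-- A remainder divisible by a high power of `z` on the right of a polynomial matrix `L` that is
invertible away from `z = 0` can be moved to its left. -/
theorem one_add_smul_mul_map_eval {M : ℕ} {L L' : Matrix n n (Polynomial ℂ)}
    (h : L * L' = (Polynomial.X ^ M : Polynomial ℂ) • 1) {z : ℂ} (hz : z ≠ 0) (R : Matrix n n ℂ) :
    (1 + z • (L.map (Polynomial.eval z) * R * L'.map (Polynomial.eval z))) *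
        L.map (Polynomial.eval z) =
      L.map (Polynomial.eval z) * (1 + z ^ (M + 1) • R) := by
  have h1 := map_eval_mul_of_mul_eq h z
  have hzM : z ^ M ≠ 0 := pow_ne_zero M hz
  have h2 : L'.map (Polynomial.eval z) * L.map (Polynomial.eval z) = z ^ M • 1 := by
    have h3 : L.map (Polynomial.eval z) * ((z ^ M)⁻¹ • L'.map (Polynomial.eval z)) = 1 := by
      rw [mul_smul_comm, h1, smul_smul, inv_mul_cancel₀ hzM, one_smul]
    have h4 := mul_eq_one_comm.1 h3
    rw [smul_mul_assoc] at h4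
    rw [← h4, smul_smul, mul_inv_cancel₀ hzM, one_smul]
  rw [add_mul, one_mul, smul_mul_assoc, mul_assoc _ (L'.map _) (L.map _), h2, mul_add, mul_one,
    mul_smul_comm, mul_smul_comm, mul_one, smul_smul, pow_succ']

/-- Every transition matrix is equivalent to a regular one. -/
theorem HolUnit.exists_regular {k : ℕ} (hk : 1 ≤ k) {T : ℂ × ℂ → Matrix n n ℂ}
    (hT : HolUnit T overlap) :
    ∃ A B T' : ℂ × ℂ → Matrix n n ℂ, HolUnit A univ ∧ HolUnit B univ ∧ HolUnit T' overlap ∧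
      (∀ i j, RegularOnOverlap fun p => T' p i j) ∧
      ∀ p ∈ overlap, T' p = A p * T p * B (coordChange k p) := by
  have : CompleteSpace (Matrix n n ℂ) := FiniteDimensional.complete ℂ _
  obtain ⟨N, M, L, L', A, B, hL, hA, hB, hTB⟩ := exists_laurent_mul_entire hk hT
  obtain ⟨R, hR, s, B₁, P, hs, hs0, hB₁, hP, hPr, hAB⟩ := hA.exists_reducesTo hk M
  have hPu : ∀ p, IsUnit (P p) := fun p => hP.2 p (mem_univ p)
  have hPd : Differentiable ℂ P := differentiableOn_univ.1 hP.1
  have hPi : Differentiable ℂ fun p => Ring.inverse (P p) := differentiableOn_univ.1 hP.inv.1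
  have hLd : Differentiable ℂ fun p : ℂ × ℂ => L.map (Polynomial.eval p.1) :=
    (differentiable_map_eval L).comp differentiable_fst
  have hLd' : Differentiable ℂ fun p : ℂ × ℂ => L'.map (Polynomial.eval p.1) :=
    (differentiable_map_eval L').comp differentiable_fst
  set Q : ℂ × ℂ → Matrix n n ℂ := fun p => P p * R p * Ring.inverse (P p) with hQ
  have hQd : Differentiable ℂ Q := (hPd.mul hR).mul hPi
  set F : ℂ × ℂ → Matrix n n ℂ := fun p =>
    1 + p.1 • (L.map (Polynomial.eval p.1) * Q p * L'.map (Polynomial.eval p.1)) with hF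
  have hFd : Differentiable ℂ F :=
    (differentiable_const _).add (differentiable_fst.smul ((hLd.mul hQd).mul hLd'))
  have hFL : ∀ p : ℂ × ℂ, p.1 ≠ 0 → F p * (L.map (Polynomial.eval p.1) * P p) =
      s p • (L.map (Polynomial.eval p.1) * A p * B₁ (coordChange k p)) := by
    intro p hp
    have h1 : (1 + p.1 ^ (M + 1) • Q p) * P p = P p * (1 + p.1 ^ (M + 1) • R p) := by
      rw [add_mul, smul_mul_assoc, hQ, mul_assoc _ _ (P p), Ring.inverse_mul_cancel _ (hPu p),
        mul_add, mul_smul_comm, mul_one, one_mul, mul_one]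
    rw [← mul_assoc, hF, one_add_smul_mul_map_eval hL hp, mul_assoc, h1, ← hAB p hp,
      mul_smul_comm, mul_assoc]
  have hFu : ∀ p, IsUnit (F p) := by
    intro p
    by_cases hp : p.1 = 0
    · simp [hF, hp]
    · have hLu := isUnit_map_eval_of_mul_eq hL hp
      have h1 : IsUnit (F p * (L.map (Polynomial.eval p.1) * P p)) := by
        rw [hFL p hp]
        exact isUnit_smul_of_ne_zero (hs0 p)
          ((hLu.mul (hA.2 p (mem_univ p))).mul (hB₁.2 _ (mem_univ _)))
      exact ((hLu.mul (hPu p)).mul_right_iff).1 h1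
  have hFU : HolUnit F univ := ⟨hFd.differentiableOn, fun p _ => hFu p⟩
  have hTd : DifferentiableOn ℂ
      (fun p : ℂ × ℂ => (p.1 ^ N)⁻¹ • (L.map (Polynomial.eval p.1) * P p)) overlap := by
    have h1 : DifferentiableOn ℂ (fun p : ℂ × ℂ => (p.1 ^ N)⁻¹) overlap :=
      (differentiable_fst.pow N).differentiableOn.inv fun p hp => pow_ne_zero N hp
    exact h1.smul (hLd.mul hPd).differentiableOn
  refine ⟨fun p => s p • Ring.inverse (F p), fun q => B q * B₁ q,
    fun p => (p.1 ^ N)⁻¹ • (L.map (Polynomial.eval p.1) * P p),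
    ⟨hs.differentiableOn.smul hFU.inv.1,
      fun p hp => isUnit_smul_of_ne_zero (hs0 p) (hFU.inv.2 p hp)⟩,
    hB.mul hB₁, ⟨hTd, fun p hp => ?_⟩, fun i j => ?_, fun p hp => ?_⟩
  · exact isUnit_smul_of_ne_zero (inv_ne_zero (pow_ne_zero N hp))
      ((isUnit_map_eval_of_mul_eq hL hp).mul (hPu p))
  · simp only [Matrix.smul_apply, smul_eq_mul]
    exact (regularOnOverlap_inv_pow N).mul
      (regularOnOverlap_matrix_mul (fun a b => regularOnOverlap_fst.eval (L a b)) hPr i j)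
  · have h1 := congrArg (Ring.inverse (F p) * ·) (hFL p hp)
    simp only [Ring.inverse_mul_cancel_left _ _ (hFu p)] at h1
    have h2 := hTB p hp
    have h3 : Ring.inverse (F p) * T p * (B (coordChange k p) * B₁ (coordChange k p)) =
        Ring.inverse (F p) * (T p * B (coordChange k p) * B₁ (coordChange k p)) := by
      simp only [mul_assoc]
    simp only [h1, smul_mul_assoc, mul_smul_comm]
    rw [h3, h2, smul_comm, smul_mul_assoc, mul_smul_comm]

theorem BundleData.exists_regular_bIso {r k : ℕ} (hk : 1 ≤ k) (E : BundleData r k) :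
    ∃ E' : BundleData r k, (∀ i j, RegularOnOverlap fun p => E'.T p i j) ∧ BIso E E' := by
  have : CompleteSpace (Matrix (Fin r) (Fin r) ℂ) := FiniteDimensional.complete ℂ _
  obtain ⟨A, B, T, hA, hB, hT, hreg, h⟩ :=
    HolUnit.exists_regular hk ⟨differentiableOn_matrix_iff.2 E.holo, E.invertible⟩
  refine ⟨⟨T, differentiableOn_matrix_iff.1 hT.1, hT.2⟩, hreg, A, fun q => Ring.inverse (B q),
    ⟨differentiableOn_matrix_iff.1 hA.1, hA.2⟩,
    ⟨differentiableOn_matrix_iff.1 hB.inv.1, hB.inv.2⟩, fun p hp => ?_⟩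
  rw [Matrix.nonsing_inv_eq_ringInverse, Ring.inverse_inverse (hB.2 _ (Set.mem_univ _))]
  exact h p hp

end Algebraization

/-- Every holomorphic vector bundle on
`Z_k = Tot 𝒪_{ℙ¹}(-k)` is algebraic: it is holomorphically isomorphic to a
bundle whose transition matrix in canonical coordinates has regular
(algebraic) entries. -/
theorem statement_1 (k : ℕ) (hk : 1 ≤ k) (r : ℕ) (E : BundleData r k) :
    ∃ E' : BundleData r k,
      (∀ i j, RegularOnOverlap fun p => E'.T p i j) ∧ BIso E E' := by
  exact E.exists_regular_bIso hk
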